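/- Let f : D^I_{p,q} → D^I_{p',q'} be a proper holomorphic map, where p ≥ q ≥ 2 and q' < p. Then: (i) f maps every (p,q−1)-subspace of D^I_{p,q} into a (p',q'−1)-subspace of D^I_{p',q'}, i.e. for every pair of column vectors a ∈ ℂ^q, b ∈ ℂ^p with ‖a‖ > ‖b‖ there exist column vectors c ∈ ℂ^{q'}, d ∈ ℂ^{p'} with ‖c‖ > ‖d‖ such that every Z ∈ D^I_{p,q} with Z·a = b satisfies f(Z)·c = d; (ii) q ≤ q'; and (iii) if in addition q' ≤ 2q−1, then p ≤ p'. -/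

import Mathlib

open Matrix
open scoped ComplexOrder

attribute [local instance] Matrix.normedAddCommGroup Matrix.normedSpace

/-- The type-I irreducible bounded symmetric domain `D^I_{m,n}`,
realized as the set of complex `m × n` matrices `Z` with `I - Zᴴ Z` positive definite. -/
def typeIDomain (m n : ℕ) : Set (Matrix (Fin m) (Fin n) ℂ) :=
  {Z | (1 - Zᴴ * Z).PosDef}

/-- `f` maps `D` into `D'` and the `f`-preimage of every compact subset of `D'`
is a compact subset of `D`. -/
def ProperOn {E F : Type*} [TopologicalSpace E] [TopologicalSpace F]
    (f : E → F) (D : Set E) (D' : Set F) : Prop :=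
  Set.MapsTo f D D' ∧ ∀ K : Set F, K ⊆ D' → IsCompact K → IsCompact (D ∩ f ⁻¹' K)

section PartA

/-- squared euclidean norm -/
noncomputable def nsq {ι : Type*} [Fintype ι] (v : ι → ℂ) : ℝ := ∑ i, ‖v i‖ ^ 2

variable {ι κ : Type*} [Fintype ι] [Fintype κ]

theorem nsq_nonneg (v : ι → ℂ) : 0 ≤ nsq v := Finset.sum_nonneg fun _ _ => by positivity

theorem nsq_eq_norm (v : ι → ℂ) : nsq v = ‖(WithLp.toLp 2 v : EuclideanSpace ℂ ι)‖ ^ 2 := by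
  rw [EuclideanSpace.norm_sq_eq]; rfl

theorem nsq_eq_zero {v : ι → ℂ} : nsq v = 0 ↔ v = 0 := by
  rw [nsq, Finset.sum_eq_zero_iff_of_nonneg (fun _ _ => by positivity)]
  constructor
  · intro h; ext i; simpa using h i (Finset.mem_univ _)
  · rintro rfl; simp

@[simp] theorem nsq_zero : nsq (0 : ι → ℂ) = 0 := nsq_eq_zero.2 rfl

theorem nsq_pos {v : ι → ℂ} (h : v ≠ 0) : 0 < nsq v :=
  lt_of_le_of_ne (nsq_nonneg v) (fun h' => h (nsq_eq_zero.1 h'.symm))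

theorem nsq_smul (a : ℂ) (v : ι → ℂ) : nsq (a • v) = ‖a‖ ^ 2 * nsq v := by
  simp [nsq, Finset.mul_sum, mul_pow]

theorem nsq_star (v : ι → ℂ) : nsq (star v) = nsq v := by simp [nsq]

theorem nsq_neg (v : ι → ℂ) : nsq (-v) = nsq v := by simp [nsq]

theorem star_dot_self (v : ι → ℂ) : star v ⬝ᵥ v = (nsq v : ℂ) := by
  simp only [dotProduct, nsq, Pi.star_apply, Complex.ofReal_sum]
  refine Finset.sum_congr rfl fun i _ => ?_
  rw [mul_comm]; simpa using Complex.mul_conj' (v i)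

theorem dot_self_star (v : ι → ℂ) : v ⬝ᵥ star v = (nsq v : ℂ) := by
  rw [dotProduct_comm, star_dot_self]

theorem continuous_nsq : Continuous (nsq : (ι → ℂ) → ℝ) := by unfold nsq; fun_prop

theorem dot_eq_inner (u v : ι → ℂ) :
    star u ⬝ᵥ v = inner ℂ (WithLp.toLp 2 u : EuclideanSpace ℂ ι) (WithLp.toLp 2 v) := by
  rw [EuclideanSpace.inner_toLp_toLp, dotProduct_comm]

theorem cs_dot (u v : ι → ℂ) : ‖u ⬝ᵥ v‖ ^ 2 ≤ nsq u * nsq v := by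
  have h := norm_inner_le_norm (𝕜 := ℂ) (WithLp.toLp 2 (star u) : EuclideanSpace ℂ ι) (WithLp.toLp 2 v)
  rw [← dot_eq_inner, star_star] at h
  rw [← nsq_star u, nsq_eq_norm, nsq_eq_norm, ← mul_pow]
  gcongr

theorem nsq_add (u v : ι → ℂ) : nsq (u + v) = nsq u + 2 * (star u ⬝ᵥ v).re + nsq v := by
  have : ∀ i, ‖u i + v i‖ ^ 2 = ‖u i‖ ^ 2 + 2 * (star (u i) * v i).re + ‖v i‖ ^ 2 := by
    intro i
    simp only [Complex.sq_norm, Complex.normSq_apply]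
    simp; ring
  simp only [nsq, Pi.add_apply, this, Finset.sum_add_distrib, dotProduct, Complex.re_sum,
    Finset.mul_sum, Pi.star_apply]

theorem norm_le_sqrt_nsq (v : ι → ℂ) (i : ι) : ‖v i‖ ^ 2 ≤ nsq v :=
  Finset.single_le_sum (f := fun i => ‖v i‖ ^ 2) (fun _ _ => by positivity) (Finset.mem_univ i)

variable {m n : ℕ}

theorem quad_eq (Z : Matrix (Fin m) (Fin n) ℂ) (v : Fin n → ℂ) :
    star v ⬝ᵥ ((1 - Zᴴ * Z) *ᵥ v) = ((nsq v - nsq (Z *ᵥ v) : ℝ) : ℂ) := by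
  rw [sub_mulVec, dotProduct_sub, one_mulVec, star_dot_self, ← mulVec_mulVec, dotProduct_mulVec,
    ← star_mulVec, star_dot_self]
  push_cast; rfl

theorem mem_D {Z : Matrix (Fin m) (Fin n) ℂ} :
    Z ∈ typeIDomain m n ↔ ∀ v, v ≠ 0 → nsq (Z *ᵥ v) < nsq v := by
  unfold typeIDomain
  rw [Set.mem_ofPred_eq, Matrix.posDef_iff_dotProduct_mulVec]
  constructor
  · rintro ⟨_, h⟩ v hv
    have := h hv
    rw [quad_eq] at this
    have := Complex.zero_lt_real.1 this
    linarith
  · intro h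
    refine ⟨?_, fun v hv => ?_⟩
    · simp [IsHermitian, conjTranspose_sub, conjTranspose_mul]
    · rw [quad_eq]
      exact Complex.zero_lt_real.2 (by linarith [h v hv])

theorem D_le {Z : Matrix (Fin m) (Fin n) ℂ} (h : Z ∈ typeIDomain m n) (v) :
    nsq (Z *ᵥ v) ≤ nsq v := by
  by_cases hv : v = 0
  · simp [hv]
  · exact (mem_D.1 h v hv).le

theorem mem_D_row {Z : Matrix (Fin m) (Fin n) ℂ} (h : Z ∈ typeIDomain m n) (y : Fin m → ℂ)
    (hy : y ≠ 0) : nsq (y ᵥ* Z) < nsq y := by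
  set u := star (y ᵥ* Z) with hu
  by_cases h0 : u = 0
  · rw [← nsq_star, ← hu, h0]; simpa using nsq_pos hy
  have h1 : ‖y ⬝ᵥ (Z *ᵥ u)‖ ^ 2 = (nsq u) ^ 2 := by
    rw [dotProduct_mulVec, hu, dot_self_star, nsq_star]
    simp [abs_of_nonneg (nsq_nonneg _)]
  have h2 := cs_dot y (Z *ᵥ u)
  have h3 := mem_D.1 h u h0
  rw [← nsq_star (y ᵥ* Z), ← hu]
  have h4 := nsq_pos h0
  have h5 := nsq_pos hy
  by_contra hc
  push Not at hc
  nlinarith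

theorem mem_D_of_row {Z : Matrix (Fin m) (Fin n) ℂ}
    (h : ∀ y : Fin m → ℂ, y ≠ 0 → nsq (y ᵥ* Z) < nsq y) : Z ∈ typeIDomain m n := by
  rw [mem_D]
  intro v hv
  set u := star (Z *ᵥ v) with hu
  by_cases h0 : u = 0
  · rw [← nsq_star, ← hu, h0]; simpa using nsq_pos hv
  have h1 : ‖u ⬝ᵥ (Z *ᵥ v)‖ ^ 2 = (nsq u) ^ 2 := by
    rw [hu, star_dot_self, nsq_star]
    simp [abs_of_nonneg (nsq_nonneg _)]
  rw [dotProduct_mulVec] at h1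
  have h2 := cs_dot (u ᵥ* Z) v
  have h3 := h u h0
  rw [← nsq_star (Z *ᵥ v), ← hu]
  have h4 := nsq_pos h0
  have h5 := nsq_pos hv
  by_contra hc
  push Not at hc
  nlinarith

/-- matrix to continuous linear map -/
noncomputable def toC (m n : ℕ) : Matrix (Fin m) (Fin n) ℂ →ₗ[ℂ]
    (EuclideanSpace ℂ (Fin n) →L[ℂ] EuclideanSpace ℂ (Fin m)) :=
  (LinearMap.toContinuousLinearMap (𝕜 := ℂ)).toLinearMap ∘ₗ (Matrix.toEuclideanLin).toLinearMap

/-- operator norm -/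
noncomputable def opN (Z : Matrix (Fin m) (Fin n) ℂ) : ℝ := ‖toC m n Z‖

theorem toC_apply (Z : Matrix (Fin m) (Fin n) ℂ) (v : Fin n → ℂ) :
    toC m n Z (WithLp.toLp 2 v) = WithLp.toLp 2 (Z *ᵥ v) := by
  simp [toC]

theorem continuous_opN : Continuous (opN : Matrix (Fin m) (Fin n) ℂ → ℝ) :=
  (LinearMap.continuous_of_finiteDimensional (toC m n)).norm

theorem nsq_mulVec_le (Z : Matrix (Fin m) (Fin n) ℂ) (v : Fin n → ℂ) :
    nsq (Z *ᵥ v) ≤ opN Z ^ 2 * nsq v := by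
  rw [nsq_eq_norm, nsq_eq_norm, ← mul_pow, ← toC_apply]
  gcongr
  exact (toC m n Z).le_opNorm _

theorem opN_nonneg (Z : Matrix (Fin m) (Fin n) ℂ) : 0 ≤ opN Z := norm_nonneg _

theorem opN_attained (Z : Matrix (Fin m) (Fin n) ℂ) (h : 0 < opN Z) :
    ∃ v, nsq v = 1 ∧ nsq (Z *ᵥ v) = opN Z ^ 2 := by
  have hne : Nontrivial (EuclideanSpace ℂ (Fin n)) := by
    by_contra hc
    rw [not_nontrivial_iff_subsingleton] at hc
    have : toC m n Z = 0 := by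
      ext v; rw [Subsingleton.elim v 0]; simp
    simp [opN, this] at h
  have hc : IsCompact (Metric.sphere (0 : EuclideanSpace ℂ (Fin n)) 1) := isCompact_sphere _ _
  obtain ⟨v, hv, hmax⟩ := hc.exists_isMaxOn (NormedSpace.sphere_nonempty.2 zero_le_one)
    (f := fun v => ‖toC m n Z v‖) (by fun_prop)
  have hv' : ‖v‖ = 1 := by simpa using hv
  have hle : opN Z ≤ ‖toC m n Z v‖ := by
    refine ContinuousLinearMap.opNorm_le_of_unit_norm (𝕜 := ℂ) (norm_nonneg _) ?_
    intro x hx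
    exact hmax (by simpa using hx)
  have hge : ‖toC m n Z v‖ ≤ opN Z := by
    have := (toC m n Z).le_opNorm v
    rwa [hv', mul_one] at this
  refine ⟨WithLp.ofLp v, ?_, ?_⟩
  · rw [nsq_eq_norm]; simp [hv']
  · rw [nsq_eq_norm, ← toC_apply]
    rw [le_antisymm hle hge]

theorem mem_D_iff {Z : Matrix (Fin m) (Fin n) ℂ} : Z ∈ typeIDomain m n ↔ opN Z < 1 := by
  rw [mem_D]
  constructor
  · intro h
    by_contra hc
    push Not at hc
    obtain ⟨v, hv, hv2⟩ := opN_attained Z (by linarith)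
    have := h v (by rintro rfl; simp at hv)
    rw [hv, hv2] at this
    nlinarith
  · intro h v hv
    refine lt_of_le_of_lt (nsq_mulVec_le Z v) ?_
    have h1 := nsq_pos hv
    have h2 := opN_nonneg Z
    have h3 : opN Z ^ 2 < 1 := by nlinarith
    nlinarith

theorem isOpen_D : IsOpen (typeIDomain m n) := by
  have : typeIDomain m n = opN ⁻¹' Set.Iio 1 := by ext Z; exact mem_D_iff
  rw [this]; exact isOpen_Iio.preimage continuous_opN

theorem zero_mem_D : (0 : Matrix (Fin m) (Fin n) ℂ) ∈ typeIDomain m n := by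
  rw [mem_D_iff]; simp [opN]

theorem convex_D : Convex ℝ (typeIDomain m n) := by
  have : typeIDomain m n = ((toC m n).restrictScalars ℝ) ⁻¹' Metric.ball 0 1 := by
    ext Z; rw [mem_D_iff]; simp [opN]
  rw [this]
  exact (convex_ball _ _).linear_preimage _

theorem entry_le (Z : Matrix (Fin m) (Fin n) ℂ) (i j) : ‖Z i j‖ ≤ opN Z := by
  have h := nsq_mulVec_le Z (Pi.single j 1)
  have h1 : nsq (Pi.single j (1:ℂ) : Fin n → ℂ) = 1 := by
    rw [nsq, Finset.sum_eq_single j] <;> simp +contextual [Pi.single_apply]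
  have h2 := norm_le_sqrt_nsq (Z *ᵥ (Pi.single j 1)) i
  simp only [mulVec_single_one, col_apply] at h2 h
  rw [h1] at h
  exact abs_le_of_sq_le_sq' (by linarith) (opN_nonneg Z) |>.2

theorem norm_le_opN (Z : Matrix (Fin m) (Fin n) ℂ) : ‖Z‖ ≤ opN Z :=
  (Matrix.norm_le_iff (opN_nonneg Z)).2 fun i j => entry_le Z i j

theorem isCompact_opN (r : ℝ) : IsCompact {Z : Matrix (Fin m) (Fin n) ℂ | opN Z ≤ r} := by
  have : ProperSpace (Matrix (Fin m) (Fin n) ℂ) := FiniteDimensional.proper ℂ _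
  refine Metric.isCompact_of_isClosed_isBounded (isClosed_le continuous_opN continuous_const) ?_
  refine (Metric.isBounded_closedBall (x := (0 : Matrix (Fin m) (Fin n) ℂ)) (r := r)).subset ?_
  intro Z hZ
  simpa using (norm_le_opN Z).trans hZ

end PartA

section PartB

open Metric Set Filter Topology

variable {E F : Type} [NormedAddCommGroup E] [NormedSpace ℂ E]
  [NormedAddCommGroup F] [NormedSpace ℂ F]

theorem holo_ident [CompleteSpace F] {U : Set E} (hU : IsOpen U) (hc : Convex ℝ U) {f : E → F}
    (hf : DifferentiableOn ℂ f U) {z₀ : E} (hz₀ : z₀ ∈ U) (h0 : f =ᶠ[𝓝 z₀] 0) :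
    ∀ z ∈ U, f z = 0 := by
  intro z hz
  let a : ℂ → E := fun s => z₀ + s • (z - z₀)
  have hac : Continuous a := by fun_prop
  have had : Differentiable ℂ a := by fun_prop
  have hV : IsOpen (a ⁻¹' U) := hU.preimage hac
  have hVc : Convex ℝ (a ⁻¹' U) := by
    have : a ⁻¹' U = (LinearMap.toSpanSingleton ℂ E (z - z₀)).restrictScalars ℝ ⁻¹'
        ((fun x => z₀ + x) ⁻¹' U) := by ext s; simp [a]
    rw [this]
    exact (hc.translate_preimage_right z₀).linear_preimage _
  have hg : DifferentiableOn ℂ (f ∘ a) (a ⁻¹' U) :=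
    hf.comp had.differentiableOn (mapsTo_preimage _ _)
  have h1 := (hg.analyticOnNhd hV).eqOn_zero_of_preconnected_of_eventuallyEq_zero
    hVc.isPreconnected (z₀ := 0) (by simpa [a] using hz₀)
    ((hac.tendsto' 0 z₀ (by simp [a])).eventually h0)
  have := h1 (x := 1) (by simpa [a] using hz)
  simpa [a] using this

variable [FiniteDimensional ℂ E] [FiniteDimensional ℂ F]

theorem holo_fderiv_apply {U : Set E} (hU : IsOpen U) {f : E → F} (hf : DifferentiableOn ℂ f U)
    (Y : E) : DifferentiableOn ℂ (fun z => fderiv ℂ f z Y) U := by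
  have : CompleteSpace F := FiniteDimensional.complete ℂ F
  have : CompleteSpace E := FiniteDimensional.complete ℂ E
  intro z₀ hz₀
  -- ball where f is close to f z₀
  have hfd : ∀ z ∈ U, DifferentiableAt ℂ f z := fun z hz => (hf z hz).differentiableAt (hU.mem_nhds hz)
  obtain ⟨r, hr, hrU⟩ : ∃ r > 0, ball z₀ r ⊆ U ∩ f ⁻¹' ball (f z₀) 1 :=
    Metric.mem_nhds_iff.1 (inter_mem (hU.mem_nhds hz₀)
      ((hfd z₀ hz₀).continuousAt.preimage_mem_nhds (ball_mem_nhds _ one_pos)))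
  obtain ⟨ρ, hρ, hρr⟩ : ∃ ρ > 0, 4 * ρ = r := ⟨r / 4, by positivity, by ring⟩
  have hball : ∀ w ∈ ball z₀ (3 * ρ), ball w ρ ⊆ ball z₀ r := by
    intro w hw; apply ball_subset_ball'; rw [mem_ball] at hw; linarith
  have hfb : ∀ w ∈ ball z₀ (3 * ρ), ‖fderiv ℂ f w‖ ≤ 2 / ρ := by
    intro w hw
    refine Complex.norm_fderiv_le_div_of_mapsTo_ball
      (hf.mono fun x hx => (hrU (hball w hw hx)).1) ?_ hρ
    intro x hx
    have h1 := (hrU (hball w hw hx)).2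
    have h2 := (hrU (hball w hw (mem_ball_self hρ))).2
    simp only [mem_preimage, mem_ball] at h1 h2
    rw [mem_closedBall]
    linarith [dist_triangle_right (f x) (f w) (f z₀)]
  obtain ⟨ε, hε, hεY⟩ : ∃ ε > 0, ε * ‖Y‖ < ρ := by
    refine ⟨ρ / (‖Y‖ + 1), by positivity, ?_⟩
    rw [div_mul_eq_mul_div, div_lt_iff₀ (by positivity)]; nlinarith [norm_nonneg Y]
  have hmem : ∀ z ∈ ball z₀ (2 * ρ), ∀ s : ℂ, ‖s‖ ≤ ε → z + s • Y ∈ ball z₀ (3 * ρ) := by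
    intro z hz s hs
    rw [mem_ball, dist_eq_norm] at hz ⊢
    have h1 : ‖z + s • Y - z₀‖ ≤ ‖z - z₀‖ + ‖s • Y‖ := by
      rw [show z + s • Y - z₀ = (z - z₀) + s • Y by abel]; exact norm_add_le _ _
    rw [norm_smul] at h1
    nlinarith [norm_nonneg Y, mul_le_mul_of_nonneg_right hs (norm_nonneg Y)]
  have h3U : ball z₀ (3 * ρ) ⊆ U := fun x hx => (hrU (ball_subset_ball (by linarith) hx)).1
  let G : E → ℝ → F := fun z θ => deriv (circleMap 0 ε) θ •
    ((circleMap 0 ε θ - 0) ^ 2)⁻¹ • f (z + circleMap 0 ε θ • Y)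
  let G' : E → ℝ → E →L[ℂ] F := fun z θ => (deriv (circleMap 0 ε) θ *
    ((circleMap 0 ε θ - 0) ^ 2)⁻¹) • fderiv ℂ f (z + circleMap 0 ε θ • Y)
  have hcn : ∀ θ, ‖circleMap 0 ε θ‖ = ε := fun θ => by simp [abs_of_pos hε]
  have hcont : ∀ z ∈ ball z₀ (2 * ρ), Continuous (G z) := by
    intro z hz
    have h1 : Continuous fun θ => f (z + circleMap 0 ε θ • Y) := by
      rw [continuous_iff_continuousAt]
      intro θ
      have : ContinuousAt f (z + circleMap 0 ε θ • Y) :=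
        (hfd _ (h3U (hmem z hz _ (hcn θ).le))).continuousAt
      exact ContinuousAt.comp (f := fun θ => z + circleMap 0 ε θ • Y) this (by fun_prop)
    have h2 : Continuous fun θ => ((circleMap 0 ε θ - 0) ^ 2)⁻¹ := by
      refine Continuous.inv₀ (by fun_prop) fun θ => ?_
      have := hcn θ
      simp only [sub_zero]
      intro h; rw [pow_eq_zero_iff (by norm_num)] at h; rw [h] at this; simp at this; linarith
    have h3 : Continuous (deriv (circleMap 0 ε)) := by
      have : deriv (circleMap 0 ε) = fun θ => circleMap 0 ε θ * Complex.I := by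
        ext θ; simp [deriv_circleMap]
      rw [this]; fun_prop
    exact h3.smul (h2.smul h1)
  have key : HasFDerivAt (fun z => ∫ θ in (0:ℝ)..(2 * Real.pi), G z θ)
      (∫ θ in (0:ℝ)..(2 * Real.pi), G' z₀ θ) z₀ := by
    refine intervalIntegral.hasFDerivAt_integral_of_dominated_of_fderiv_le (s := ball z₀ (2 * ρ))
      (bound := fun _ => ε * (ε ^ 2)⁻¹ * (2 / ρ)) (ball_mem_nhds _ (by positivity)) ?_ ?_ ?_ ?_ ?_ ?_
    · filter_upwards [ball_mem_nhds z₀ (by positivity : 0 < 2 * ρ)] with z hz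
      exact (hcont z hz).aestronglyMeasurable
    · exact (hcont z₀ (mem_ball_self (by positivity))).intervalIntegrable _ _
    · borelize E
      borelize (E →L[ℂ] F)
      have : ProperSpace (E →L[ℂ] F) := FiniteDimensional.proper ℂ _
      have h1 : Measurable fun θ => fderiv ℂ f (z₀ + circleMap 0 ε θ • Y) :=
        (measurable_fderiv ℂ f).comp (by fun_prop)
      have h3 : Continuous (deriv (circleMap 0 ε)) := by
        have : deriv (circleMap 0 ε) = fun θ => circleMap 0 ε θ * Complex.I := by
          ext θ; simp [deriv_circleMap]
        rw [this]; fun_prop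
      have h2 : Measurable fun θ => (deriv (circleMap 0 ε) θ * ((circleMap 0 ε θ - 0) ^ 2)⁻¹) := by
        refine h3.measurable.mul (Measurable.inv ?_)
        exact Continuous.measurable (by fun_prop)
      exact (h2.smul h1).aestronglyMeasurable
    · refine Eventually.of_forall fun θ _ z hz => ?_
      simp only [G', norm_smul]
      gcongr
      · simp [deriv_circleMap, abs_of_pos hε]
      · exact hfb _ (hmem z hz _ (hcn θ).le)
    · exact intervalIntegrable_const
    · refine Eventually.of_forall fun θ _ z hz => ?_
      have h1 := (hfd _ (h3U (hmem z hz _ (hcn θ).le))).hasFDerivAt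
      have h2 : HasFDerivAt (fun z => f (z + circleMap 0 ε θ • Y))
          (fderiv ℂ f (z + circleMap 0 ε θ • Y)) z := by
        have h3 : HasFDerivAt (fun z => z + circleMap 0 ε θ • Y) (ContinuousLinearMap.id ℂ E) z :=
          (hasFDerivAt_id z).add_const _
        exact h1.comp z h3
      have h4 := h2.const_smul (deriv (circleMap 0 ε) θ * ((circleMap 0 ε θ - 0) ^ 2)⁻¹)
      refine h4.congr_of_eventuallyEq (Eventually.of_forall fun x => ?_)
      simp only [G, smul_smul, Pi.smul_apply]
  have heq : (fun z => fderiv ℂ f z Y) =ᶠ[𝓝 z₀]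
      fun z => (2 * Real.pi * Complex.I : ℂ)⁻¹ • ∫ θ in (0:ℝ)..(2 * Real.pi), G z θ := by
    filter_upwards [ball_mem_nhds z₀ (by positivity : 0 < 2 * ρ)] with z hz
    have hac : Continuous fun s : ℂ => z + s • Y := by fun_prop
    have had : Differentiable ℂ fun s : ℂ => z + s • Y := by fun_prop
    have := Complex.two_pi_I_inv_smul_circleIntegral_sub_sq_inv_smul_of_differentiable
      (U := (fun s : ℂ => z + s • Y) ⁻¹' U) (hU.preimage hac) (c := 0) (w₀ := 0) (R := ε)
      (f := f ∘ fun s : ℂ => z + s • Y)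
      (fun s hs => h3U (hmem z hz s (by simpa using hs)))
      (hf.comp had.differentiableOn (mapsTo_preimage _ _)) (mem_ball_self hε)
    have hzU : z ∈ U := h3U (ball_subset_ball (by linarith) hz)
    have h2 : deriv (f ∘ fun s : ℂ => z + s • Y) 0 = fderiv ℂ f z Y := by
      have h3 : HasFDerivAt f (fderiv ℂ f z) (z + (0:ℂ) • Y) := by simpa using (hfd z hzU).hasFDerivAt
      have h4 : HasDerivAt (fun s : ℂ => z + s • Y) Y 0 := by
        simpa using ((hasDerivAt_id (0:ℂ)).smul_const Y).const_add z
      exact (h3.comp_hasDerivAt _ h4).deriv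
    rw [← h2, ← this]
    rfl
  exact ((key.differentiableAt.const_smul _).congr_of_eventuallyEq heq).differentiableWithinAt

theorem holo_contDiffOn {U : Set E} (hU : IsOpen U) (n : ℕ) : ∀ {f : E → F},
    DifferentiableOn ℂ f U → ContDiffOn ℂ n f U := by
  induction n with
  | zero => intro f hf; simpa using hf.continuousOn
  | succ n ih =>
    intro f hf
    have := (contDiffOn_succ_iff_fderiv_of_isOpen (𝕜 := ℂ) (n := n) (f := f) hU).2
      ⟨hf, by simp, contDiffOn_clm_apply.2 fun Y => ih (holo_fderiv_apply hU hf Y)⟩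
    simpa using this

/-- iterated directional derivative -/
noncomputable def Dir (X : E) (f : E → F) : E → F := fun z => fderiv ℂ f z X

theorem holo_Dir_iter {U : Set E} (hU : IsOpen U) {f : E → F} (hf : DifferentiableOn ℂ f U)
    (X : E) (k : ℕ) : DifferentiableOn ℂ ((Dir X)^[k] f) U := by
  induction k with
  | zero => exact hf
  | succ k ih => rw [Function.iterate_succ_apply']; exact holo_fderiv_apply hU ih X

theorem iteratedFDeriv_eq_Dir {U : Set E} (hU : IsOpen U) {f : E → F} (hf : DifferentiableOn ℂ f U)
    (X : E) (k : ℕ) : ∀ z ∈ U, iteratedFDeriv ℂ k f z (fun _ => X) = (Dir X)^[k] f z := by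
  induction k with
  | zero => intro z _; simp
  | succ k ih =>
    intro z hz
    have h1 : DifferentiableAt ℂ (iteratedFDeriv ℂ k f) z :=
      ((holo_contDiffOn hU (k+1) hf).contDiffAt (hU.mem_nhds hz)).differentiableAt_iteratedFDeriv
        (by exact_mod_cast Nat.lt_succ_self k)
    rw [DifferentiableAt.iteratedFDeriv_succ_apply_left' h1, Function.iterate_succ_apply', Dir]
    have : (fun x => iteratedFDeriv ℂ k f x (Fin.tail fun _ : Fin (k+1) => X)) =ᶠ[𝓝 z]
        (Dir X)^[k] f := by
      filter_upwards [hU.mem_nhds hz] with x hx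
      exact ih x hx
    rw [this.fderiv_eq]

theorem deriv_line {f : E → F} {z X : E} {s : ℂ} (h : DifferentiableAt ℂ f (z + s • X)) :
    HasDerivAt (fun s : ℂ => f (z + s • X)) (Dir X f (z + s • X)) s := by
  have h4 : HasDerivAt (fun s : ℂ => z + s • X) X s := by
    simpa using ((hasDerivAt_id s).smul_const X).const_add z
  exact h.hasFDerivAt.comp_hasDerivAt _ h4

theorem iteratedDeriv_line {U : Set E} (hU : IsOpen U) {f : E → F} (hf : DifferentiableOn ℂ f U)
    (z X : E) (k : ℕ) : ∀ s : ℂ, z + s • X ∈ U →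
      iteratedDeriv k (fun s : ℂ => f (z + s • X)) s = (Dir X)^[k] f (z + s • X) := by
  induction k with
  | zero => intro s _; simp
  | succ k ih =>
    intro s hs
    have hac : Continuous fun s : ℂ => z + s • X := by fun_prop
    rw [iteratedDeriv_succ, Function.iterate_succ_apply']
    have : iteratedDeriv k (fun s : ℂ => f (z + s • X)) =ᶠ[𝓝 s]
        fun s => (Dir X)^[k] f (z + s • X) := by
      filter_upwards [(hU.preimage hac).mem_nhds hs] with t ht
      exact ih t ht
    rw [this.deriv_eq]
    exact (deriv_line (((holo_Dir_iter hU hf X k) _ hs).differentiableAt (hU.mem_nhds hs))).deriv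

end PartB

section PartC

open Set

variable {p q p' q' m n : ℕ}

/-- proper holomorphic -/
structure PH (p q p' q' : ℕ) (f : Matrix (Fin p) (Fin q) ℂ → Matrix (Fin p') (Fin q') ℂ) : Prop where
  diff : DifferentiableOn ℂ f (typeIDomain p q)
  maps : MapsTo f (typeIDomain p q) (typeIDomain p' q')
  comp : ∀ K ⊆ typeIDomain p' q', IsCompact K → IsCompact (typeIDomain p q ∩ f ⁻¹' K)

theorem matrix_diff {E : Type*} [NormedAddCommGroup E] [NormedSpace ℂ E] {s : Set E}
    {f : E → Matrix (Fin m) (Fin n) ℂ} :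
    DifferentiableOn ℂ f s ↔ ∀ i j, DifferentiableOn ℂ (fun x => f x i j) s := by
  constructor
  · intro h i j
    exact differentiableOn_pi.1 (differentiableOn_pi.1 h i) j
  · intro h
    exact differentiableOn_pi.2 fun i => differentiableOn_pi.2 fun j => h i j

theorem mul_diff {E : Type*} [NormedAddCommGroup E] [NormedSpace ℂ E] {s : Set E} {l : ℕ}
    {f : E → Matrix (Fin m) (Fin n) ℂ} {g : E → Matrix (Fin n) (Fin l) ℂ}
    (hf : DifferentiableOn ℂ f s) (hg : DifferentiableOn ℂ g s) :
    DifferentiableOn ℂ (fun x => f x * g x) s := by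
  rw [matrix_diff] at *
  intro i j
  simp only [Matrix.mul_apply]
  exact DifferentiableOn.fun_sum fun k _ => (hf i k).mul (hg k j)

theorem det_diff {E : Type*} [NormedAddCommGroup E] [NormedSpace ℂ E] {s : Set E}
    {ι : Type*} [Fintype ι] [DecidableEq ι]
    {f : E → Matrix ι ι ℂ} (hf : ∀ i j, DifferentiableOn ℂ (fun x => f x i j) s) :
    DifferentiableOn ℂ (fun x => (f x).det) s := by
  simp only [Matrix.det_apply]
  refine DifferentiableOn.fun_sum fun σ _ => DifferentiableOn.const_smul ?_ _
  intro x hx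
  exact (HasFDerivWithinAt.finsetProd (g := fun i x => f x (σ i) i)
    fun i _ => (hf (σ i) i x hx).hasFDerivWithinAt).differentiableWithinAt

theorem adj_diff {E : Type*} [NormedAddCommGroup E] [NormedSpace ℂ E] {s : Set E}
    {ι : Type*} [Fintype ι] [DecidableEq ι]
    {f : E → Matrix ι ι ℂ} (hf : ∀ i j, DifferentiableOn ℂ (fun x => f x i j) s) (i j : ι) :
    DifferentiableOn ℂ (fun x => (f x).adjugate i j) s := by
  simp only [Matrix.adjugate_apply]
  refine det_diff fun k l => ?_
  simp only [updateRow_apply]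
  split_ifs
  · exact differentiableOn_const _
  · exact hf _ _

theorem vec_diff {E : Type*} [NormedAddCommGroup E] [NormedSpace ℂ E] {s : Set E}
    {f : E → Matrix (Fin m) (Fin n) ℂ} {g : E → Fin n → ℂ}
    (hf : DifferentiableOn ℂ f s) (hg : DifferentiableOn ℂ g s) :
    DifferentiableOn ℂ (fun x => f x *ᵥ g x) s := by
  rw [matrix_diff] at hf
  rw [differentiableOn_pi] at *
  intro i
  simp only [Matrix.mulVec, dotProduct]
  exact DifferentiableOn.fun_sum fun k _ => (hf i k).mul (hg k)

/-- row covector of the reflection -/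
noncomputable def rY (w1 : Fin q → ℂ) (w2 : Fin p → ℂ) (Z : Matrix (Fin p) (Fin q) ℂ) : Fin q → ℂ :=
  star w1 - star w2 ᵥ* Z
/-- denominator of the reflection -/
noncomputable def rT (w1 : Fin q → ℂ) (w2 : Fin p → ℂ) (Z : Matrix (Fin p) (Fin q) ℂ) :
    Matrix (Fin q) (Fin q) ℂ := 1 - (2 / ((nsq w1 - nsq w2 : ℝ) : ℂ)) • vecMulVec w1 (rY w1 w2 Z)
/-- numerator of the reflection -/
noncomputable def rU (w1 : Fin q → ℂ) (w2 : Fin p → ℂ) (Z : Matrix (Fin p) (Fin q) ℂ) :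
    Matrix (Fin p) (Fin q) ℂ := Z - (2 / ((nsq w1 - nsq w2 : ℝ) : ℂ)) • vecMulVec w2 (rY w1 w2 Z)
/-- the reflection automorphism -/
noncomputable def rPhi (w1 : Fin q → ℂ) (w2 : Fin p → ℂ) (Z : Matrix (Fin p) (Fin q) ℂ) :
    Matrix (Fin p) (Fin q) ℂ := rU w1 w2 Z * (rT w1 w2 Z)⁻¹
/-- the linear reflection -/
noncomputable def rG (w1 : Fin q → ℂ) (w2 : Fin p → ℂ) :
    ((Fin q → ℂ) × (Fin p → ℂ)) →ₗ[ℂ] ((Fin q → ℂ) × (Fin p → ℂ)) where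
  toFun x := x - (2 / ((nsq w1 - nsq w2 : ℝ) : ℂ) * (star w1 ⬝ᵥ x.1 - star w2 ⬝ᵥ x.2)) • (w1, w2)
  map_add' x y := by
    simp only [Prod.fst_add, Prod.snd_add, dotProduct_add]; module
  map_smul' c x := by
    simp only [Prod.smul_fst, Prod.smul_snd, dotProduct_smul, RingHom.id_apply, smul_eq_mul]; module

section
variable {w1 : Fin q → ℂ} {w2 : Fin p → ℂ} {Z : Matrix (Fin p) (Fin q) ℂ}

theorem rY_dot (v : Fin q → ℂ) : rY w1 w2 Z ⬝ᵥ v = star w1 ⬝ᵥ v - star w2 ⬝ᵥ (Z *ᵥ v) := by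
  rw [rY, sub_dotProduct, dotProduct_mulVec]

theorem rT_mulVec (v : Fin q → ℂ) : rT w1 w2 Z *ᵥ v =
    v - (2 / ((nsq w1 - nsq w2 : ℝ) : ℂ) * (rY w1 w2 Z ⬝ᵥ v)) • w1 := by
  rw [rT, sub_mulVec, one_mulVec, smul_mulVec, vecMulVec_mulVec]
  ext i; simp; ring

theorem rU_mulVec (v : Fin q → ℂ) : rU w1 w2 Z *ᵥ v =
    Z *ᵥ v - (2 / ((nsq w1 - nsq w2 : ℝ) : ℂ) * (rY w1 w2 Z ⬝ᵥ v)) • w2 := by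
  rw [rU, sub_mulVec, smul_mulVec, vecMulVec_mulVec]
  ext i; simp; ring

theorem dot_star_swap {ι : Type*} [Fintype ι] (u v : ι → ℂ) :
    star (star u ⬝ᵥ v) = star v ⬝ᵥ u := by
  rw [star_dotProduct, star_star, dotProduct_comm]

theorem rform (hω : nsq w1 - nsq w2 ≠ 0) (v : Fin q → ℂ) :
    nsq (rT w1 w2 Z *ᵥ v) - nsq (rU w1 w2 Z *ᵥ v) = nsq v - nsq (Z *ᵥ v) := by
  rw [rT_mulVec, rU_mulVec]
  set ω := nsq w1 - nsq w2 with hω'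
  set s := (2 / (ω : ℂ) * (rY w1 w2 Z ⬝ᵥ v)) with hs
  have h1 : star v ⬝ᵥ w1 - star (Z *ᵥ v) ⬝ᵥ w2 = star s * (ω / 2) := by
    rw [← dot_star_swap w1, ← dot_star_swap w2, ← star_sub, ← rY_dot, hs]
    have : (ω : ℂ) ≠ 0 := by exact_mod_cast hω
    simp only [star_mul', star_div₀, Complex.star_def, Complex.conj_ofReal, map_ofNat]
    field_simp
  rw [sub_eq_add_neg v, sub_eq_add_neg (Z *ᵥ v), nsq_add, nsq_add, nsq_neg, nsq_neg, nsq_smul, nsq_smul,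
    dotProduct_neg, dotProduct_neg, dotProduct_smul, dotProduct_smul]
  have h2 : (s • (star v ⬝ᵥ w1)).re - (s • (star (Z *ᵥ v) ⬝ᵥ w2)).re = ‖s‖ ^ 2 * ω / 2 := by
    rw [← Complex.sub_re, ← smul_sub, h1, smul_eq_mul, ← mul_assoc, Complex.star_def,
      Complex.mul_conj', ← Complex.ofReal_pow, ← Complex.ofReal_ofNat, ← Complex.ofReal_div, ← Complex.ofReal_mul, Complex.ofReal_re]
    ring
  simp only [Complex.neg_re]
  have h3 : ‖s‖ ^ 2 * nsq w1 - ‖s‖ ^ 2 * nsq w2 = ‖s‖ ^ 2 * ω := by rw [hω']; ring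
  linarith

theorem rT_unit (hω : nsq w1 - nsq w2 ≠ 0) (hZ : Z ∈ typeIDomain p q) :
    IsUnit (rT w1 w2 Z).det := by
  rw [isUnit_iff_ne_zero]
  intro h
  obtain ⟨v, hv, hv2⟩ := Matrix.exists_mulVec_eq_zero_iff.2 h
  have h1 := rform (Z := Z) hω v
  rw [hv2] at h1
  have h2 := mem_D.1 hZ v hv
  have h3 := nsq_nonneg (rU w1 w2 Z *ᵥ v)
  simp at h1
  linarith

theorem rPhi_mul (hω : nsq w1 - nsq w2 ≠ 0) (hZ : Z ∈ typeIDomain p q) :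
    rPhi w1 w2 Z * rT w1 w2 Z = rU w1 w2 Z := by
  rw [rPhi, Matrix.mul_assoc, nonsing_inv_mul _ (rT_unit hω hZ), Matrix.mul_one]

theorem rPhi_mem (hω : nsq w1 - nsq w2 ≠ 0) (hZ : Z ∈ typeIDomain p q) :
    rPhi w1 w2 Z ∈ typeIDomain p q := by
  rw [mem_D]
  intro u hu
  set v := (rT w1 w2 Z)⁻¹ *ᵥ u with hv
  have hTv : rT w1 w2 Z *ᵥ v = u := by
    rw [hv, mulVec_mulVec, mul_nonsing_inv _ (rT_unit hω hZ), one_mulVec]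
  have hv0 : v ≠ 0 := by rintro h; rw [h] at hTv; simp at hTv; exact hu hTv.symm
  have h1 := rform (Z := Z) hω v
  have h2 := mem_D.1 hZ v hv0
  have h3 : rPhi w1 w2 Z *ᵥ u = rU w1 w2 Z *ᵥ v := by
    rw [rPhi, ← mulVec_mulVec]
  rw [h3]; rw [hTv] at h1
  linarith

theorem rPhi_inv (hω : nsq w1 - nsq w2 ≠ 0) (hZ : Z ∈ typeIDomain p q) :
    rPhi w1 w2 (rPhi w1 w2 Z) = Z := by
  set W := rPhi w1 w2 Z with hW
  have hWT := rPhi_mul hω hZ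
  rw [← hW] at hWT
  have hc : ((nsq w1 - nsq w2 : ℝ) : ℂ) ≠ 0 := by exact_mod_cast hω
  have hyv : ∀ v, rY w1 w2 W ⬝ᵥ (rT w1 w2 Z *ᵥ v) = - (rY w1 w2 Z ⬝ᵥ v) := by
    intro v
    rw [rY_dot, mulVec_mulVec, hWT, rT_mulVec, rU_mulVec, dotProduct_sub, dotProduct_sub,
      dotProduct_smul, dotProduct_smul, star_dot_self, star_dot_self]
    have := rY_dot (w1 := w1) (w2 := w2) (Z := Z) v
    set y := rY w1 w2 Z ⬝ᵥ v
    have h5 : star w1 ⬝ᵥ v = y + star w2 ⬝ᵥ (Z *ᵥ v) := by rw [this]; ring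
    rw [h5]
    simp only [smul_eq_mul]
    push_cast at hc ⊢
    field_simp
    ring
  have hTT : rT w1 w2 W * rT w1 w2 Z = 1 := by
    refine Matrix.ext_of_mulVec_single fun i => ?_
    rw [← mulVec_mulVec, rT_mulVec (Z := W), hyv, rT_mulVec, one_mulVec]
    module
  have hUT : rU w1 w2 W * rT w1 w2 Z = Z := by
    refine Matrix.ext_of_mulVec_single fun i => ?_
    rw [← mulVec_mulVec, rU_mulVec (Z := W), hyv, mulVec_mulVec, hWT, rU_mulVec]
    module
  rw [rPhi, Matrix.inv_eq_right_inv hTT, hUT]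

theorem rPhi_diff (hω : nsq w1 - nsq w2 ≠ 0) :
    DifferentiableOn ℂ (rPhi w1 w2) (typeIDomain p q) := by
  have hid : ∀ i j, Differentiable ℂ fun Z : Matrix (Fin p) (Fin q) ℂ => Z i j := fun i j =>
    (differentiable_pi.1 (differentiable_pi.1 differentiable_id i) j)
  have hy : ∀ j, Differentiable ℂ fun Z => rY w1 w2 Z j := by
    intro j
    simp only [rY, Pi.sub_apply, vecMul, dotProduct]
    exact (differentiable_const _).sub (Differentiable.fun_sum fun k _ =>
      (differentiable_const _).mul (hid k j))
  have hT : ∀ i j, Differentiable ℂ fun Z => rT w1 w2 Z i j := by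
    intro i j
    simp only [rT, Matrix.sub_apply, Matrix.smul_apply, vecMulVec_apply, smul_eq_mul]
    exact (differentiable_const _).sub ((differentiable_const _).mul ((differentiable_const _).mul (hy j)))
  have hU : ∀ i j, Differentiable ℂ fun Z => rU w1 w2 Z i j := by
    intro i j
    simp only [rU, Matrix.sub_apply, Matrix.smul_apply, vecMulVec_apply, smul_eq_mul]
    exact (hid i j).sub ((differentiable_const _).mul ((differentiable_const _).mul (hy j)))
  refine mul_diff (matrix_diff.2 fun i j => (hU i j).differentiableOn) (matrix_diff.2 fun i j => ?_)
  simp only [Matrix.inv_def, Ring.inverse_eq_inv', Matrix.smul_apply, smul_eq_mul]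
  refine DifferentiableOn.mul (DifferentiableOn.inv (det_diff fun i j => (hT i j).differentiableOn) ?_)
    (adj_diff (fun i j => (hT i j).differentiableOn) i j)
  intro Z hZ
  exact (rT_unit hω hZ).ne_zero

theorem rG_graph (hω : nsq w1 - nsq w2 ≠ 0) (hZ : Z ∈ typeIDomain p q)
    (x : (Fin q → ℂ) × (Fin p → ℂ)) (hx : Z *ᵥ x.1 = x.2) :
    rPhi w1 w2 Z *ᵥ (rG w1 w2 x).1 = (rG w1 w2 x).2 := by
  have h1 : (rG w1 w2 x).1 = rT w1 w2 Z *ᵥ x.1 := by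
    rw [rT_mulVec, rY_dot, hx]; simp [rG]
  have h2 : (rG w1 w2 x).2 = rU w1 w2 Z *ᵥ x.1 := by
    rw [rU_mulVec, rY_dot, hx]; simp [rG]
  rw [h1, h2, mulVec_mulVec, rPhi_mul hω hZ]

theorem rG_invol (hω : nsq w1 - nsq w2 ≠ 0) (x : (Fin q → ℂ) × (Fin p → ℂ)) :
    rG w1 w2 (rG w1 w2 x) = x := by
  have hc : ((nsq w1 - nsq w2 : ℝ) : ℂ) ≠ 0 := by exact_mod_cast hω
  simp only [rG, LinearMap.coe_mk, AddHom.coe_mk, Prod.fst_sub, Prod.snd_sub, Prod.smul_fst,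
    Prod.smul_snd, dotProduct_sub, dotProduct_smul, star_dot_self]
  set t := star w1 ⬝ᵥ x.1 - star w2 ⬝ᵥ x.2 with ht
  have h5 : star w1 ⬝ᵥ x.1 = t + star w2 ⬝ᵥ x.2 := by rw [ht]; ring
  rw [h5, sub_sub, ← add_smul]
  convert sub_zero x using 2
  convert zero_smul ℂ (w1, w2) using 2
  simp only [smul_eq_mul]
  push_cast at hc ⊢
  field_simp
  ring
end

theorem exists_aut (a : Fin q → ℂ) (b : Fin p → ℂ) (h : nsq b < nsq a) (e : Fin q → ℂ)
    (he : nsq e = 1) : ∃ (φ : Matrix (Fin p) (Fin q) ℂ → Matrix (Fin p) (Fin q) ℂ)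
      (G : ((Fin q → ℂ) × (Fin p → ℂ)) →ₗ[ℂ] ((Fin q → ℂ) × (Fin p → ℂ))),
      DifferentiableOn ℂ φ (typeIDomain p q) ∧ MapsTo φ (typeIDomain p q) (typeIDomain p q) ∧
      (∀ Z ∈ typeIDomain p q, φ (φ Z) = Z) ∧ (∀ x, G (G x) = x) ∧
      (∀ Z ∈ typeIDomain p q, ∀ x, Z *ᵥ x.1 = x.2 → φ Z *ᵥ (G x).1 = (G x).2) ∧
      ∃ μ : ℂ, μ ≠ 0 ∧ G (a, b) = (μ • e, 0) := by
  -- choose a scalar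
  obtain ⟨σ, hσ0, hσ, hσr⟩ : ∃ σ : ℂ, σ ≠ 0 ∧ ‖σ‖ ^ 2 * (nsq a - nsq b) = 1 ∧
      ∃ t : ℝ, t ≤ 0 ∧ star e ⬝ᵥ (σ • a) = t := by
    set s := nsq a - nsq b with hs
    have hs0 : 0 < s := by rw [hs]; linarith
    set u := star e ⬝ᵥ a with hu
    have hss : ‖((Real.sqrt s : ℝ) : ℂ)⁻¹‖ ^ 2 * s = 1 := by
      rw [norm_inv, Complex.norm_real, Real.norm_of_nonneg (Real.sqrt_nonneg _), inv_pow,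
        Real.sq_sqrt hs0.le, inv_mul_cancel₀ hs0.ne']
    have hss0 : ((Real.sqrt s : ℝ) : ℂ)⁻¹ ≠ 0 := by
      simp [Real.sqrt_eq_zero', hs0]
    by_cases hu0 : u = 0
    · refine ⟨((Real.sqrt s : ℝ) : ℂ)⁻¹, hss0, hss, 0, le_rfl, ?_⟩
      rw [dotProduct_smul, ← hu, hu0]; simp
    · have hun : (‖u‖ : ℂ) ≠ 0 := by simpa using hu0
      refine ⟨-((Real.sqrt s : ℝ) : ℂ)⁻¹ * (star u / ‖u‖), ?_, ?_, -(Real.sqrt s)⁻¹ * ‖u‖, ?_, ?_⟩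
      · refine mul_ne_zero (neg_ne_zero.2 hss0) (div_ne_zero (star_ne_zero.2 hu0) hun)
      · rw [norm_mul, norm_neg, norm_div, norm_star, Complex.norm_real, norm_norm,
          div_self (by simpa using hu0), mul_one, hss]
      · have := inv_nonneg.2 (Real.sqrt_nonneg s)
        nlinarith [norm_nonneg u]
      · rw [dotProduct_smul, ← hu, smul_eq_mul]
        have := Complex.conj_mul' u
        push_cast
        rw [mul_assoc, div_mul_eq_mul_div, Complex.star_def, this]
        field_simp
  obtain ⟨t, ht, htr⟩ := hσr
  set w1 := σ • a - e with hw1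
  set w2 := σ • b with hw2
  have hn1 : nsq w1 = ‖σ‖ ^ 2 * nsq a - 2 * t + 1 := by
    rw [hw1, sub_eq_add_neg, add_comm, nsq_add, nsq_neg, he, nsq_smul, star_neg, neg_dotProduct, htr]
    simp; ring
  have hn2 : nsq w2 = ‖σ‖ ^ 2 * nsq b := by rw [hw2, nsq_smul]
  have hω : nsq w1 - nsq w2 = 2 * (1 - t) := by rw [hn1, hn2]; nlinarith
  have hω0 : nsq w1 - nsq w2 ≠ 0 := by rw [hω]; nlinarith
  refine ⟨rPhi w1 w2, rG w1 w2, rPhi_diff hω0, fun Z hZ => rPhi_mem hω0 hZ,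
    fun Z hZ => rPhi_inv hω0 hZ, rG_invol hω0, fun Z hZ x hx => rG_graph hω0 hZ x hx,
    σ⁻¹, inv_ne_zero hσ0, ?_⟩
  have hσx : rG w1 w2 (σ • (a, b)) = (e, 0) := by
    have h1 : star w1 ⬝ᵥ (σ • a) - star w2 ⬝ᵥ (σ • b) = ((1 - t : ℝ) : ℂ) := by
      rw [hw1, hw2, star_sub, sub_dotProduct, star_dot_self, star_dot_self, htr, nsq_smul, nsq_smul,
        sub_right_comm, ← Complex.ofReal_sub, ← mul_sub, hσ]
      push_cast; ring
    have h2 : 2 / ((nsq w1 - nsq w2 : ℝ) : ℂ) * ((1 - t : ℝ) : ℂ) = 1 := by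
      rw [hω]
      have : ((1 - t : ℝ) : ℂ) ≠ 0 := by
        rw [Complex.ofReal_ne_zero]; linarith
      push_cast at this ⊢
      field_simp
    show (σ • (a, b)) - (_ * (star w1 ⬝ᵥ (σ • a) - star w2 ⬝ᵥ (σ • b))) • (w1, w2) = _
    rw [h1, h2, one_smul]
    ext i <;> simp [hw1, hw2]
  have : rG w1 w2 (a, b) = σ⁻¹ • rG w1 w2 (σ • (a, b)) := by
    rw [← map_smul, smul_smul, inv_mul_cancel₀ hσ0, one_smul]
  rw [this, hσx]; simp

end PartC

section PartD

open Set

variable {p q p' q' m n : ℕ}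

/-- append a column -/
def sn (Z : Matrix (Fin p) (Fin m) ℂ) (z : Fin p → ℂ) : Matrix (Fin p) (Fin (m + 1)) ℂ :=
  Matrix.of fun i => Fin.snoc (α := fun _ => ℂ) (Z i) (z i)

/-- drop the last column -/
def dr (W : Matrix (Fin p) (Fin (m + 1)) ℂ) : Matrix (Fin p) (Fin m) ℂ :=
  W.submatrix id Fin.castSucc

@[simp] theorem sn_castSucc (Z : Matrix (Fin p) (Fin m) ℂ) (z : Fin p → ℂ) (i j) :
    sn Z z i (Fin.castSucc j) = Z i j := by simp [sn]

@[simp] theorem sn_last (Z : Matrix (Fin p) (Fin m) ℂ) (z : Fin p → ℂ) (i) :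
    sn Z z i (Fin.last m) = z i := by simp [sn]

theorem dr_sn (Z : Matrix (Fin p) (Fin m) ℂ) (z : Fin p → ℂ) : dr (sn Z z) = Z := by
  ext i j; simp [dr]

theorem sn_dr (W : Matrix (Fin p) (Fin (m + 1)) ℂ) : sn (dr W) (fun i => W i (Fin.last m)) = W := by
  ext i j
  refine Fin.lastCases ?_ (fun j => ?_) j <;> simp [dr]

theorem sn_mulVec (Z : Matrix (Fin p) (Fin m) ℂ) (z : Fin p → ℂ) (v : Fin (m + 1) → ℂ) :
    sn Z z *ᵥ v = Z *ᵥ (fun j => v j.castSucc) + v (Fin.last m) • z := by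
  ext i; simp [mulVec, dotProduct, Fin.sum_univ_castSucc, mul_comm]

theorem nsq_split (v : Fin (m + 1) → ℂ) :
    nsq v = nsq (fun j : Fin m => v j.castSucc) + ‖v (Fin.last m)‖ ^ 2 := by
  simp [nsq, Fin.sum_univ_castSucc]

theorem nsq_vecMul_sn (Z : Matrix (Fin p) (Fin m) ℂ) (z : Fin p → ℂ) (y : Fin p → ℂ) :
    nsq (y ᵥ* sn Z z) = nsq (y ᵥ* Z) + ‖y ⬝ᵥ z‖ ^ 2 := by
  rw [nsq_split]; simp [vecMul, dotProduct]; rfl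

theorem sn_zero_mem {Z : Matrix (Fin p) (Fin m) ℂ} :
    sn Z 0 ∈ typeIDomain p (m + 1) ↔ Z ∈ typeIDomain p m := by
  constructor
  · intro h
    refine mem_D_of_row fun y hy => ?_
    have := mem_D_row h y hy
    rw [nsq_vecMul_sn] at this
    simpa using this
  · intro h
    refine mem_D_of_row fun y hy => ?_
    have := mem_D_row h y hy
    rw [nsq_vecMul_sn]
    simpa using this

/-- `sn` as a linear map -/
noncomputable def snL (p m : ℕ) : (Matrix (Fin p) (Fin m) ℂ × (Fin p → ℂ)) →L[ℂ]
    Matrix (Fin p) (Fin (m + 1)) ℂ :=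
  LinearMap.toContinuousLinearMap
    { toFun := fun x => sn x.1 x.2
      map_add' := fun x y => by
        ext i j; refine Fin.lastCases ?_ (fun j => ?_) j <;> simp
      map_smul' := fun c x => by
        ext i j; refine Fin.lastCases ?_ (fun j => ?_) j <;> simp }

theorem snL_apply (Z : Matrix (Fin p) (Fin m) ℂ) (z : Fin p → ℂ) : snL p m (Z, z) = sn Z z := rfl

theorem sn_eq (Z : Matrix (Fin p) (Fin m) ℂ) (z : Fin p → ℂ) : sn Z z = snL p m (Z, z) := rfl

theorem sn_diff {E : Type*} [NormedAddCommGroup E] [NormedSpace ℂ E]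
    {f : E → Matrix (Fin p) (Fin m) ℂ} {g : E → Fin p → ℂ} {s : Set E}
    (hf : DifferentiableOn ℂ f s) (hg : DifferentiableOn ℂ g s) :
    DifferentiableOn ℂ (fun x => sn (f x) (g x)) s :=
  (snL p m).differentiable.comp_differentiableOn (hf.prodMk hg)

theorem sn_cont {E : Type*} [TopologicalSpace E]
    {f : E → Matrix (Fin p) (Fin m) ℂ} {g : E → Fin p → ℂ}
    (hf : Continuous f) (hg : Continuous g) :
    Continuous (fun x => sn (f x) (g x)) :=
  (snL p m).continuous.comp (hf.prodMk hg)

theorem dr_cont : Continuous (dr : Matrix (Fin p) (Fin (m + 1)) ℂ → _) := by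
  refine continuous_pi fun i => continuous_pi fun j => ?_
  exact (continuous_apply j.castSucc).comp (continuous_apply i)

theorem PH.aut_right {f : Matrix (Fin p) (Fin q) ℂ → Matrix (Fin p') (Fin q') ℂ}
    (hf : PH p q p' q' f) {φ : Matrix (Fin p) (Fin q) ℂ → Matrix (Fin p) (Fin q) ℂ}
    (h1 : DifferentiableOn ℂ φ (typeIDomain p q)) (h2 : MapsTo φ (typeIDomain p q) (typeIDomain p q))
    (h3 : ∀ Z ∈ typeIDomain p q, φ (φ Z) = Z) : PH p q p' q' (f ∘ φ) where
  diff := hf.diff.comp h1 h2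
  maps := hf.maps.comp h2
  comp := by
    intro K hK hKc
    have h := hf.comp K hK hKc
    have : typeIDomain p q ∩ (f ∘ φ) ⁻¹' K = φ '' (typeIDomain p q ∩ f ⁻¹' K) := by
      ext Z
      constructor
      · rintro ⟨hZ, hZK⟩
        exact ⟨φ Z, ⟨h2 hZ, hZK⟩, h3 Z hZ⟩
      · rintro ⟨W, ⟨hW, hWK⟩, rfl⟩
        refine ⟨h2 hW, ?_⟩
        simpa [h3 W hW] using hWK
    rw [this]
    exact h.image_of_continuousOn (h1.continuousOn.mono inter_subset_left)

theorem PH.aut_left {f : Matrix (Fin p) (Fin q) ℂ → Matrix (Fin p') (Fin q') ℂ}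
    (hf : PH p q p' q' f) {φ : Matrix (Fin p') (Fin q') ℂ → Matrix (Fin p') (Fin q') ℂ}
    (h1 : DifferentiableOn ℂ φ (typeIDomain p' q'))
    (h2 : MapsTo φ (typeIDomain p' q') (typeIDomain p' q'))
    (h3 : ∀ Z ∈ typeIDomain p' q', φ (φ Z) = Z) : PH p q p' q' (φ ∘ f) where
  diff := h1.comp hf.diff hf.maps
  maps := h2.comp hf.maps
  comp := by
    intro K hK hKc
    have h := hf.comp (φ '' K) (by rintro _ ⟨W, hW, rfl⟩; exact h2 (hK hW))
      (hKc.image_of_continuousOn (h1.continuousOn.mono hK))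
    have : typeIDomain p q ∩ (φ ∘ f) ⁻¹' K = typeIDomain p q ∩ f ⁻¹' (φ '' K) := by
      ext Z
      constructor
      · rintro ⟨hZ, hZK⟩
        exact ⟨hZ, φ (f Z), hZK, h3 _ (hf.maps hZ)⟩
      · rintro ⟨hZ, W, hW, hWZ⟩
        refine ⟨hZ, ?_⟩
        rw [mem_preimage, Function.comp_apply, ← hWZ, h3 W (hK hW)]; exact hW
    rwa [this]

theorem PH.restrict {f : Matrix (Fin p) (Fin (m + 1)) ℂ → Matrix (Fin p') (Fin q') ℂ}
    (hf : PH p (m + 1) p' q' f) : PH p m p' q' (fun Z => f (sn Z 0)) where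
  diff := hf.diff.comp (sn_diff differentiableOn_id (differentiableOn_const _))
    fun _ hZ => sn_zero_mem.2 hZ
  maps := fun _ hZ => hf.maps (sn_zero_mem.2 hZ)
  comp := by
    intro K hK hKc
    have h := hf.comp K hK hKc
    have h1 : IsClosed {W : Matrix (Fin p) (Fin (m + 1)) ℂ | ∀ i, W i (Fin.last m) = 0} := by
      rw [Set.ofPred_forall]
      refine isClosed_iInter fun i => isClosed_eq ?_ continuous_const
      exact (continuous_apply _).comp (continuous_apply _)
    have : typeIDomain p m ∩ (fun Z => f (sn Z 0)) ⁻¹' K =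
        dr '' ((typeIDomain p (m + 1) ∩ f ⁻¹' K) ∩ {W | ∀ i, W i (Fin.last m) = 0}) := by
      ext Z
      constructor
      · rintro ⟨hZ, hZK⟩
        exact ⟨sn Z 0, ⟨⟨sn_zero_mem.2 hZ, hZK⟩, by simp⟩, dr_sn _ _⟩
      · rintro ⟨W, ⟨⟨hW, hWK⟩, hW0⟩, rfl⟩
        have hW' : sn (dr W) 0 = W := by
          conv_rhs => rw [← sn_dr W]
          congr 1; ext i; simp [hW0 i]
        rw [← hW'] at hW hWK
        exact ⟨sn_zero_mem.1 hW, hWK⟩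
    rw [this]
    exact (h.inter_right h1).image dr_cont

/-- last basis vector -/
def eL (n : ℕ) : Fin (n + 1) → ℂ := Pi.single (Fin.last n) 1

theorem nsq_eL : nsq (eL n) = 1 := by
  rw [nsq, Finset.sum_eq_single (Fin.last n)] <;> simp +contextual [eL]

theorem mulVec_eL (W : Matrix (Fin p) (Fin (m + 1)) ℂ) : W *ᵥ eL m = fun i => W i (Fin.last m) := by
  ext i; simp [eL]

theorem PH.drop {f : Matrix (Fin p) (Fin m) ℂ → Matrix (Fin p') (Fin (n + 1)) ℂ}
    (hf : PH p m p' (n + 1) f) (c : Fin (n + 1) → ℂ) (d : Fin p' → ℂ) (hc : c ≠ 0)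
    (hcd : ∀ Z ∈ typeIDomain p m, f Z *ᵥ c = d) :
    ∃ g, PH p m p' n g ∧ ∀ c2 d2, (∀ Z ∈ typeIDomain p m, f Z *ᵥ c2 = d2) → (∀ k : ℂ, c2 ≠ k • c) →
      ∃ c3 d3, c3 ≠ 0 ∧ ∀ Z ∈ typeIDomain p m, g Z *ᵥ c3 = d3 := by
  have hd : nsq d < nsq c := by
    rw [← hcd 0 zero_mem_D]; exact mem_D.1 (hf.maps zero_mem_D) c hc
  obtain ⟨φ, G, h1, h2, h3, hG, hgr, μ, hμ, hGc⟩ := exists_aut c d hd (eL n) nsq_eL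
  have hF := hf.aut_left h1 h2 h3
  have hlast : ∀ Z ∈ typeIDomain p m, sn (dr (φ (f Z))) 0 = φ (f Z) := by
    intro Z hZ
    have h := hgr (f Z) (hf.maps hZ) (c, d) (hcd Z hZ)
    rw [hGc] at h
    simp only [mulVec_smul, mulVec_eL] at h
    have h' := (smul_eq_zero.1 h).resolve_left hμ
    conv_rhs => rw [← sn_dr (φ (f Z)), h']
  refine ⟨fun Z => dr (φ (f Z)), ⟨?_, ?_, ?_⟩, ?_⟩
  · exact matrix_diff.2 fun i j => matrix_diff.1 hF.diff i j.castSucc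
  · intro Z hZ
    have := hF.maps hZ
    rw [Function.comp_apply, ← hlast Z hZ] at this
    exact sn_zero_mem.1 this
  · intro K hK hKc
    have hc : Continuous fun W : Matrix (Fin p') (Fin n) ℂ => sn W 0 :=
      sn_cont continuous_id continuous_const
    have h := hF.comp ((fun W => sn W 0) '' K) (by
      rintro _ ⟨W, hW, rfl⟩; exact sn_zero_mem.2 (hK hW)) (hKc.image hc)
    convert h using 1
    ext Z
    constructor
    · rintro ⟨hZ, hZK⟩
      exact ⟨hZ, _, hZK, hlast Z hZ⟩
    · rintro ⟨hZ, W, hW, hWZ⟩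
      refine ⟨hZ, ?_⟩
      simp only [Function.comp_apply] at hWZ
      rw [mem_preimage, ← hWZ, dr_sn]; exact hW
  · intro c2 d2 hcd2 hk
    have hgr2 : ∀ Z ∈ typeIDomain p m, φ (f Z) *ᵥ (G (c2, d2)).1 = (G (c2, d2)).2 := fun Z hZ =>
      hgr (f Z) (hf.maps hZ) (c2, d2) (hcd2 Z hZ)
    refine ⟨fun j => (G (c2, d2)).1 j.castSucc, (G (c2, d2)).2, ?_, ?_⟩
    · intro h0
      have h5 : (G (c2, d2)).2 = 0 := by
        rw [← hgr2 0 zero_mem_D, ← hlast 0 zero_mem_D, sn_mulVec, h0]; simp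
      have h6 : (G (c2, d2)).1 = (G (c2, d2)).1 (Fin.last n) • eL n := by
        ext j
        refine Fin.lastCases ?_ (fun j => ?_) j
        · simp [eL]
        · simpa [eL] using congrFun h0 j
      set ν := (G (c2, d2)).1 (Fin.last n)
      have h7 : G (c2, d2) = (ν / μ) • G (c, d) := by
        rw [hGc]
        refine Prod.ext ?_ ?_
        · rw [h6, Prod.smul_fst, smul_smul, div_mul_cancel₀ _ hμ]
        · rw [h5]; simp
      have h8 := congrArg G h7
      rw [map_smul, hG, hG] at h8
      exact hk (ν / μ) (congrArg Prod.fst h8)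
    · intro Z hZ
      rw [← hgr2 Z hZ, ← hlast Z hZ, sn_mulVec]; simp

theorem PH.target_pos (hp : 0 < p) (hm : 0 < m)
    {f : Matrix (Fin p) (Fin m) ℂ → Matrix (Fin p') (Fin q') ℂ}
    (hf : PH p m p' q' f) : 0 < q' := by
  rcases Nat.eq_zero_or_pos q' with rfl | h
  swap
  · exact h
  exfalso
  have hsub : Subsingleton (Matrix (Fin p') (Fin 0) ℂ) := inferInstance
  have h := hf.comp (typeIDomain p' 0) le_rfl (Set.Subsingleton.isCompact (Set.subsingleton_of_subsingleton))
  have h1 : typeIDomain p m ∩ f ⁻¹' (typeIDomain p' 0) = typeIDomain p m := by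
    rw [inter_eq_left]; exact hf.maps
  rw [h1] at h
  have h2 : IsClopen (typeIDomain p m) := ⟨h.isClosed, isOpen_D⟩
  have h3 := h2.eq_univ ⟨0, zero_mem_D⟩
  have h4 : (Matrix.of fun _ _ => 1 : Matrix (Fin p) (Fin m) ℂ) ∈ typeIDomain p m := by rw [h3]; trivial
  rw [mem_D_iff] at h4
  have h5 := entry_le (Matrix.of fun _ _ => 1 : Matrix (Fin p) (Fin m) ℂ) ⟨0, hp⟩ ⟨0, hm⟩
  simp at h5
  linarith

end PartD

section PartE

variable {X I : Type*} {n ρ : ℕ}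

theorem rows_lemma (Λ : I → Fin n → ℂ) (h : ∀ c, (∀ i, Λ i ⬝ᵥ c = 0) → c = 0) :
    ∃ r : Fin n → I, (Matrix.of fun k => Λ (r k)).det ≠ 0 := by
  have htop : Submodule.span ℂ (Set.range Λ) = ⊤ := by
    by_contra hne
    obtain ⟨φ, hφ0, hφ⟩ := Submodule.exists_le_ker_of_lt_top _ (lt_top_iff_ne_top.2 hne)
    apply hφ0
    set c : Fin n → ℂ := fun j => φ (Pi.single j 1) with hc
    have hφc : ∀ v, φ v = v ⬝ᵥ c := by
      intro v
      conv_lhs => rw [pi_eq_sum_univ' v]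
      simp [dotProduct, hc, map_sum]
    have : c = 0 := h c fun i => by
      rw [← hφc]; exact hφ (Submodule.subset_span ⟨i, rfl⟩)
    ext v; simp [hφc, this]
  obtain ⟨f, hf, hfs, hfi⟩ := Submodule.exists_fun_fin_finrank_span_eq ℂ (Set.range Λ)
  have hfr : Module.finrank ℂ (Submodule.span ℂ (Set.range Λ)) = n := by
    rw [htop]; simp
  choose r hr using hf
  have hcast : n = Module.finrank ℂ (Submodule.span ℂ (Set.range Λ)) := hfr.symm
  refine ⟨fun k => r (Fin.cast hcast k), ?_⟩
  have hli : LinearIndependent ℂ (fun k : Fin n => Λ (r (Fin.cast hcast k))) := by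
    have := hfi.comp (Fin.cast hcast) (Fin.cast_injective _)
    have h2 : (f ∘ Fin.cast hcast) = fun k : Fin n => Λ (r (Fin.cast hcast k)) := by
      ext k; simp [hr]
    rwa [h2] at this
  have := (Matrix.linearIndependent_rows_iff_isUnit (A := Matrix.of fun k => Λ (r (Fin.cast hcast k)))).1 hli
  exact ((Matrix.isUnit_iff_isUnit_det _).1 this).ne_zero

/-- minor -/
def kB (Λ : I → X → Fin n → ℂ) (r : Fin ρ → I) (s : Fin ρ → Fin n) (x : X) :
    Matrix (Fin ρ) (Fin ρ) ℂ := Matrix.of fun a b => Λ (r a) x (s b)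

/-- kernel vectors -/
def kq (Λ : I → X → Fin n → ℂ) (r : Fin ρ → I) (s : Fin ρ → Fin n) (j : Fin n) (x : X) :
    Fin n → ℂ :=
  (kB Λ r s x).det • Pi.single j 1 -
    ∑ k, ((kB Λ r s x).adjugate *ᵥ fun a => Λ (r a) x j) k • Pi.single (s k) 1

theorem kq_span (Λ : I → X → Fin n → ℂ) (r : Fin ρ → I) (s : Fin ρ → Fin n) (x : X) (c : Fin n → ℂ)
    (hc : ∀ i, Λ i x ⬝ᵥ c = 0) : (kB Λ r s x).det • c = ∑ j, c j • kq Λ r s j x := by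
  simp only [kq, smul_sub, Finset.sum_sub_distrib, Finset.smul_sum]
  rw [Finset.sum_comm]
  have h1 : ∀ k, ∑ j, c j • ((kB Λ r s x).adjugate *ᵥ fun a => Λ (r a) x j) k •
      (Pi.single (s k) 1 : Fin n → ℂ) = 0 := by
    intro k
    simp only [smul_smul]
    rw [← Finset.sum_smul]
    convert zero_smul ℂ _
    simp only [mulVec, dotProduct, Finset.mul_sum]
    rw [Finset.sum_comm]
    refine Finset.sum_eq_zero fun a _ => ?_
    have := hc (r a)
    simp only [dotProduct] at this
    calc _ = (kB Λ r s x).adjugate k a * ∑ i, Λ (r a) x i * c i := by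
          rw [Finset.mul_sum]; exact Finset.sum_congr rfl fun i _ => by ring
      _ = 0 := by rw [this, mul_zero]
  simp only [h1, Finset.sum_const_zero, sub_zero]
  ext i
  simp [Pi.single_apply]; ring

theorem ker_lemma (Λ : I → X → Fin n → ℂ) (S : Set X) (hS : S.Nonempty) :
    ∃ (ρ : ℕ) (r : Fin ρ → I) (s : Fin ρ → Fin n), (∃ x ∈ S, (kB Λ r s x).det ≠ 0) ∧
      ∀ x ∈ S, (kB Λ r s x).det ≠ 0 → ∀ i j, Λ i x ⬝ᵥ kq Λ r s j x = 0 := by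
  let P : ℕ → Prop := fun ρ => ∃ (r : Fin ρ → I) (s : Fin ρ → Fin n), ∃ x ∈ S, (kB Λ r s x).det ≠ 0
  have hP0 : P 0 := by
    obtain ⟨x, hx⟩ := hS
    exact ⟨Fin.elim0, Fin.elim0, x, hx, by simp⟩
  have hPn : ¬ P (n + 1) := by
    rintro ⟨r, s, x, _, hx⟩
    obtain ⟨a, b, hab, hs⟩ := Fintype.exists_ne_map_eq_of_card_lt s (by simp)
    exact hx (Matrix.det_zero_of_column_eq hab fun i => by simp [kB, hs])
  obtain ⟨ρ, hρ, hρ1⟩ : ∃ ρ, P ρ ∧ ¬ P (ρ + 1) := by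
    by_contra hcon
    push Not at hcon
    have : ∀ k, P k := fun k => Nat.rec hP0 (fun k hk => hcon k hk) k
    exact hPn (this _)
  obtain ⟨r, s, hx⟩ := hρ
  refine ⟨ρ, r, s, hx, fun x hxS hδ i j => ?_⟩
  by_contra hne
  apply hρ1
  refine ⟨Fin.snoc (α := fun _ => I) r i, Fin.snoc (α := fun _ => Fin n) s j, x, hxS, ?_⟩
  set B := kB Λ r s x with hB
  let e : Fin ρ ⊕ Fin 1 ≃ Fin (ρ + 1) := finSumFinEquiv
  have hinl : ∀ a : Fin ρ, e (Sum.inl a) = Fin.castSucc a := fun a => by simp [e]; rfl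
  have hinr : ∀ a : Fin 1, e (Sum.inr a) = Fin.last ρ := fun a => by
    rw [Subsingleton.elim a 0]; simp [e]; rfl
  rw [← Matrix.det_submatrix_equiv_self e]
  have hblk : (kB Λ (Fin.snoc (α := fun _ => I) r i) (Fin.snoc (α := fun _ => Fin n) s j) x).submatrix e e
      = Matrix.fromBlocks B (Matrix.of fun a _ => Λ (r a) x j)
        (Matrix.of fun _ b => Λ i x (s b)) (Matrix.of fun _ _ => Λ i x j) := by
    ext a b
    rcases a with a | a <;> rcases b with b | b <;>
      simp [kB, hB, hinl, hinr]
  have hu : IsUnit B.det := isUnit_iff_ne_zero.2 hδ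
  let _ := Matrix.invertibleOfIsUnitDet B hu
  rw [hblk, Matrix.det_fromBlocks₁₁]
  refine mul_ne_zero hδ ?_
  rw [Matrix.det_unique]
  intro h0
  apply hne
  have hinv : B.adjugate = B.det • ⅟B := by
    rw [Matrix.invOf_eq_nonsing_inv, Matrix.inv_def, smul_smul, Ring.inverse_eq_inv',
      mul_inv_cancel₀ hδ, one_smul]
  rw [kq, ← hB, hinv, dotProduct_sub, dotProduct_smul, dotProduct_single_one, dotProduct_sum]
  simp only [dotProduct_smul, dotProduct_single_one]
  simp only [Matrix.sub_apply, of_apply, Matrix.mul_apply] at h0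
  rw [sub_eq_zero] at h0
  rw [h0, sub_eq_zero, smul_eq_mul, Finset.mul_sum]
  simp only [smul_eq_mul, mulVec, dotProduct, Finset.mul_sum, Finset.sum_mul]
  rw [Finset.sum_comm]
  exact Finset.sum_congr rfl fun a _ => Finset.sum_congr rfl fun b _ => by
    rw [Matrix.smul_apply, smul_eq_mul]; ring

theorem det_mem_sub (A : Subring (X → ℂ)) {ι : Type*} [Fintype ι] [DecidableEq ι]
    {M : X → Matrix ι ι ℂ} (h : ∀ a b, (fun x => M x a b) ∈ A) : (fun x => (M x).det) ∈ A := by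
  have : (fun x => (M x).det) = ∑ σ : Equiv.Perm ι, (Equiv.Perm.sign σ : ℤ) •
      ∏ i, (fun x => M x (σ i) i) := by
    ext x
    rw [Matrix.det_apply]
    simp [Finset.sum_apply, Finset.prod_apply, Units.smul_def]
  rw [this]
  exact A.sum_mem fun σ _ => A.zsmul_mem (A.prod_mem fun i _ => h _ _) _

theorem adj_mem_sub (A : Subring (X → ℂ)) {ι : Type*} [Fintype ι] [DecidableEq ι]
    {M : X → Matrix ι ι ℂ} (h : ∀ a b, (fun x => M x a b) ∈ A) (i j : ι) :
    (fun x => (M x).adjugate i j) ∈ A := by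
  simp only [Matrix.adjugate_apply]
  refine det_mem_sub A fun k l => ?_
  simp only [updateRow_apply]
  split_ifs
  · by_cases hl : l = i
    · subst hl; simp only [Pi.single_eq_same]; exact A.one_mem
    · simp only [Pi.single_apply, hl, if_false]; exact A.zero_mem
  · exact h _ _

theorem kB_mem (A : Subring (X → ℂ)) (Λ : I → X → Fin n → ℂ) (hΛ : ∀ i j, (fun x => Λ i x j) ∈ A)
    (r : Fin ρ → I) (s : Fin ρ → Fin n) : (fun x => (kB Λ r s x).det) ∈ A :=
  det_mem_sub A fun a b => hΛ (r a) (s b)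

theorem kq_mem (A : Subring (X → ℂ)) (Λ : I → X → Fin n → ℂ) (hΛ : ∀ i j, (fun x => Λ i x j) ∈ A)
    (r : Fin ρ → I) (s : Fin ρ → Fin n) (j i : Fin n) : (fun x => kq Λ r s j x i) ∈ A := by
  have : (fun x => kq Λ r s j x i) = (fun x => (kB Λ r s x).det) * (fun _ => (Pi.single j 1 : Fin n → ℂ) i)
      - ∑ k, (∑ a, (fun x => (kB Λ r s x).adjugate k a) * (fun x => Λ (r a) x j)) *
        (fun _ => (Pi.single (s k) 1 : Fin n → ℂ) i) := by
    ext x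
    simp [kq, Finset.sum_apply, mulVec, dotProduct]
  rw [this]
  have hs : ∀ k l : Fin n, (fun _ : X => (Pi.single k 1 : Fin n → ℂ) l) ∈ A := by
    intro k l
    by_cases hl : l = k
    · subst hl; simp only [Pi.single_eq_same]; exact A.one_mem
    · simp only [Pi.single_apply, hl, if_false]; exact A.zero_mem
  refine A.sub_mem (A.mul_mem (kB_mem A Λ hΛ r s) (hs _ _)) (A.sum_mem fun k _ => A.mul_mem
    (A.sum_mem fun a _ => A.mul_mem (adj_mem_sub A (fun a b => hΛ (r a) (s b)) k a) (hΛ _ _)) (hs _ _))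

end PartE

section PartF
open Set
variable {p m p' q' : ℕ}

/-- the slice of the domain -/
def Sset (β : Fin p → ℂ) (γ : Fin m → ℂ) : Set (Matrix (Fin p) (Fin m) ℂ) :=
  {Z | Z ∈ typeIDomain p m ∧ β ᵥ* Z = γ}

/-- its center -/
def Zc (β : Fin p → ℂ) (γ : Fin m → ℂ) : Matrix (Fin p) (Fin m) ℂ := vecMulVec (star β) γ

/-- the disc through `sn Z 0` -/
noncomputable def Zl (β : Fin p → ℂ) (γ : Fin m → ℂ) (Z : Matrix (Fin p) (Fin m) ℂ) (l : ℂ) :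
    Matrix (Fin p) (Fin (m + 1)) ℂ :=
  sn Z ((l / (Real.sqrt (1 - nsq γ) : ℂ)) • (star β - Z *ᵥ star γ))

theorem D_row_le {Z : Matrix (Fin p) (Fin m) ℂ} (h : Z ∈ typeIDomain p m) (y : Fin p → ℂ) :
    nsq (y ᵥ* Z) ≤ nsq y := by
  by_cases hy : y = 0
  · subst hy; simp
  · exact (mem_D_row h y hy).le

theorem S_cs {β : Fin p → ℂ} {γ : Fin m → ℂ} (hβ : nsq β = 1) (hγ : nsq γ < 1)
    {Z : Matrix (Fin p) (Fin m) ℂ} (hZ : Z ∈ Sset β γ) (y : Fin p → ℂ) :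
    ‖y ⬝ᵥ (star β - Z *ᵥ star γ)‖ ^ 2 ≤ (nsq y - nsq (y ᵥ* Z)) * (1 - nsq γ) := by
  set s := star y ⬝ᵥ β - star (y ᵥ* Z) ⬝ᵥ γ with hs
  have hR : y ⬝ᵥ (star β - Z *ᵥ star γ) = star s := by
    rw [hs, star_sub, dot_star_swap, dot_star_swap, dotProduct_sub, dotProduct_mulVec,
      dotProduct_comm (star β), dotProduct_comm (star γ)]
  rw [hR, norm_star]
  have ht : 0 < 1 - nsq γ := by linarith
  set t := 1 - nsq γ with htd
  set μ : ℂ := star s / (t : ℂ) with hμ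
  have h1 := D_row_le hZ.1 (y + (-μ) • β)
  rw [add_vecMul, smul_vecMul, hZ.2, nsq_add, nsq_add, nsq_smul, nsq_smul, dotProduct_smul,
    dotProduct_smul, hβ] at h1
  have h2 : (-μ * (star y ⬝ᵥ β)).re - (-μ * (star (y ᵥ* Z) ⬝ᵥ γ)).re = - (‖s‖ ^ 2 / t) := by
    rw [← Complex.sub_re, ← mul_sub, ← hs, hμ]
    have : -(star s / (t : ℂ)) * s = ((-(‖s‖ ^ 2 / t) : ℝ) : ℂ) := by
      push_cast
      rw [← Complex.conj_mul']
      simp only [starRingEnd_apply]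
      ring
    rw [this, Complex.ofReal_re]
  have h3 : ‖-μ‖ ^ 2 = ‖s‖ ^ 2 / t ^ 2 := by
    rw [norm_neg, hμ, norm_div, norm_star, div_pow, Complex.norm_real, Real.norm_eq_abs, sq_abs]
  rw [h3] at h1
  simp only [smul_eq_mul] at h1
  have h4 : ‖s‖ ^ 2 / t ^ 2 * t = ‖s‖ ^ 2 / t := by field_simp
  have h5 : ‖s‖ ^ 2 / t ≤ nsq y - nsq (y ᵥ* Z) := by
    have : ‖s‖ ^ 2 / t ^ 2 * 1 - ‖s‖ ^ 2 / t ^ 2 * nsq γ = ‖s‖ ^ 2 / t := by rw [← h4, htd]; ring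
    linarith
  rwa [div_le_iff₀ ht] at h5

theorem Zl_mem {β : Fin p → ℂ} {γ : Fin m → ℂ} (hβ : nsq β = 1) (hγ : nsq γ < 1)
    {Z : Matrix (Fin p) (Fin m) ℂ} (hZ : Z ∈ Sset β γ) {l : ℂ} (hl : ‖l‖ < 1) :
    Zl β γ Z l ∈ typeIDomain p (m + 1) := by
  apply mem_D_of_row
  intro y hy
  rw [Zl, nsq_vecMul_sn, dotProduct_smul, norm_smul, mul_pow, norm_div, div_pow, Complex.norm_real,
    Real.norm_eq_abs, sq_abs, Real.sq_sqrt (by linarith)]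
  have h1 := S_cs hβ hγ hZ y
  have h2 := mem_D_row hZ.1 y hy
  have ht : 0 < 1 - nsq γ := by linarith
  have h3 : ‖l‖ ^ 2 / (1 - nsq γ) * ‖y ⬝ᵥ (star β - Z *ᵥ star γ)‖ ^ 2 ≤
      ‖l‖ ^ 2 * (nsq y - nsq (y ᵥ* Z)) := by
    rw [div_mul_eq_mul_div, div_le_iff₀ ht, mul_assoc]
    gcongr
  have h4 : ‖l‖ ^ 2 < 1 := by rw [sq_lt_one_iff₀ (norm_nonneg _)]; exact hl
  nlinarith

theorem Zl_notMem {β : Fin p → ℂ} {γ : Fin m → ℂ} (hβ : nsq β = 1) (hγ : nsq γ < 1)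
    {Z : Matrix (Fin p) (Fin m) ℂ} (hZ : Z ∈ Sset β γ) {l : ℂ} (hl : ‖l‖ = 1) :
    Zl β γ Z l ∉ typeIDomain p (m + 1) := by
  intro h
  have hb : β ≠ 0 := by rintro rfl; simp [nsq] at hβ
  have h1 := mem_D_row h β hb
  have ht : 0 < 1 - nsq γ := by linarith
  rw [Zl, nsq_vecMul_sn, dotProduct_smul, norm_smul, mul_pow, norm_div, div_pow, Complex.norm_real,
    Real.norm_eq_abs, sq_abs, Real.sq_sqrt (by linarith), dotProduct_sub, dotProduct_mulVec, hZ.2,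
    dot_self_star, dot_self_star, ← Complex.ofReal_sub, Complex.norm_real, Real.norm_eq_abs, sq_abs,
    hβ, hl] at h1
  have : (1:ℝ) ^ 2 / (1 - nsq γ) * (1 - nsq γ) ^ 2 = 1 - nsq γ := by field_simp
  linarith

theorem Zc_mem {β : Fin p → ℂ} {γ : Fin m → ℂ} (hβ : nsq β = 1) (hγ : nsq γ < 1) :
    Zc β γ ∈ Sset β γ := by
  constructor
  · apply mem_D_of_row
    intro y hy
    have h1 : y ᵥ* Zc β γ = (y ⬝ᵥ star β) • γ := by
      rw [Zc, vecMul_vecMulVec]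
    rw [h1, nsq_smul]
    have h2 := cs_dot y (star β)
    rw [nsq_star, hβ, mul_one] at h2
    have h3 := nsq_pos hy
    have h4 := nsq_nonneg γ
    calc _ ≤ nsq y * nsq γ := by gcongr
      _ < nsq y := by nlinarith
  · rw [Zc, vecMul_vecMulVec, dot_self_star, hβ]; simp

theorem S_circ {β : Fin p → ℂ} {γ : Fin m → ℂ} (hβ : nsq β = 1) (hγ : nsq γ < 1)
    {Z : Matrix (Fin p) (Fin m) ℂ} (hZ : Z ∈ Sset β γ) {z : ℂ} (hz : ‖z‖ ≤ 1) :
    Zc β γ + z • (Z - Zc β γ) ∈ Sset β γ := by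
  have hc := Zc_mem (β := β) hβ hγ
  refine ⟨?_, ?_⟩
  · apply mem_D_of_row
    intro y hy
    set s := y ⬝ᵥ star β with hs
    have h1 : y ᵥ* Zc β γ = s • γ := by
      rw [Zc, vecMul_vecMulVec]
    have h2 : y ᵥ* (Zc β γ + z • (Z - Zc β γ)) = (s • β + z • (y - s • β)) ᵥ* Z := by
      rw [vecMul_add, vecMul_smul, vecMul_sub, h1, add_vecMul, smul_vecMul, smul_vecMul, sub_vecMul,
        smul_vecMul, hZ.2]
    rw [h2]
    have h3 : star (s • β) ⬝ᵥ (y - s • β) = 0 := by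
      rw [dotProduct_sub, dotProduct_smul, star_smul, smul_dotProduct, smul_dotProduct,
        star_dot_self, hβ, dotProduct_comm, ← hs]
      simp; ring
    have h4 : nsq y = nsq (s • β) + nsq (y - s • β) := by
      conv_lhs => rw [show y = s • β + (y - s • β) by abel]
      rw [nsq_add, h3]; simp
    have h5 : nsq (s • β + z • (y - s • β)) ≤ nsq y := by
      rw [nsq_add, dotProduct_smul, h3, h4, nsq_smul z]
      simp
      have : ‖z‖ ^ 2 ≤ 1 := by rw [sq_le_one_iff₀ (norm_nonneg _)]; exact hz
      nlinarith [nsq_nonneg (y - s • β)]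
    by_cases h0 : s • β + z • (y - s • β) = 0
    · rw [h0]; simpa using nsq_pos hy
    · exact (mem_D_row hZ.1 _ h0).trans_le h5
  · rw [vecMul_add, vecMul_smul, vecMul_sub, hZ.2, hc.2]; simp

theorem S_circ_R {β : Fin p → ℂ} {γ : Fin m → ℂ} (hβ : nsq β = 1) (hγ : nsq γ < 1)
    {Z : Matrix (Fin p) (Fin m) ℂ} (hZ : Z ∈ Sset β γ) :
    ∃ R : ℝ, 1 < R ∧ ∀ z : ℂ, ‖z‖ < R → Zc β γ + z • (Z - Zc β γ) ∈ Sset β γ := by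
  have hc := Zc_mem (β := β) hβ hγ
  have hcont : Continuous fun t : ℝ => Zc β γ + (t : ℂ) • (Z - Zc β γ) := by fun_prop
  have h1 : (fun t : ℝ => Zc β γ + (t : ℂ) • (Z - Zc β γ)) ⁻¹' typeIDomain p m ∈ nhds (1:ℝ) := by
    apply (isOpen_D.preimage hcont).mem_nhds
    simpa using hZ.1
  obtain ⟨ε, hε, hb⟩ := Metric.mem_nhds_iff.1 h1
  have h2 : (1 + ε / 2 : ℝ) ∈ Metric.ball (1:ℝ) ε := by
    rw [Metric.mem_ball, Real.dist_eq]; rw [abs_of_pos] <;> linarith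
  have h3 := hb h2
  set R : ℝ := 1 + ε / 2 with hR
  have hR1 : 1 < R := by linarith
  have hS : Zc β γ + (R : ℂ) • (Z - Zc β γ) ∈ Sset β γ := by
    refine ⟨h3, ?_⟩
    rw [vecMul_add, vecMul_smul, vecMul_sub, hZ.2, hc.2]; simp
  refine ⟨R, hR1, fun z hz => ?_⟩
  have h4 := S_circ hβ hγ hS (z := z / R) (by
    rw [norm_div, Complex.norm_real, Real.norm_eq_abs, abs_of_pos (by linarith)]
    rw [div_le_one (by linarith)]; exact hz.le)
  have hne : (R : ℂ) ≠ 0 := by norm_cast; linarith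
  rwa [add_sub_cancel_left, smul_smul, div_mul_cancel₀ _ hne] at h4

theorem Zl_zero (β : Fin p → ℂ) (γ : Fin m → ℂ) (Z : Matrix (Fin p) (Fin m) ℂ) :
    Zl β γ Z 0 = sn Z 0 := by simp [Zl]

theorem Zl_diff (β : Fin p → ℂ) (γ : Fin m → ℂ) (Z : Matrix (Fin p) (Fin m) ℂ) :
    Differentiable ℂ (Zl β γ Z) := by
  rw [← differentiableOn_univ]
  refine sn_diff (differentiableOn_const _) ?_
  fun_prop

theorem mulVec_const_diff (v : Fin m → ℂ) :
    Differentiable ℂ fun Z : Matrix (Fin p) (Fin m) ℂ => Z *ᵥ v := by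
  rw [← differentiableOn_univ]
  exact vec_diff differentiableOn_id (differentiableOn_const _)

theorem Zl_diff2 (β : Fin p → ℂ) (γ : Fin m → ℂ) (l : ℂ) :
    Differentiable ℂ (fun Z => Zl β γ Z l) := by
  rw [← differentiableOn_univ]
  refine sn_diff differentiableOn_id ?_
  have := (mulVec_const_diff (p := p) (star γ))
  fun_prop

end PartF

section PartF2
open Set
variable {p m p' q' : ℕ} {f : Matrix (Fin p) (Fin (m + 1)) ℂ → Matrix (Fin p') (Fin q') ℂ}
  {β : Fin p → ℂ} {γ : Fin m → ℂ}

theorem bdry_opN (hf : PH p (m + 1) p' q' f) (hβ : nsq β = 1) (hγ : nsq γ < 1)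
    {Z : Matrix (Fin p) (Fin m) ℂ} (hZ : Z ∈ Sset β γ) (η : ℝ) (hη : 0 < η) :
    ∃ r < 1, ∀ l : ℂ, r < ‖l‖ → ‖l‖ < 1 → 1 - η < opN (f (Zl β γ Z l)) := by
  have hK := hf.comp {W | opN W ≤ 1 - η} (fun W hW => mem_D_iff.2 (by
    simp only [Set.mem_ofPred_eq] at hW; linarith)) (isCompact_opN _)
  have hT : IsCompact (Metric.closedBall (0:ℂ) 1 ∩
      (Zl β γ Z) ⁻¹' (typeIDomain p (m + 1) ∩ f ⁻¹' {W | opN W ≤ 1 - η})) :=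
    (isCompact_closedBall 0 1).inter_right (hK.isClosed.preimage (Zl_diff β γ Z).continuous)
  set T := (Metric.closedBall (0:ℂ) 1 ∩
      (Zl β γ Z) ⁻¹' (typeIDomain p (m + 1) ∩ f ⁻¹' {W | opN W ≤ 1 - η})) with hTd
  rcases T.eq_empty_or_nonempty with h | h
  · refine ⟨0, one_pos, fun l _ hl => ?_⟩
    by_contra hh
    have : l ∈ T := ⟨by simpa using hl.le, Zl_mem hβ hγ hZ hl, by simpa using hh⟩
    rw [h] at this; exact this
  · obtain ⟨x, hx, hmax⟩ := hT.exists_isMaxOn h continuous_norm.continuousOn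
    refine ⟨‖x‖, ?_, fun l hl1 hl => ?_⟩
    · have h1 : ‖x‖ ≤ 1 := by simpa using hx.1
      refine lt_of_le_of_ne h1 fun h2 => Zl_notMem hβ hγ hZ h2 hx.2.1
    · by_contra hh
      have : l ∈ T := ⟨by simpa using hl.le, Zl_mem hβ hγ hZ hl, by simpa using hh⟩
      have := hmax this
      simp only [Set.mem_ofPred_eq] at this
      linarith

theorem bdry_one (hf : PH p (m + 1) p' q' f) (hβ : nsq β = 1) (hγ : nsq γ < 1)
    {Z : Matrix (Fin p) (Fin m) ℂ} (hZ : Z ∈ Sset β γ) :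
    ∃ C : ℝ, 0 < C ∧ ∀ η : ℝ, 0 < η → ∀ l : ℂ, ‖l‖ < 1 → ∀ c, nsq c = 1 →
      1 - η ≤ nsq (f (Zl β γ (Zc β γ) l) *ᵥ c) →
      nsq (f (Zl β γ Z l) *ᵥ c - f (Zl β γ (Zc β γ) l) *ᵥ c) ≤ C * η := by
  obtain ⟨R, hR, hRS⟩ := S_circ_R hβ hγ hZ
  have hR' : 0 < R - 1 := by linarith
  refine ⟨2 * (2 / (R - 1) + (R + 1) / (R - 1)), by positivity, fun η hη l hl c hc h1 => ?_⟩
  set F0 := f (Zl β γ (Zc β γ) l) *ᵥ c with hF0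
  let F : ℂ → Fin p' → ℂ := fun z => f (Zl β γ (Zc β γ + z • (Z - Zc β γ)) l) *ᵥ c
  have hFle : ∀ z : ℂ, ‖z‖ < R → nsq (F z) ≤ 1 := fun z hz => by
    rw [← hc]; exact D_le (hf.maps (Zl_mem hβ hγ (hRS z hz) hl)) c
  have hF00 : F 0 = F0 := by simp [F, hF0]
  have hF01 : nsq F0 ≤ 1 := by rw [← hF00]; exact hFle 0 (by simp; linarith)
  have hF1 : F 1 = f (Zl β γ Z l) *ᵥ c := by simp [F]
  have hFd : DifferentiableOn ℂ F (Metric.ball 0 R) := by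
    refine vec_diff ?_ (differentiableOn_const _)
    refine hf.diff.comp ?_ fun z hz => Zl_mem hβ hγ (hRS z (by simpa using hz)) hl
    refine ((Zl_diff2 β γ l).comp ?_).differentiableOn
    fun_prop
  let u : ℂ → ℂ := fun z => star F0 ⬝ᵥ F z - 1
  have hud : DifferentiableOn ℂ u (Metric.ball 0 R) := by
    refine DifferentiableOn.sub_const ?_ 1
    simp only [dotProduct]
    refine DifferentiableOn.fun_sum fun i _ => ?_
    exact ((differentiableOn_pi.1 hFd) i).const_mul _
  have hum : MapsTo u (Metric.ball 0 R) {z | z.re ≤ η} := by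
    intro z hz
    have hz' : ‖z‖ < R := by simpa using hz
    have h2 := cs_dot (star F0) (F z)
    rw [nsq_star] at h2
    have h3 : ‖star F0 ⬝ᵥ F z‖ ^ 2 ≤ 1 := h2.trans (by
      have := hFle z hz'; nlinarith [nsq_nonneg F0, nsq_nonneg (F z)])
    have h4 : ‖star F0 ⬝ᵥ F z‖ ≤ 1 := by rwa [sq_le_one_iff₀ (norm_nonneg _)] at h3
    have h5 := Complex.re_le_norm (star F0 ⬝ᵥ F z)
    simp only [Set.mem_ofPred_eq, u, Complex.sub_re, Complex.one_re]
    linarith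
  have hbc := Complex.borelCaratheodory hη hud hum (by linarith) (z := 1) (by simpa using hR)
  have hu0 : ‖u 0‖ ≤ η := by
    simp only [u, hF00, star_dot_self]
    rw [← Complex.ofReal_one, ← Complex.ofReal_sub, Complex.norm_real, Real.norm_eq_abs, abs_le]
    constructor <;> linarith
  rw [norm_one, mul_one] at hbc
  have h6 : ‖u 1‖ ≤ (2 / (R - 1) + (R + 1) / (R - 1)) * η := by
    refine hbc.trans ?_
    rw [add_mul]
    refine add_le_add (le_of_eq (by ring)) ?_
    rw [mul_div_assoc, mul_comm]; gcongr
  have h7 : nsq (F 1 - F0) = nsq F0 + nsq (F 1) - 2 * (star F0 ⬝ᵥ F 1).re := by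
    rw [show F 1 - F0 = -F0 + F 1 by abel, nsq_add, nsq_neg, star_neg, neg_dotProduct]
    simp; ring
  rw [← hF1, h7]
  have h8 := Complex.abs_re_le_norm (u 1)
  have h9 : (u 1).re = (star F0 ⬝ᵥ F 1).re - 1 := by simp [u]
  rw [h9] at h8
  have h10 := hFle 1 (by simpa using hR)
  have h11 := (abs_le.1 (h8.trans h6)).1
  linarith

theorem bdry (hf : PH p (m + 1) p' q' f) (hβ : nsq β = 1) (hγ : nsq γ < 1)
    {ι : Type} [Finite ι] (Zi : ι → Matrix (Fin p) (Fin m) ℂ) (hZ : ∀ i, Zi i ∈ Sset β γ)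
    (ε : ℝ) (hε : 0 < ε) :
    ∃ r < 1, ∀ l : ℂ, r < ‖l‖ → ‖l‖ < 1 → ∃ c, nsq c = 1 ∧
      1 - ε ≤ nsq (f (Zl β γ (Zc β γ) l) *ᵥ c) ∧
      ∀ i, nsq (f (Zl β γ (Zi i) l) *ᵥ c - f (Zl β γ (Zc β γ) l) *ᵥ c) ≤ ε := by
  have := Fintype.ofFinite ι
  choose C hC hC2 using fun i => bdry_one hf hβ hγ (hZ i)
  have hs : 0 ≤ ∑ i, C i := Finset.sum_nonneg fun i _ => (hC i).le
  set η := ε / (1 + ∑ i, C i) with hη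
  have hη0 : 0 < η := by positivity
  have hη1 : η ≤ ε := div_le_self hε.le (by linarith)
  have hη2 : ∀ i, C i * η ≤ ε := fun i => by
    rw [hη, ← mul_div_assoc, div_le_iff₀ (by positivity)]
    have := Finset.single_le_sum (f := C) (fun i _ => (hC i).le) (Finset.mem_univ i)
    nlinarith
  obtain ⟨r, hr, hr2⟩ := bdry_opN hf hβ hγ (Zc_mem (β := β) hβ hγ) (min (η / 2) (1 / 2))
    (by positivity)
  refine ⟨r, hr, fun l hl hl1 => ?_⟩
  have h1 := hr2 l hl hl1
  have h2 : min (η / 2) (1 / 2) ≤ 1 / 2 := min_le_right _ _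
  have h2' : min (η / 2) (1 / 2) ≤ η / 2 := min_le_left _ _
  obtain ⟨c, hc, hc2⟩ := opN_attained (f (Zl β γ (Zc β γ) l)) (by linarith)
  have h3 : 1 - η ≤ nsq (f (Zl β γ (Zc β γ) l) *ᵥ c) := by rw [hc2]; nlinarith
  exact ⟨c, hc, by linarith, fun i => (hC2 i η hη0 l hl1 c hc h3).trans (hη2 i)⟩

end PartF2

section PartF3
open Set

theorem max_disc {d : ℂ → ℂ} (hd : DifferentiableOn ℂ d (Metric.ball 0 1))
    (h : ∀ ε > 0, ∃ r < 1, ∀ l : ℂ, r < ‖l‖ → ‖l‖ < 1 → ‖d l‖ ≤ ε) : d 0 = 0 := by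
  rw [← norm_le_zero_iff]
  refine le_of_forall_pos_le_add fun ε hε => ?_
  rw [zero_add]
  obtain ⟨r, hr, h1⟩ := h ε hε
  obtain ⟨s, hs1, hs2⟩ := exists_between (max_lt hr one_pos)
  have hs0 : 0 < s := (le_max_right _ _).trans_lt hs1
  have hsr : r < s := (le_max_left _ _).trans_lt hs1
  have hdc : DiffContOnCl ℂ d (Metric.ball 0 s) := by
    apply DifferentiableOn.diffContOnCl
    refine hd.mono ?_
    rw [closure_ball _ hs0.ne']
    exact Metric.closedBall_subset_ball hs2
  refine Complex.norm_le_of_forall_mem_frontier_norm_le Metric.isBounded_ball hdc ?_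
    (subset_closure (Metric.mem_ball_self hs0))
  intro z hz
  rw [frontier_ball _ hs0.ne'] at hz
  have hz' : ‖z‖ = s := by simpa using hz
  exact h1 z (by rw [hz']; exact hsr) (by rw [hz']; exact hs2)

theorem arc_disc {d : ℂ → ℂ} (hd : DifferentiableOn ℂ d (Metric.ball 0 1)) (B : ℝ)
    (hB : ∀ l : ℂ, ‖l‖ < 1 → ‖d l‖ ≤ B) (ls : ℂ) (hls : ‖ls‖ = 1) (ρ : ℝ) (hρ : 0 < ρ)
    (h : ∀ ε > 0, ∃ r < 1, ∀ l : ℂ, r < ‖l‖ → ‖l‖ < 1 → ‖l - ls‖ < ρ → ‖d l‖ ≤ ε) : d 0 = 0 := by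
  classical
  have hB0 : 0 ≤ B := (norm_nonneg _).trans (hB 0 (by simp))
  have hcov : Metric.sphere (0:ℂ) 1 ⊆ ⋃ u : Metric.sphere (0:ℂ) 1, {z : ℂ | ‖u.1 * z - ls‖ < ρ / 2} := by
    intro z hz
    have hz1 : ‖z‖ = 1 := by simpa using hz
    have hz0 : z ≠ 0 := by rintro rfl; simp at hz1
    rw [mem_iUnion]
    refine ⟨⟨ls / z, by simp [hls, hz1]⟩, ?_⟩
    simp [div_mul_cancel₀ _ hz0, hρ]
  obtain ⟨t, ht⟩ := (isCompact_sphere (0:ℂ) 1).elim_finite_subcover _ (fun u =>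
    isOpen_lt (by fun_prop) continuous_const) hcov
  have hu : ∀ u : Metric.sphere (0:ℂ) 1, ‖u.1‖ = 1 := fun u => by simp
  have key : (fun l => ∏ u ∈ t, d (u.1 * l)) 0 = 0 := by
    refine max_disc (d := fun l => ∏ u ∈ t, d (u.1 * l)) ?_ ?_
    · refine DifferentiableOn.fun_finsetProd fun u _ => ?_
      refine hd.comp (by fun_prop) ?_
      intro l hl
      simpa [hu u] using hl
    · intro ε hε
      obtain ⟨r, hr, h1⟩ := h (ε / (B + 1) ^ t.card) (by positivity)
      refine ⟨max (max r 0) (1 - ρ / 2), max_lt (max_lt hr one_pos) (by linarith), fun l hl hl1 => ?_⟩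
      have hr1 : r < ‖l‖ := ((le_max_left _ _).trans (le_max_left _ _)).trans_lt hl
      have hr0 : 0 < ‖l‖ := ((le_max_right _ _).trans (le_max_left _ _)).trans_lt hl
      have hr2 : 1 - ρ / 2 < ‖l‖ := (le_max_right _ _).trans_lt hl
      have hl0 : (‖l‖ : ℂ) ≠ 0 := by exact_mod_cast hr0.ne'
      have hmem : l / ‖l‖ ∈ Metric.sphere (0:ℂ) 1 := by
        simp [norm_div, hr0.ne']
      obtain ⟨u, hut, hu2⟩ := mem_iUnion₂.1 (ht hmem)
      simp only [Set.mem_ofPred_eq] at hu2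
      have h3 : ‖u.1 * l - ls‖ < ρ := by
        have h4 : u.1 * l - ls = (u.1 * (l / ‖l‖) - ls) + u.1 * (l / ‖l‖) * ((‖l‖ : ℂ) - 1) := by
          field_simp; ring
        have h5 : ‖u.1 * (l / ‖l‖) * ((‖l‖ : ℂ) - 1)‖ = 1 - ‖l‖ := by
          rw [norm_mul, norm_mul, hu u, ← Complex.ofReal_one, ← Complex.ofReal_sub,
            Complex.norm_real, Real.norm_eq_abs, abs_of_neg (by linarith)]
          rw [show ‖l / (‖l‖ : ℂ)‖ = 1 by simpa using hmem]; ring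
        rw [h4]
        refine (norm_add_le _ _).trans_lt ?_
        rw [h5]; linarith
      have h6 := h1 (u.1 * l) (by rw [norm_mul, hu u, one_mul]; exact hr1)
        (by rw [norm_mul, hu u, one_mul]; exact hl1) h3
      rw [← Finset.mul_prod_erase t _ hut, norm_mul, norm_prod]
      have h7 : ∏ v ∈ t.erase u, ‖d (v.1 * l)‖ ≤ (B + 1) ^ t.card := by
        refine (Finset.prod_le_prod (g := fun _ => B + 1) (fun _ _ => norm_nonneg _) fun v _ => ?_).trans ?_
        · have := hB (v.1 * l) (by rw [norm_mul, hu v, one_mul]; exact hl1)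
          linarith
        · rw [Finset.prod_const]
          exact pow_le_pow_right₀ (by linarith) (Finset.card_erase_le)
      calc _ ≤ ε / (B + 1) ^ t.card * (B + 1) ^ t.card := by
            refine mul_le_mul h6 h7 (Finset.prod_nonneg fun _ _ => norm_nonneg _) (by positivity)
        _ = ε := by field_simp
  simp only [mul_zero, Finset.prod_const] at key
  exact eq_zero_of_pow_eq_zero key

theorem adj_bound (n : ℕ) (B : ℝ) : ∃ C : ℝ, 0 < C ∧ ∀ M : Matrix (Fin n) (Fin n) ℂ,
    (∀ i j, ‖M i j‖ ≤ B) → ∀ v, nsq (M.adjugate *ᵥ v) ≤ C * nsq v := by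
  have hprop : ProperSpace (Matrix (Fin n) (Fin n) ℂ) := FiniteDimensional.proper ℂ _
  have hK : IsCompact {M : Matrix (Fin n) (Fin n) ℂ | ∀ i j, ‖M i j‖ ≤ B} := by
    refine Metric.isCompact_of_isClosed_isBounded ?_ ?_
    · simp only [Set.ofPred_forall]
      refine isClosed_iInter fun i => isClosed_iInter fun j => isClosed_le ?_ continuous_const
      exact ((continuous_apply j).comp (continuous_apply i)).norm
    · rw [isBounded_iff_forall_norm_le]
      refine ⟨max B 0, fun M hM => (Matrix.norm_le_iff (le_max_right _ _)).2 fun i j => ?_⟩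
      exact (hM i j).trans (le_max_left _ _)
  have hcont : Continuous fun M : Matrix (Fin n) (Fin n) ℂ => opN M.adjugate :=
    continuous_opN.comp (continuous_id.matrix_adjugate)
  obtain ⟨C, hC⟩ := (hK.image hcont).isBounded.bddAbove
  refine ⟨(|C| + 1) ^ 2, by positivity, fun M hM v => (nsq_mulVec_le _ _).trans ?_⟩
  have h1 : opN M.adjugate ≤ C := hC ⟨M, hM, rfl⟩
  have h2 := opN_nonneg M.adjugate
  have h3 := nsq_nonneg v
  gcongr
  linarith [le_abs_self C]

theorem det_bound (n : ℕ) (B : ℝ) : ∃ C : ℝ, 0 < C ∧ ∀ M : Matrix (Fin n) (Fin n) ℂ,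
    (∀ i j, ‖M i j‖ ≤ B) → ∀ c, nsq c = 1 → ‖M.det‖ ^ 2 ≤ C * nsq (M *ᵥ c) := by
  obtain ⟨C, hC, h⟩ := adj_bound n B
  refine ⟨C, hC, fun M hM c hc => ?_⟩
  have := h M hM (M *ᵥ c)
  rwa [mulVec_mulVec, adjugate_mul, smul_mulVec, one_mulVec, nsq_smul, hc, mul_one] at this

end PartF3

section PartF4
open Set
variable {p m p' q' : ℕ} {f : Matrix (Fin p) (Fin (m + 1)) ℂ → Matrix (Fin p') (Fin q') ℂ}
  {β : Fin p → ℂ} {γ : Fin m → ℂ}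

theorem F_entry_diff (hf : PH p (m + 1) p' q' f) (hβ : nsq β = 1) (hγ : nsq γ < 1)
    {Z : Matrix (Fin p) (Fin m) ℂ} (hZ : Z ∈ Sset β γ) (i j) :
    DifferentiableOn ℂ (fun l => f (Zl β γ Z l) i j) (Metric.ball 0 1) := by
  have h : DifferentiableOn ℂ (fun l => f (Zl β γ Z l)) (Metric.ball 0 1) :=
    hf.diff.comp (Zl_diff β γ Z).differentiableOn fun l hl => Zl_mem hβ hγ hZ (by simpa using hl)
  exact matrix_diff.1 h i j

theorem F_entry_le (hf : PH p (m + 1) p' q' f) (hβ : nsq β = 1) (hγ : nsq γ < 1)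
    {Z : Matrix (Fin p) (Fin m) ℂ} (hZ : Z ∈ Sset β γ) {l : ℂ} (hl : ‖l‖ < 1) (i j) :
    ‖f (Zl β γ Z l) i j‖ ≤ 1 :=
  (entry_le _ _ _).trans (mem_D_iff.1 (hf.maps (Zl_mem hβ hγ hZ hl))).le

theorem K_ne_norm (hf : PH p (m + 1) p' q' f) (hβ : nsq β = 1) (hγ : nsq γ < 1) :
    ∃ c, c ≠ 0 ∧ ∀ Z ∈ Sset β γ, f (sn Z 0) *ᵥ c = f (sn (Zc β γ) 0) *ᵥ c := by
  by_contra hcon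
  push Not at hcon
  let Λ : (Sset β γ) × Fin p' → Fin q' → ℂ := fun x =>
    (f (sn x.1.1 0) - f (sn (Zc β γ) 0)) x.2
  obtain ⟨r, hr⟩ := rows_lemma Λ (by
    intro c hc
    by_contra h0
    obtain ⟨Z, hZ, hne⟩ := hcon c h0
    apply hne
    ext k
    have := hc (⟨Z, hZ⟩, k)
    simp only [Λ] at this
    have h2 : ((f (sn Z 0) - f (sn (Zc β γ) 0)) *ᵥ c) k = 0 := this
    rw [sub_mulVec] at h2
    exact sub_eq_zero.1 h2)
  let M : ℂ → Matrix (Fin q') (Fin q') ℂ := fun l => Matrix.of fun k j =>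
    f (Zl β γ (r k).1.1 l) (r k).2 j - f (Zl β γ (Zc β γ) l) (r k).2 j
  have hc := Zc_mem (β := β) hβ hγ
  have hM0 : M 0 = Matrix.of fun k => Λ (r k) := by
    ext k j; simp [M, Λ, Zl_zero]
  apply hr
  rw [← hM0]
  refine max_disc (d := fun l => (M l).det) ?_ ?_
  · refine det_diff fun i j => ?_
    simp only [M, Matrix.of_apply]
    exact (F_entry_diff hf hβ hγ (r i).1.2 _ _).sub (F_entry_diff hf hβ hγ hc _ _)
  · intro ε hε
    obtain ⟨C, hC, hC2⟩ := det_bound q' 2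
    obtain ⟨s, hs, hs2⟩ := bdry hf hβ hγ (fun k => (r k).1.1) (fun k => (r k).1.2)
      (ε ^ 2 / (C * (q' + 1))) (by positivity)
    refine ⟨s, hs, fun l hl hl1 => ?_⟩
    obtain ⟨c, hc1, -, hc3⟩ := hs2 l hl hl1
    have h1 := hC2 (M l) (fun i j => by
      simp only [M, Matrix.of_apply]
      refine (norm_sub_le _ _).trans ?_
      have := F_entry_le hf hβ hγ (r i).1.2 hl1 (r i).2 j
      have := F_entry_le hf hβ hγ hc hl1 (r i).2 j
      linarith) c hc1
    have h2 : nsq (M l *ᵥ c) ≤ (q' : ℝ) * (ε ^ 2 / (C * (q' + 1))) := by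
      have : ∀ k, ‖(M l *ᵥ c) k‖ ^ 2 ≤ ε ^ 2 / (C * (q' + 1)) := fun k => by
        refine le_trans ?_ (hc3 k)
        have := norm_le_sqrt_nsq (f (Zl β γ (r k).1.1 l) *ᵥ c - f (Zl β γ (Zc β γ) l) *ᵥ c) (r k).2
        refine le_trans (le_of_eq ?_) this
        congr 2
        simp [M, mulVec, dotProduct, sub_mul]
      refine (Finset.sum_le_sum fun k _ => this k).trans (le_of_eq ?_)
      simp
    have h3 : ‖(M l).det‖ ^ 2 ≤ ε ^ 2 := by
      refine h1.trans ?_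
      calc C * nsq (M l *ᵥ c) ≤ C * ((q' : ℝ) * (ε ^ 2 / (C * (q' + 1)))) := by gcongr
        _ = ε ^ 2 * (q' / (q' + 1)) := by field_simp
        _ ≤ ε ^ 2 * 1 := by
          gcongr
          rw [div_le_one (by positivity)]; linarith
        _ = ε ^ 2 := mul_one _
    exact le_of_sq_le_sq h3 hε.le

theorem Sset_smul (k : ℂ) (hk : k ≠ 0) (β : Fin p → ℂ) (γ : Fin m → ℂ) :
    Sset (k • β) (k • γ) = Sset β γ := by
  ext Z
  simp only [Sset, Set.mem_ofPred_eq, smul_vecMul]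
  constructor
  · rintro ⟨h1, h2⟩; exact ⟨h1, smul_right_injective _ hk h2⟩
  · rintro ⟨h1, h2⟩; exact ⟨h1, by rw [h2]⟩

theorem exists_normal (h : nsq γ < nsq β) : ∃ k : ℂ, k ≠ 0 ∧ nsq (k • β) = 1 ∧ nsq (k • γ) < 1 := by
  have hb : 0 < nsq β := (nsq_nonneg γ).trans_lt h
  have hk : ‖((1 / Real.sqrt (nsq β) : ℝ) : ℂ)‖ ^ 2 = 1 / nsq β := by
    rw [Complex.norm_real, Real.norm_eq_abs, sq_abs, div_pow, Real.sq_sqrt hb.le, one_pow]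
  refine ⟨((1 / Real.sqrt (nsq β) : ℝ) : ℂ), ?_, ?_, ?_⟩
  · norm_cast; positivity
  · rw [nsq_smul, hk]; field_simp
  · rw [nsq_smul, hk, one_div_mul_eq_div, div_lt_one hb]; exact h

theorem K_ne (hf : PH p (m + 1) p' q' f) (h : nsq γ < nsq β) :
    ∃ c, c ≠ 0 ∧ ∀ Z ∈ Sset β γ, ∀ Z' ∈ Sset β γ, f (sn Z 0) *ᵥ c = f (sn Z' 0) *ᵥ c := by
  obtain ⟨k, hk, h1, h2⟩ := exists_normal h
  obtain ⟨c, hc, hc2⟩ := K_ne_norm hf h1 h2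
  rw [Sset_smul k hk] at hc2
  exact ⟨c, hc, fun Z hZ Z' hZ' => (hc2 Z hZ).trans (hc2 Z' hZ').symm⟩

end PartF4

section PartG
open Set Topology

theorem const_line {E F : Type} [NormedAddCommGroup E] [NormedSpace ℂ E]
    [NormedAddCommGroup F] [NormedSpace ℂ F] [FiniteDimensional ℂ E] [FiniteDimensional ℂ F]
    {U : Set E} (hU : IsOpen U) (hc : Convex ℝ U) {f : E → F} (hf : DifferentiableOn ℂ f U)
    (L : F →L[ℂ] ℂ) {z₀ z : E} (hz₀ : z₀ ∈ U) (hz : z ∈ U)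
    (h : ∀ k, L ((Dir (z - z₀))^[k + 1] f z₀) = 0) : L (f z) = L (f z₀) := by
  have : CompleteSpace F := FiniteDimensional.complete ℂ F
  set X := z - z₀ with hX
  have hac : Continuous fun s : ℂ => z₀ + s • X := by fun_prop
  set V := (fun s : ℂ => z₀ + s • X) ⁻¹' U with hV
  have hVo : IsOpen V := hU.preimage hac
  have hVc : Convex ℝ V := by
    intro a ha b hb s t hs ht hst
    have := hc ha hb hs ht hst
    simp only [hV, mem_preimage]
    convert this using 1
    simp only [smul_add, add_smul, smul_assoc]
    rw [show s • z₀ + s • a • X + (t • z₀ + t • b • X) = (s + t) • z₀ + (s • a • X + t • b • X) by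
      rw [add_smul]; abel, hst, one_smul]
  have hd : DifferentiableOn ℂ (fun s : ℂ => f (z₀ + s • X)) V :=
    hf.comp (by fun_prop) fun s hs => hs
  have h0 : (0:ℂ) ∈ V := by simpa [hV] using hz₀
  have h1 : (1:ℂ) ∈ V := by simpa [hV, hX] using hz
  obtain ⟨r, hr, hrV⟩ := Metric.isOpen_iff.1 hVo 0 h0
  have hz : (fun s : ℂ => L (f (z₀ + s • X)) - L (f z₀)) =ᶠ[𝓝 0] 0 := by
    filter_upwards [Metric.ball_mem_nhds 0 hr] with s hs
    have hs2 := Complex.hasSum_taylorSeries_on_ball (hd.mono hrV) hs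
    have hs3 := (L.hasSum hs2)
    have hs4 := hasSum_single (f := fun n : ℕ => L ((n.factorial : ℂ)⁻¹ • (s - 0) ^ n •
      iteratedDeriv n (fun s : ℂ => f (z₀ + s • X)) 0)) 0 (by
        intro n hn
        obtain ⟨k, rfl⟩ := Nat.exists_eq_succ_of_ne_zero hn
        rw [iteratedDeriv_line hU hf z₀ X _ 0 (by simpa using hz₀)]
        simp only [zero_smul, add_zero, map_smul]
        have := h k
        simp only [Nat.succ_eq_add_one, this, smul_zero])
    have := hs3.unique hs4
    simp at this
    simp [this]
  have hfin := holo_ident hVo hVc (f := fun s : ℂ => L (f (z₀ + s • X)) - L (f z₀))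
    ((L.differentiable.comp_differentiableOn hd).sub_const _) h0 hz 1 h1
  rw [sub_eq_zero] at hfin
  simpa [hX] using hfin

variable {p m p' q' : ℕ}

/-- the set of admissible parameters -/
def Om (p m : ℕ) : Set ((Fin p → ℂ) × (Fin m → ℂ)) := {x | nsq x.2 < nsq x.1}

theorem isOpen_Om : IsOpen (Om p m) :=
  isOpen_lt (continuous_nsq.comp continuous_snd) (continuous_nsq.comp continuous_fst)

/-- dot with a fixed vector as CLM -/
noncomputable def dotL {n : ℕ} (c : Fin n → ℂ) : (Fin n → ℂ) →L[ℂ] ℂ :=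
  LinearMap.toContinuousLinearMap
    { toFun := fun v => v ⬝ᵥ c
      map_add' := fun u v => add_dotProduct u v c
      map_smul' := fun a v => by simp }

@[simp] theorem dotL_apply {n : ℕ} (c v : Fin n → ℂ) : dotL c v = v ⬝ᵥ c := rfl

/-- admissible class -/
def Cls (U : Set ((Fin p → ℂ) × (Fin m → ℂ))) (q : (Fin p → ℂ) × (Fin m → ℂ) → Fin q' → ℂ)
    (h : Matrix (Fin p) (Fin m) ℂ → Fin q' → ℂ) : Prop :=
  DifferentiableOn ℂ h (typeIDomain p m) ∧ ∀ β γ, (β, γ) ∈ U → ∀ Z ∈ typeIDomain p m, β ᵥ* Z = γ →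
    ∀ X : Matrix (Fin p) (Fin m) ℂ, β ᵥ* X = 0 → Dir X h Z ⬝ᵥ q (β, γ) = 0

theorem cls_full {U : Set ((Fin p → ℂ) × (Fin m → ℂ))} (hU : IsOpen U) (hUO : U ⊆ Om p m)
    {q : (Fin p → ℂ) × (Fin m → ℂ) → Fin q' → ℂ} (hq : ContinuousOn q U) (hqp : q' < p)
    {h : Matrix (Fin p) (Fin m) ℂ → Fin q' → ℂ} (hh : Cls U q h)
    {β : Fin p → ℂ} {γ : Fin m → ℂ} (hx : (β, γ) ∈ U) {Z : Matrix (Fin p) (Fin m) ℂ}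
    (hZ : Z ∈ typeIDomain p m) (hβZ : β ᵥ* Z = γ) (X : Matrix (Fin p) (Fin m) ℂ) :
    Dir X h Z ⬝ᵥ q (β, γ) = 0 := by
  -- the map β ↦ (β, βZ)
  let e : (Fin p → ℂ) → (Fin p → ℂ) × (Fin m → ℂ) := fun b => (b, b ᵥ* Z)
  have he : Continuous e := by
    refine continuous_id.prodMk ?_
    exact continuous_id.matrix_vecMul continuous_const
  -- rank one directions
  have hone : ∀ j : Fin m, ∀ u : Fin p → ℂ, Dir (vecMulVec u (Pi.single j 1)) h Z ⬝ᵥ q (β, γ) = 0 := by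
    intro j
    let T : (Fin q' → ℂ) →ₗ[ℂ] (Fin p → ℂ) :=
      { toFun := fun c i => fderiv ℂ h Z (vecMulVec (Pi.single i 1) (Pi.single j 1)) ⬝ᵥ c
        map_add' := fun c d => by ext i; simp [dotProduct_add]
        map_smul' := fun a c => by ext i; simp }
    have hT : ∀ c u, Dir (vecMulVec u (Pi.single j 1)) h Z ⬝ᵥ c = T c ⬝ᵥ u := by
      intro c u
      have h1 : vecMulVec u (Pi.single j (1:ℂ)) =
          ∑ i, u i • vecMulVec (Pi.single i (1:ℂ)) (Pi.single j (1:ℂ) : Fin m → ℂ) := by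
        ext a b
        simp [vecMulVec_apply, Matrix.sum_apply, Pi.single_apply]
      rw [Dir, h1, map_sum, sum_dotProduct]
      change _ = ∑ i, _ * _
      refine Finset.sum_congr rfl fun i _ => ?_
      rw [map_smul, smul_dotProduct, smul_eq_mul, mul_comm]
      rfl
    have hTc : Continuous T := LinearMap.continuous_of_finiteDimensional T
    -- show T (q (β, γ)) = 0
    suffices hT0 : T (q (β, γ)) = 0 by
      intro u; rw [hT, hT0, zero_dotProduct]
    by_contra hne
    let V : Set (Fin p → ℂ) := e ⁻¹' U
    have hVo : IsOpen V := hU.preimage he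
    have hcont : ContinuousOn (fun b => T (q (e b))) V :=
      hTc.comp_continuousOn (hq.comp he.continuousOn fun b hb => hb)
    have hWo : IsOpen (V ∩ (fun b => T (q (e b))) ⁻¹' {0}ᶜ) :=
      hcont.isOpen_inter_preimage hVo isOpen_compl_singleton
    have hsub : V ∩ (fun b => T (q (e b))) ⁻¹' {0}ᶜ ⊆ (LinearMap.range T : Set (Fin p → ℂ)) := by
      rintro b ⟨hb, hb2⟩
      have hb2' : T (q (e b)) ≠ 0 := hb2
      have hker : ∀ u : Fin p → ℂ, b ⬝ᵥ u = 0 → T (q (e b)) ⬝ᵥ u = 0 := by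
        intro u hu
        rw [← hT]
        refine hh.2 b (b ᵥ* Z) hb Z hZ rfl _ ?_
        rw [vecMul_vecMulVec, hu, zero_smul]
      have hb0 : 0 < nsq b := (nsq_nonneg _).trans_lt (hUO hb)
      set t := T (q (e b)) with ht
      -- t = ψ b
      have hpsi : t = (t ⬝ᵥ star b / (nsq b : ℂ)) • b := by
        have hnb : (nsq b : ℂ) ≠ 0 := by exact_mod_cast hb0.ne'
        set w := t - (t ⬝ᵥ star b / (nsq b : ℂ)) • b with hw
        have h1 : b ⬝ᵥ star w = 0 := by
          have : w ⬝ᵥ star b = 0 := by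
            rw [hw, sub_dotProduct, smul_dotProduct, dot_self_star, smul_eq_mul,
              div_mul_cancel₀ _ hnb, sub_self]
          have h2 := congrArg star this
          rw [dotProduct_comm, dot_star_swap, star_zero, dotProduct_comm] at h2
          exact h2
        have h2 := hker _ h1
        have h3 : w ⬝ᵥ star w = 0 := by
          conv_lhs => rw [hw]
          rw [sub_dotProduct, smul_dotProduct, ← hw, h1, h2]; simp
        rw [dot_self_star] at h3
        have : w = 0 := nsq_eq_zero.1 (by exact_mod_cast h3)
        exact sub_eq_zero.1 this
      have hψ : t ⬝ᵥ star b / (nsq b : ℂ) ≠ 0 := by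
        intro h0; rw [h0, zero_smul] at hpsi; exact hb2' hpsi
      refine ⟨(t ⬝ᵥ star b / (nsq b : ℂ))⁻¹ • q (e b), ?_⟩
      rw [map_smul, ← ht]
      exact (inv_smul_eq_iff₀ hψ).2 hpsi
    have hx' : β ∈ V ∩ (fun b => T (q (e b))) ⁻¹' {0}ᶜ := by
      refine ⟨?_, ?_⟩
      · change (β, β ᵥ* Z) ∈ U
        rw [hβZ]; exact hx
      · change T (q (β, β ᵥ* Z)) ≠ 0
        rw [hβZ]; exact hne
    have htop := Submodule.eq_top_of_nonempty_interior' (LinearMap.range T)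
      ⟨β, interior_maximal hsub hWo hx'⟩
    have hfr := LinearMap.finrank_range_le T
    rw [htop, finrank_top] at hfr
    simp at hfr
    omega
  have hX : X = ∑ j, vecMulVec (fun i => X i j) (Pi.single j (1:ℂ)) := by
    ext a b
    simp [vecMulVec_apply, Matrix.sum_apply, Pi.single_apply]
  have h2 : Dir X h Z = ∑ j, Dir (vecMulVec (fun i => X i j) (Pi.single j (1:ℂ))) h Z := by
    conv_lhs => rw [hX]
    simp only [Dir, map_sum]
  rw [h2, sum_dotProduct]
  exact Finset.sum_eq_zero fun j _ => hone j _

theorem cls_step {U : Set ((Fin p → ℂ) × (Fin m → ℂ))} (hU : IsOpen U) (hUO : U ⊆ Om p m)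
    {q : (Fin p → ℂ) × (Fin m → ℂ) → Fin q' → ℂ} (hq : ContinuousOn q U) (hqp : q' < p)
    {h : Matrix (Fin p) (Fin m) ℂ → Fin q' → ℂ} (hh : Cls U q h) (Y : Matrix (Fin p) (Fin m) ℂ) :
    Cls U q (Dir Y h) := by
  have hd : DifferentiableOn ℂ (Dir Y h) (typeIDomain p m) := holo_fderiv_apply isOpen_D hh.1 Y
  refine ⟨hd, fun β γ hx Z hZ hβ X hX => ?_⟩
  have hder := deriv_line (f := Dir Y h) (z := Z) (X := X) (s := 0) (by
    rw [zero_smul, add_zero]; exact (hd Z hZ).differentiableAt (isOpen_D.mem_nhds hZ))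
  have hder2 := (dotL (q (β, γ))).hasFDerivAt.comp_hasDerivAt 0 hder
  have hev : (fun s : ℂ => dotL (q (β, γ)) (Dir Y h (Z + s • X))) =ᶠ[𝓝 0] fun _ => 0 := by
    have hc : Continuous fun s : ℂ => Z + s • X := by fun_prop
    have : (fun s : ℂ => Z + s • X) ⁻¹' typeIDomain p m ∈ 𝓝 (0:ℂ) :=
      (isOpen_D.preimage hc).mem_nhds (by simpa using hZ)
    filter_upwards [this] with s hs
    refine cls_full hU hUO hq hqp hh hx hs ?_ Y
    rw [vecMul_add, vecMul_smul, hX, hβ]; simp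
  have h3 := hder2.unique ((hasDerivAt_const (0:ℂ) (0:ℂ)).congr_of_eventuallyEq hev)
  simpa using h3

theorem cls_iter {U : Set ((Fin p → ℂ) × (Fin m → ℂ))} (hU : IsOpen U) (hUO : U ⊆ Om p m)
    {q : (Fin p → ℂ) × (Fin m → ℂ) → Fin q' → ℂ} (hq : ContinuousOn q U) (hqp : q' < p)
    {h : Matrix (Fin p) (Fin m) ℂ → Fin q' → ℂ} (hh : Cls U q h) (Y : Matrix (Fin p) (Fin m) ℂ)
    (k : ℕ) : Cls U q ((Dir Y)^[k] h) := by
  induction k with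
  | zero => exact hh
  | succ k ih => rw [Function.iterate_succ_apply']; exact cls_step hU hUO hq hqp ih Y

theorem cls_const {U : Set ((Fin p → ℂ) × (Fin m → ℂ))} (hU : IsOpen U) (hUO : U ⊆ Om p m)
    {q : (Fin p → ℂ) × (Fin m → ℂ) → Fin q' → ℂ} (hq : ContinuousOn q U) (hqp : q' < p)
    {h : Matrix (Fin p) (Fin m) ℂ → Fin q' → ℂ} (hh : Cls U q h)
    {β : Fin p → ℂ} {γ : Fin m → ℂ} (hx : (β, γ) ∈ U) {Z₀ Z : Matrix (Fin p) (Fin m) ℂ}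
    (hZ₀ : Z₀ ∈ Sset β γ) (hZ : Z ∈ typeIDomain p m) : h Z ⬝ᵥ q (β, γ) = h Z₀ ⬝ᵥ q (β, γ) := by
  refine const_line isOpen_D convex_D hh.1 (dotL (q (β, γ))) hZ₀.1 hZ fun k => ?_
  rw [Function.iterate_succ_apply', dotL_apply]
  exact cls_full hU hUO hq hqp (cls_iter hU hUO hq hqp hh _ k) hx hZ₀.1 hZ₀.2 _

end PartG

section PartG2
open Set Topology
variable {p m p' q' : ℕ}

/-- projection to the slice -/
noncomputable def Wx (x : (Fin p → ℂ) × (Fin m → ℂ)) (Y : Matrix (Fin p) (Fin m) ℂ) :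
    Matrix (Fin p) (Fin m) ℂ :=
  Y + vecMulVec (star x.1) ((1 / (nsq x.1 : ℂ)) • (x.2 - x.1 ᵥ* Y))

theorem Wx_row {x : (Fin p → ℂ) × (Fin m → ℂ)} (hx : x ∈ Om p m) (Y : Matrix (Fin p) (Fin m) ℂ) :
    x.1 ᵥ* Wx x Y = x.2 := by
  have hb0 : 0 < nsq x.1 := (nsq_nonneg _).trans_lt hx
  have hnb : (nsq x.1 : ℂ) ≠ 0 := by exact_mod_cast hb0.ne'
  rw [Wx, vecMul_add, vecMul_vecMulVec, dot_self_star, smul_smul, mul_one_div_cancel hnb, one_smul]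
  abel

theorem Wx_self {x : (Fin p → ℂ) × (Fin m → ℂ)} (Y : Matrix (Fin p) (Fin m) ℂ)
    (hY : x.1 ᵥ* Y = x.2) : Wx x Y = Y := by
  rw [Wx, hY, sub_self, smul_zero]; ext; simp [vecMulVec_apply]

theorem Wx_zero_mem {x : (Fin p → ℂ) × (Fin m → ℂ)} (hx : x ∈ Om p m) : Wx x 0 ∈ Sset x.1 x.2 := by
  refine ⟨?_, Wx_row hx 0⟩
  have hb0 : 0 < nsq x.1 := (nsq_nonneg _).trans_lt hx
  apply mem_D_of_row
  intro y hy
  rw [Wx, zero_add, vecMul_zero, sub_zero, vecMul_vecMulVec, smul_smul, nsq_smul, norm_mul, mul_pow]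
  have h1 := cs_dot y (star x.1)
  rw [nsq_star] at h1
  have h2 : ‖(1 / (nsq x.1 : ℂ))‖ ^ 2 = 1 / nsq x.1 ^ 2 := by
    rw [norm_div, Complex.norm_real, Real.norm_eq_abs, div_pow, sq_abs]; simp
  rw [h2]
  have h3 := nsq_pos hy
  have h4 := nsq_nonneg x.2
  have hx' : nsq x.2 < nsq x.1 := hx
  calc _ ≤ (nsq y * nsq x.1) * (1 / nsq x.1 ^ 2) * nsq x.2 := by gcongr
    _ = nsq y * (nsq x.2 / nsq x.1) := by field_simp
    _ < nsq y * 1 := by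
      gcongr
      rw [div_lt_one hb0]; exact hx'
    _ = nsq y := mul_one _

theorem Wx_cont (Y : Matrix (Fin p) (Fin m) ℂ) : ContinuousOn (fun x => Wx x Y) (Om p m) := by
  have hn : ∀ x ∈ Om p m, (nsq x.1 : ℂ) ≠ 0 := fun x hx => by
    have : 0 < nsq x.1 := (nsq_nonneg _).trans_lt hx
    exact_mod_cast this.ne'
  refine continuousOn_pi.2 fun i => continuousOn_pi.2 fun j => ?_
  simp only [Wx, Matrix.add_apply, vecMulVec_apply, Pi.smul_apply, Pi.sub_apply, Pi.star_apply,
    smul_eq_mul, vecMul, dotProduct]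
  have h1 : ContinuousOn (fun x : (Fin p → ℂ) × (Fin m → ℂ) => 1 / (nsq x.1 : ℂ)) (Om p m) := by
    refine ContinuousOn.div continuousOn_const ?_ hn
    exact (Complex.continuous_ofReal.comp (continuous_nsq.comp continuous_fst)).continuousOn
  have h2 : Continuous fun x : (Fin p → ℂ) × (Fin m → ℂ) => x.2 j - ∑ i, x.1 i * Y i j := by fun_prop
  have h3 : Continuous fun x : (Fin p → ℂ) × (Fin m → ℂ) => star (x.1 i) := by fun_prop
  exact continuousOn_const.add (h3.continuousOn.mul (h1.mul h2.continuousOn))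

/-- cutoff -/
noncomputable def cut (Z : Matrix (Fin p) (Fin m) ℂ) : ℝ := max 0 (1 - opN Z)

theorem cut_cont {g : Matrix (Fin p) (Fin m) ℂ → ℂ} (hg : ContinuousOn g (typeIDomain p m))
    (hb : ∀ Z ∈ typeIDomain p m, ‖g Z‖ ≤ 1) : Continuous fun Z => (cut Z : ℂ) * g Z := by
  have hcc : Continuous fun Z : Matrix (Fin p) (Fin m) ℂ => cut Z :=
    continuous_const.max (continuous_const.sub continuous_opN)
  rw [continuous_iff_continuousAt]
  intro Z
  by_cases hZ : Z ∈ typeIDomain p m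
  · exact (Complex.continuous_ofReal.comp hcc).continuousAt.mul
      (hg.continuousAt (isOpen_D.mem_nhds hZ))
  · have hz : ∀ Z ∉ typeIDomain p m, cut Z = 0 := fun Z hZ => by
      rw [mem_D_iff] at hZ; exact max_eq_left (by linarith)
    have h0 : (cut Z : ℂ) * g Z = 0 := by simp [hz Z hZ]
    rw [ContinuousAt, h0]
    refine squeeze_zero_norm (a := fun W => cut W) (fun W => ?_) ?_
    · have h1 : 0 ≤ cut W := le_max_left _ _
      rw [norm_mul, Complex.norm_real, Real.norm_eq_abs, abs_of_nonneg h1]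
      by_cases hW : W ∈ typeIDomain p m
      · exact mul_le_of_le_one_right h1 (hb W hW)
      · simp [hz W hW]
    · have := hcc.tendsto Z
      rwa [hz Z hZ] at this

/-- continuous functions as a subring -/
def contSub {X : Type*} [TopologicalSpace X] (S : Set X) : Subring (X → ℂ) where
  carrier := {f | ContinuousOn f S}
  mul_mem' := fun ha hb => ContinuousOn.mul ha hb
  one_mem' := continuousOn_const
  add_mem' := fun ha hb => ContinuousOn.add ha hb
  zero_mem' := continuousOn_const
  neg_mem' := fun ha => ContinuousOn.neg ha

theorem ord_open {g : Matrix (Fin p) (Fin m) ℂ → Matrix (Fin p') (Fin q') ℂ}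
    (hg : DifferentiableOn ℂ g (typeIDomain p m))
    (hb : MapsTo g (typeIDomain p m) (typeIDomain p' q')) (hqp : q' < p)
    {U : Set ((Fin p → ℂ) × (Fin m → ℂ))} (hU : IsOpen U) (hUO : U ⊆ Om p m) (hne : U.Nonempty) :
    ∃ U' ⊆ U, IsOpen U' ∧ U'.Nonempty ∧ ∀ β γ, (β, γ) ∈ U' → ∀ c,
      (∀ Z ∈ Sset β γ, ∀ Z' ∈ Sset β γ, g Z *ᵥ c = g Z' *ᵥ c) →
      ∀ Z ∈ typeIDomain p m, ∀ Z' ∈ typeIDomain p m, g Z *ᵥ c = g Z' *ᵥ c := by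
  let Λ : Matrix (Fin p) (Fin m) ℂ × Fin p' → (Fin p → ℂ) × (Fin m → ℂ) → Fin q' → ℂ := fun i x j =>
    (cut (Wx x i.1) : ℂ) * g (Wx x i.1) i.2 j - (cut (Wx x i.1) : ℂ) * g (Wx x 0) i.2 j
  have hgc : ∀ i j, ContinuousOn (fun Z => g Z i j) (typeIDomain p m) := fun i j =>
    (matrix_diff.1 hg i j).continuousOn
  have hgb : ∀ i j, ∀ Z ∈ typeIDomain p m, ‖g Z i j‖ ≤ 1 := fun i j Z hZ =>
    (entry_le _ _ _).trans (mem_D_iff.1 (hb hZ)).le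
  have hcc : Continuous fun Z : Matrix (Fin p) (Fin m) ℂ => (cut Z : ℂ) :=
    Complex.continuous_ofReal.comp (continuous_const.max (continuous_const.sub continuous_opN))
  have hΛc : ∀ i j, (fun x => Λ i x j) ∈ contSub U := by
    intro i j
    change ContinuousOn (fun x => Λ i x j) U
    refine ContinuousOn.sub ?_ (ContinuousOn.mul ?_ ?_)
    · exact (cut_cont (hgc i.2 j) (hgb i.2 j)).comp_continuousOn ((Wx_cont i.1).mono hUO)
    · exact hcc.comp_continuousOn ((Wx_cont i.1).mono hUO)
    · exact (hgc i.2 j).comp ((Wx_cont 0).mono hUO) fun x hx => (Wx_zero_mem (hUO hx)).1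
  have hdot : ∀ Y k x c, Λ (Y, k) x ⬝ᵥ c =
      (cut (Wx x Y) : ℂ) * ((g (Wx x Y) *ᵥ c) k - (g (Wx x 0) *ᵥ c) k) := by
    intro Y k x c
    simp only [Λ, dotProduct, mulVec, mul_sub, Finset.mul_sum, ← Finset.sum_sub_distrib]
    exact Finset.sum_congr rfl fun j _ => by ring
  -- kernel iff
  have hker1 : ∀ x ∈ U, ∀ c, (∀ i, Λ i x ⬝ᵥ c = 0) → ∀ Z ∈ Sset x.1 x.2, g Z *ᵥ c = g (Wx x 0) *ᵥ c := by
    intro x hx c hc Z hZ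
    ext k
    have h1 := hc (Z, k)
    rw [hdot, Wx_self Z hZ.2] at h1
    have h2 : cut Z ≠ 0 := by
      have := mem_D_iff.1 hZ.1
      have : 0 < cut Z := lt_max_of_lt_right (by linarith)
      exact this.ne'
    rcases mul_eq_zero.1 h1 with h3 | h3
    · exact absurd (by exact_mod_cast h3) h2
    · exact sub_eq_zero.1 h3
  have hker2 : ∀ x ∈ U, ∀ c, (∀ Z ∈ Sset x.1 x.2, ∀ Z' ∈ Sset x.1 x.2, g Z *ᵥ c = g Z' *ᵥ c) →
      ∀ i, Λ i x ⬝ᵥ c = 0 := by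
    rintro x hx c hc ⟨Y, k⟩
    rw [hdot]
    by_cases hW : Wx x Y ∈ typeIDomain p m
    · rw [hc _ ⟨hW, Wx_row (hUO hx) Y⟩ _ (Wx_zero_mem (hUO hx)), sub_self, mul_zero]
    · rw [mem_D_iff] at hW
      rw [cut, max_eq_left (by linarith)]; simp
  obtain ⟨ρ, r, s, ⟨x0, hx0, hd0⟩, hk⟩ := ker_lemma Λ U hne
  have hdet : ContinuousOn (fun x => (kB Λ r s x).det) U := kB_mem (contSub U) Λ hΛc r s
  refine ⟨U ∩ (fun x => (kB Λ r s x).det) ⁻¹' {0}ᶜ, inter_subset_left,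
    hdet.isOpen_inter_preimage hU isOpen_compl_singleton, ⟨x0, hx0, hd0⟩, ?_⟩
  set U' := U ∩ (fun x => (kB Λ r s x).det) ⁻¹' {0}ᶜ with hU'
  have hU'o : IsOpen U' := hdet.isOpen_inter_preimage hU isOpen_compl_singleton
  have hU'O : U' ⊆ Om p m := inter_subset_left.trans hUO
  intro β γ hx c hc
  -- each kq is in N
  have hN : ∀ j, ∀ Z ∈ typeIDomain p m, g Z *ᵥ kq Λ r s j (β, γ) = g (Wx (β, γ) 0) *ᵥ kq Λ r s j (β, γ) := by
    intro j Z hZ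
    have hqc : ContinuousOn (fun x => kq Λ r s j x) U' := by
      refine continuousOn_pi.2 fun i => ?_
      exact ContinuousOn.mono (kq_mem (contSub U) Λ hΛc r s j i) inter_subset_left
    ext k
    have hcls : Cls U' (fun x => kq Λ r s j x) (fun Z => g Z k) := by
      have hdk : DifferentiableOn ℂ (fun Z => g Z k) (typeIDomain p m) := differentiableOn_pi.1 hg k
      refine ⟨hdk, ?_⟩
      intro b c' hbc Z hZ hbZ X hX
      have hder := deriv_line (f := fun Z => g Z k) (z := Z) (X := X) (s := 0) (by
        rw [zero_smul, add_zero]; exact (hdk Z hZ).differentiableAt (isOpen_D.mem_nhds hZ))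
      have hder2 := (dotL (kq Λ r s j (b, c'))).hasFDerivAt.comp_hasDerivAt 0 hder
      have hev : (fun s' : ℂ => dotL (kq Λ r s j (b, c')) (g (Z + s' • X) k)) =ᶠ[𝓝 0]
          fun _ => (g (Wx (b, c') 0) *ᵥ kq Λ r s j (b, c')) k := by
        have hcont : Continuous fun s : ℂ => Z + s • X := by fun_prop
        have : (fun s : ℂ => Z + s • X) ⁻¹' typeIDomain p m ∈ 𝓝 (0:ℂ) :=
          (isOpen_D.preimage hcont).mem_nhds (by simpa using hZ)
        filter_upwards [this] with s' hs'
        have h5 := hker1 (b, c') hbc.1 _ (fun i => hk (b, c') hbc.1 hbc.2 i j) (Z + s' • X)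
          ⟨hs', by rw [vecMul_add, vecMul_smul, hX, hbZ]; simp⟩
        rw [← h5]; rfl
      have h3 := hder2.unique ((hasDerivAt_const (0:ℂ) _).congr_of_eventuallyEq hev)
      simpa using h3
    exact cls_const hU'o hU'O hqc hqp hcls hx (Wx_zero_mem (hU'O hx)) hZ
  have hspan := kq_span Λ r s (β, γ) c (hker2 _ hx.1 c hc)
  have hfin : ∀ Z ∈ typeIDomain p m, g Z *ᵥ c = g (Wx (β, γ) 0) *ᵥ c := by
    intro Z hZ
    have h1 : g Z *ᵥ ((kB Λ r s (β, γ)).det • c) = g (Wx (β, γ) 0) *ᵥ ((kB Λ r s (β, γ)).det • c) := by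
      rw [hspan, mulVec_sum, mulVec_sum]
      refine Finset.sum_congr rfl fun j _ => ?_
      rw [mulVec_smul, mulVec_smul, hN j Z hZ]
    rw [mulVec_smul, mulVec_smul] at h1
    exact smul_right_injective _ (show (kB Λ r s (β, γ)).det ≠ 0 from hx.2) h1
  intro Z hZ Z' hZ'
  rw [hfin Z hZ, hfin Z' hZ']

end PartG2

section PartH
open Set
variable {p m p' q' : ℕ} {f : Matrix (Fin p) (Fin (m + 1)) ℂ → Matrix (Fin p') (Fin q') ℂ}

theorem sn_zero_zero : sn (0 : Matrix (Fin p) (Fin m) ℂ) 0 = 0 := by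
  ext i j
  refine Fin.lastCases ?_ (fun j => ?_) j <;> simp

theorem Om_nonempty (hp : 0 < p) : (Om p m).Nonempty := by
  refine ⟨(Pi.single ⟨0, hp⟩ 1, 0), ?_⟩
  have h : (Pi.single (⟨0, hp⟩ : Fin p) (1:ℂ) : Fin p → ℂ) ≠ 0 := by simp
  have := nsq_pos h
  simpa [Om, nsq_zero] using this

theorem part_i0 (hf : PH p (m + 1) p' q' f) (hqp : q' < p) :
    ∃ c, c ≠ 0 ∧ ∀ Z ∈ typeIDomain p m, f (sn Z 0) *ᵥ c = f 0 *ᵥ c := by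
  obtain ⟨U', hU', -, ⟨⟨β, γ⟩, hx⟩, h⟩ := ord_open hf.restrict.diff hf.restrict.maps hqp isOpen_Om
    subset_rfl (Om_nonempty (m := m) (by omega))
  obtain ⟨c, hc, hc2⟩ := K_ne hf (hU' hx)
  refine ⟨c, hc, fun Z hZ => ?_⟩
  have := h β γ hx c hc2 Z hZ 0 zero_mem_D
  rwa [sn_zero_zero] at this

theorem last_col_zero {W : Matrix (Fin p) (Fin (m + 1)) ℂ} (hW : W *ᵥ eL m = 0) : sn (dr W) 0 = W := by
  conv_rhs => rw [← sn_dr W]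
  rw [mulVec_eL] at hW
  rw [hW]

theorem part_i (hf : PH p (m + 1) p' q' f) (hqp : q' < p) (a : Fin (m + 1) → ℂ) (b : Fin p → ℂ)
    (h : nsq b < nsq a) : ∃ c d, nsq d < nsq c ∧
      ∀ Z ∈ typeIDomain p (m + 1), Z *ᵥ a = b → f Z *ᵥ c = d := by
  obtain ⟨φ, G, h1, h2, h3, h4, h5, μ, hμ, h6⟩ := exists_aut a b h (eL m) nsq_eL
  have hF := hf.aut_right h1 h2 h3
  obtain ⟨c, hc, hc2⟩ := part_i0 hF hqp
  refine ⟨c, (f ∘ φ) 0 *ᵥ c, mem_D.1 (hF.maps zero_mem_D) c hc, fun Z hZ hab => ?_⟩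
  have h7 := h5 Z hZ (a, b) hab
  rw [h6] at h7
  simp only [mulVec_smul] at h7
  have h8 : φ Z *ᵥ eL m = 0 := by
    rcases smul_eq_zero.1 h7 with h | h
    · exact absurd h hμ
    · exact h
  have h9 := last_col_zero h8
  have h10 := hc2 (dr (φ Z)) (sn_zero_mem.1 (by rw [h9]; exact h2 hZ))
  rw [h9] at h10
  simpa [h3 Z hZ] using h10

theorem part_ii : ∀ (q q' : ℕ) (f : Matrix (Fin p) (Fin q) ℂ → Matrix (Fin p') (Fin q') ℂ),
    PH p q p' q' f → q' < p → q ≤ q' := by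
  intro q
  induction q with
  | zero => intro _ _ _ _; omega
  | succ m ih =>
    intro q' f hf hqp
    have hpos := hf.target_pos (by omega) (by omega)
    obtain ⟨n, rfl⟩ := Nat.exists_eq_succ_of_ne_zero hpos.ne'
    obtain ⟨c, hc, hc2⟩ := part_i0 hf hqp
    obtain ⟨g, hg, -⟩ := hf.restrict.drop c _ hc hc2
    have := ih n g hg (by omega)
    omega

end PartH

section PartI
open Set Topology Filter

theorem four_alg (a b : ℂ) (r : ℝ) (c0 c1 c2 c3 : ℂ) :
    ‖a + (r:ℂ) * (b + r * c0)‖ ^ 2 + ‖a + (r * Complex.I) * (b + (r * Complex.I) * c1)‖ ^ 2 +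
      ‖a + (-(r:ℂ)) * (b + (-(r:ℂ)) * c2)‖ ^ 2 +
      ‖a + (-(r * Complex.I)) * (b + (-(r * Complex.I)) * c3)‖ ^ 2 =
    4 * ‖a‖ ^ 2 + r ^ 2 * (4 * ‖b‖ ^ 2 + 2 * (star a * (c0 - c1 + c2 - c3)).re +
      r * (2 * (star b * (c0 + Complex.I * c1 - c2 - Complex.I * c3)).re +
        r * (‖c0‖ ^ 2 + ‖c1‖ ^ 2 + ‖c2‖ ^ 2 + ‖c3‖ ^ 2))) := by
  simp only [Complex.sq_norm, Complex.normSq_apply, Complex.add_re, Complex.add_im, Complex.mul_re,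
    Complex.mul_im, Complex.ofReal_re, Complex.ofReal_im, Complex.I_re, Complex.I_im, Complex.neg_re,
    Complex.neg_im, Complex.sub_re, Complex.sub_im, Complex.star_def, Complex.conj_re, Complex.conj_im]
  ring

theorem four_pt {h : ℂ → ℂ} {V : Set ℂ} (hV : V ∈ 𝓝 (0:ℂ)) (hd : DifferentiableOn ℂ h V) :
    Tendsto (fun r : ℝ => (‖h r‖ ^ 2 + ‖h (r * Complex.I)‖ ^ 2 + ‖h (-(r:ℂ))‖ ^ 2 +
      ‖h (-(r * Complex.I))‖ ^ 2 - 4 * ‖h 0‖ ^ 2) / r ^ 2) (𝓝[>] 0) (𝓝 (4 * ‖deriv h 0‖ ^ 2)) := by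
  set h1 := dslope h 0 with hh1
  set h2 := dslope h1 0 with hh2
  have hd1 : DifferentiableOn ℂ h1 V := (Complex.differentiableOn_dslope hV).2 hd
  have hd2 : DifferentiableOn ℂ h2 V := (Complex.differentiableOn_dslope hV).2 hd1
  have hc2 : ContinuousAt h2 0 := (hd2.differentiableAt hV).continuousAt
  have e1 : ∀ z, h z = h 0 + z * h1 z := fun z => by
    have := sub_smul_dslope h 0 z
    rw [sub_zero, smul_eq_mul] at this
    rw [hh1, this]; ring
  have e2 : ∀ z, h1 z = deriv h 0 + z * h2 z := fun z => by
    have := sub_smul_dslope h1 0 z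
    rw [sub_zero, smul_eq_mul] at this
    rw [hh2, this, ← dslope_same h 0]; ring
  have e3 : ∀ z, h z = h 0 + z * (deriv h 0 + z * h2 z) := fun z => by rw [← e2, ← e1]
  have t : ∀ k : ℂ, Tendsto (fun r : ℝ => h2 (k * r)) (𝓝[>] 0) (𝓝 (h2 0)) := fun k => by
    have hk : Continuous fun r : ℝ => k * (r:ℂ) := by fun_prop
    have h1 : Tendsto (fun r : ℝ => k * (r:ℂ)) (𝓝[>] 0) (𝓝 0) := by
      have := hk.tendsto 0
      simp only [Complex.ofReal_zero, mul_zero] at this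
      exact this.mono_left nhdsWithin_le_nhds
    exact Tendsto.comp hc2 h1
  have t0 : Tendsto (fun r : ℝ => h2 r) (𝓝[>] 0) (𝓝 (h2 0)) := by simpa using t 1
  have t1 : Tendsto (fun r : ℝ => h2 (r * Complex.I)) (𝓝[>] 0) (𝓝 (h2 0)) := by
    simpa [mul_comm] using t Complex.I
  have t2 : Tendsto (fun r : ℝ => h2 (-(r:ℂ))) (𝓝[>] 0) (𝓝 (h2 0)) := by simpa using t (-1)
  have t3 : Tendsto (fun r : ℝ => h2 (-(r * Complex.I))) (𝓝[>] 0) (𝓝 (h2 0)) := by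
    simpa [mul_comm] using t (-Complex.I)
  have tr : Tendsto (fun r : ℝ => r) (𝓝[>] 0) (𝓝 0) := tendsto_id.mono_left nhdsWithin_le_nhds
  have key : Tendsto (fun r : ℝ => 4 * ‖deriv h 0‖ ^ 2 +
      2 * (star (h 0) * (h2 r - h2 (r * Complex.I) + h2 (-(r:ℂ)) - h2 (-(r * Complex.I)))).re +
      r * (2 * (star (deriv h 0) * (h2 r + Complex.I * h2 (r * Complex.I) - h2 (-(r:ℂ)) -
        Complex.I * h2 (-(r * Complex.I)))).re +
        r * (‖h2 r‖ ^ 2 + ‖h2 (r * Complex.I)‖ ^ 2 + ‖h2 (-(r:ℂ))‖ ^ 2 + ‖h2 (-(r * Complex.I))‖ ^ 2)))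
      (𝓝[>] 0) (𝓝 (4 * ‖deriv h 0‖ ^ 2 + 2 * (star (h 0) * (h2 0 - h2 0 + h2 0 - h2 0)).re +
      0 * (2 * (star (deriv h 0) * (h2 0 + Complex.I * h2 0 - h2 0 - Complex.I * h2 0)).re +
        0 * (‖h2 0‖ ^ 2 + ‖h2 0‖ ^ 2 + ‖h2 0‖ ^ 2 + ‖h2 0‖ ^ 2)))) := by
    refine Tendsto.add (Tendsto.add tendsto_const_nhds ?_) (tr.mul (Tendsto.add ?_ (tr.mul ?_)))
    · refine Tendsto.const_mul _ ((Complex.continuous_re.tendsto _).comp (Tendsto.const_mul _ ?_))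
      exact ((t0.sub t1).add t2).sub t3
    · refine Tendsto.const_mul _ ((Complex.continuous_re.tendsto _).comp (Tendsto.const_mul _ ?_))
      exact ((t0.add (t1.const_mul _)).sub t2).sub (t3.const_mul _)
    · exact (((t0.norm.pow 2).add (t1.norm.pow 2)).add (t2.norm.pow 2)).add (t3.norm.pow 2)
  have hlim : (4 * ‖deriv h 0‖ ^ 2 + 2 * (star (h 0) * (h2 0 - h2 0 + h2 0 - h2 0)).re +
      0 * (2 * (star (deriv h 0) * (h2 0 + Complex.I * h2 0 - h2 0 - Complex.I * h2 0)).re +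
        0 * (‖h2 0‖ ^ 2 + ‖h2 0‖ ^ 2 + ‖h2 0‖ ^ 2 + ‖h2 0‖ ^ 2))) = 4 * ‖deriv h 0‖ ^ 2 := by
    simp
  rw [hlim] at key
  refine key.congr' ?_
  filter_upwards [self_mem_nhdsWithin] with r hr
  have hr0 : (r:ℝ) ≠ 0 := (show (0:ℝ) < r from hr).ne'
  have h4 := four_alg (h 0) (deriv h 0) r (h2 r) (h2 (r * Complex.I)) (h2 (-(r:ℂ)))
    (h2 (-(r * Complex.I)))
  rw [← e3, ← e3, ← e3, ← e3] at h4
  rw [h4]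
  field_simp
  ring

theorem four_pt_vec {n : ℕ} {h : ℂ → Fin n → ℂ} {V : Set ℂ} (hV : V ∈ 𝓝 (0:ℂ))
    (hd : DifferentiableOn ℂ h V) :
    Tendsto (fun r : ℝ => (nsq (h r) + nsq (h (r * Complex.I)) + nsq (h (-(r:ℂ))) +
      nsq (h (-(r * Complex.I))) - 4 * nsq (h 0)) / r ^ 2) (𝓝[>] 0) (𝓝 (4 * nsq (deriv h 0))) := by
  have hi : ∀ i, deriv (fun z => h z i) 0 = deriv h 0 i := fun i =>
    (hasDerivAt_pi.1 (hd.differentiableAt hV).hasDerivAt i).deriv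
  have := tendsto_finsetSum Finset.univ fun i _ => four_pt hV (differentiableOn_pi.1 hd i)
  simp only [hi] at this
  simp only [nsq, Finset.mul_sum]
  refine this.congr fun r => ?_
  rw [← Finset.sum_div]
  simp only [Finset.sum_add_distrib, Finset.sum_sub_distrib]

end PartI

section PartI2
open Set Topology Filter

theorem lap_aux {D C s r : ℝ} (hC : 0 < C) (hs : 0 < s) (hr : 0 < r) (hr1 : r ≤ 1)
    (h : D * Real.exp (s * r ^ 2) ≤ C) : D - C ≤ -(C * s / (1 + s)) * r ^ 2 := by
  have h1 : 1 + s * r ^ 2 ≤ Real.exp (s * r ^ 2) := by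
    have := Real.add_one_le_exp (s * r ^ 2); linarith
  have hr2 : r ^ 2 ≤ 1 := by nlinarith
  have hr0 : 0 < r ^ 2 := by positivity
  have hx : s * r ^ 2 ≤ s := by nlinarith
  have h2 : D ≤ C / (1 + s * r ^ 2) := by
    rw [le_div_iff₀ (by positivity)]
    rcases le_or_gt D 0 with hD | hD
    · have : D * (1 + s * r ^ 2) ≤ 0 := mul_nonpos_of_nonpos_of_nonneg hD (by positivity)
      linarith
    · exact (mul_le_mul_of_nonneg_left h1 hD.le).trans h
  have h3 : C / (1 + s * r ^ 2) - C = -(C * s / (1 + s * r ^ 2)) * r ^ 2 := by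
    field_simp; ring
  have h4 : C * s / (1 + s) ≤ C * s / (1 + s * r ^ 2) := by gcongr
  nlinarith

theorem lap1 {n k : ℕ} {N : ℂ → Fin n → ℂ} {H : ℂ → Fin k → ℂ} {V : Set ℂ} (hV : V ∈ 𝓝 (0:ℂ))
    (hN : DifferentiableOn ℂ N V) (hH : DifferentiableOn ℂ H V) {s : ℝ} (hs : 0 < s)
    (hC : 0 < nsq (N 0) - nsq (H 0))
    (hm : ∀ z ∈ V, (nsq (N z) - nsq (H z)) * Real.exp (s * ‖z‖ ^ 2) ≤ nsq (N 0) - nsq (H 0)) :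
    nsq (deriv N 0) < nsq (deriv H 0) := by
  set C := nsq (N 0) - nsq (H 0) with hCdef
  have ht := (four_pt_vec hV hN).sub (four_pt_vec hV hH)
  have hle : 4 * nsq (deriv N 0) - 4 * nsq (deriv H 0) ≤ 4 * -(C * s / (1 + s)) := by
    refine le_of_tendsto ht ?_
    obtain ⟨ε, hε, hball⟩ := Metric.mem_nhds_iff.1 hV
    have : Ioo (0:ℝ) (min ε 1) ∈ 𝓝[>] (0:ℝ) := Ioo_mem_nhdsGT (by positivity)
    filter_upwards [this] with r hr
    have hr1 : r ≤ 1 := hr.2.le.trans (min_le_right _ _)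
    have hrε : r < ε := hr.2.trans_le (min_le_left _ _)
    have key : ∀ z : ℂ, ‖z‖ = r → (nsq (N z) - nsq (H z)) - C ≤ -(C * s / (1 + s)) * r ^ 2 := by
      intro z hz
      refine lap_aux hC hs hr.1 hr1 ?_
      have := hm z (hball (by simpa [hz] using hrε))
      rwa [hz] at this
    have hnr : ‖(r:ℂ)‖ = r := by rw [Complex.norm_real, Real.norm_eq_abs, abs_of_pos hr.1]
    have k1 := key r hnr
    have k2 := key (r * Complex.I) (by simp [hnr, hr.1.le])
    have k3 := key (-(r:ℂ)) (by rw [norm_neg, hnr])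
    have k4 := key (-(r * Complex.I)) (by simp [hnr, hr.1.le])
    have hr2 : 0 < r ^ 2 := by have := hr.1; positivity
    rw [← sub_div, div_le_iff₀ hr2]
    linarith
  have : 0 < C * s / (1 + s) := by positivity
  linarith

theorem nsq_sub_proj {n : ℕ} (N0 N1 : Fin n → ℂ) (h0 : 0 < nsq N0) :
    ‖(star N0 ⬝ᵥ N1) / (nsq N0 : ℂ)‖ ^ 2 * nsq N0 ≤ nsq N1 := by
  have h := cs_dot (star N0) N1
  rw [nsq_star] at h
  rw [norm_div, div_pow, Complex.norm_real, Real.norm_eq_abs, sq_abs]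
  have : ‖star N0 ⬝ᵥ N1‖ ^ 2 / nsq N0 ^ 2 * nsq N0 = ‖star N0 ⬝ᵥ N1‖ ^ 2 / nsq N0 := by field_simp
  rw [this, div_le_iff₀ h0]; linarith

theorem lap {p k n : ℕ} (hkp : k < p) {V : Set (Fin p → ℂ)} (hV : IsOpen V)
    {c : (Fin p → ℂ) → Fin n → ℂ} {d : (Fin p → ℂ) → Fin k → ℂ} (hc : DifferentiableOn ℂ c V)
    (hd : DifferentiableOn ℂ d V) {x : Fin p → ℂ} (hx : x ∈ V) (l : (Fin p → ℂ) →ₗ[ℂ] ℂ)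
    (hpos : 0 < nsq (c x) - nsq (d x))
    (hm : ∀ v ∈ V, (nsq (c v) - nsq (d v)) * Real.exp ((l v).re + nsq v) ≤
      (nsq (c x) - nsq (d x)) * Real.exp ((l x).re + nsq x)) : False := by
  set N0 := c x with hN0
  set H0 := d x with hH0
  have hNpos : 0 < nsq N0 := by have := nsq_nonneg H0; linarith
  set dc := fderiv ℂ c x with hdc
  set dd := fderiv ℂ d x with hdd
  let T : (Fin p → ℂ) →ₗ[ℂ] (Fin k → ℂ) :=
    { toFun := fun ξ => dd ξ - ((star N0 ⬝ᵥ dc ξ) / (nsq N0 : ℂ)) • H0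
      map_add' := fun a b => by simp only [map_add, dotProduct_add, add_div, add_smul]; abel
      map_smul' := fun a b => by
        simp only [map_smul, dotProduct_smul, smul_sub, smul_smul, RingHom.id_apply, smul_eq_mul,
          mul_div_assoc] }
  obtain ⟨ξ, hξ, hξ0⟩ : ∃ ξ ∈ LinearMap.ker T, ξ ≠ 0 := by
    have : LinearMap.ker T ≠ ⊥ := LinearMap.ker_ne_bot_of_finrank_lt (by simpa using hkp)
    exact (Submodule.ne_bot_iff _).1 this
  have hT : dd ξ = ((star N0 ⬝ᵥ dc ξ) / (nsq N0 : ℂ)) • H0 := sub_eq_zero.1 hξ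
  set κ : ℂ := l ξ / 2 + star x ⬝ᵥ ξ with hκ
  let line : ℂ → Fin p → ℂ := fun z => x + z • ξ
  have hline : Differentiable ℂ line := by fun_prop
  have hW : line ⁻¹' V ∈ 𝓝 (0:ℂ) :=
    (hV.preimage hline.continuous).mem_nhds (by simpa [line] using hx)
  let N : ℂ → Fin n → ℂ := fun z => Complex.exp (κ * z) • c (line z)
  let H : ℂ → Fin k → ℂ := fun z => Complex.exp (κ * z) • d (line z)
  have hexp : Differentiable ℂ fun z => Complex.exp (κ * z) := by fun_prop
  have hNd : DifferentiableOn ℂ N (line ⁻¹' V) :=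
    hexp.differentiableOn.smul (hc.comp hline.differentiableOn fun _ h => h)
  have hHd : DifferentiableOn ℂ H (line ⁻¹' V) :=
    hexp.differentiableOn.smul (hd.comp hline.differentiableOn fun _ h => h)
  have hl0 : line 0 = x := by simp [line]
  have hN00 : N 0 = N0 := by simp [N, hl0, hN0]
  have hH00 : H 0 = H0 := by simp [H, hl0, hH0]
  have hexp' : HasDerivAt (fun z => Complex.exp (κ * z)) κ 0 := by
    have := ((hasDerivAt_id (0:ℂ)).const_mul κ).cexp
    simpa using this
  have hN' : deriv N 0 = κ • N0 + dc ξ := by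
    have h1 := deriv_line (f := c) (z := x) (X := ξ) (s := 0) (by
      rw [zero_smul, add_zero]; exact (hc x hx).differentiableAt (hV.mem_nhds hx))
    have h2 := (hexp'.smul h1).deriv
    simp only [zero_smul, add_zero, mul_zero, Complex.exp_zero, one_smul] at h2
    rw [add_comm]
    exact h2
  have hH' : deriv H 0 = κ • H0 + dd ξ := by
    have h1 := deriv_line (f := d) (z := x) (X := ξ) (s := 0) (by
      rw [zero_smul, add_zero]; exact (hd x hx).differentiableAt (hV.mem_nhds hx))
    have h2 := (hexp'.smul h1).deriv
    simp only [zero_smul, add_zero, mul_zero, Complex.exp_zero, one_smul] at h2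
    rw [add_comm]
    exact h2
  have hlt := lap1 hW hNd hHd (nsq_pos hξ0) (by rw [hN00, hH00]; exact hpos) (by
    intro z hz
    have h1 := hm (line z) hz
    have h2 : (l (line z)).re + nsq (line z) = (l x).re + nsq x + 2 * (κ * z).re + nsq ξ * ‖z‖ ^ 2 := by
      simp only [line, map_add, map_smul, nsq_add, nsq_smul, dotProduct_smul, smul_eq_mul, hκ, Complex.add_re]
      have : (l ξ / 2 + star x ⬝ᵥ ξ) * z = (z * l ξ) / 2 + z * (star x ⬝ᵥ ξ) := by ring
      rw [this, Complex.add_re, Complex.div_ofNat_re]; ring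
    rw [h2, Real.exp_add, Real.exp_add] at h1
    have h3 : ‖Complex.exp (κ * z)‖ ^ 2 = Real.exp (2 * (κ * z).re) := by
      rw [Complex.norm_exp, ← Real.exp_nat_mul]; norm_num
    rw [hN00, hH00]
    simp only [N, H, nsq_smul, h3]
    have h4 := Real.exp_pos ((l x).re + nsq x)
    refine le_of_mul_le_mul_right ?_ h4
    calc _ = (nsq (c (line z)) - nsq (d (line z))) *
          (Real.exp ((l x).re + nsq x) * Real.exp (2 * (κ * z).re) * Real.exp (nsq ξ * ‖z‖ ^ 2)) := by ring
      _ ≤ _ := h1)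
  rw [hN', hH', hT, ← add_smul, nsq_smul] at hlt
  have h5 := nsq_sub_proj N0 (κ • N0 + dc ξ) hNpos
  have h6 : star N0 ⬝ᵥ (κ • N0 + dc ξ) / (nsq N0 : ℂ) = κ + star N0 ⬝ᵥ dc ξ / (nsq N0 : ℂ) := by
    have : (nsq N0 : ℂ) ≠ 0 := by exact_mod_cast hNpos.ne'
    rw [dotProduct_add, dotProduct_smul, star_dot_self, smul_eq_mul]
    field_simp
  rw [h6] at h5
  have h7 : nsq H0 ≤ nsq N0 := by linarith
  have h8 := mul_le_mul_of_nonneg_left h7 (sq_nonneg ‖κ + star N0 ⬝ᵥ dc ξ / (nsq N0 : ℂ)‖)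
  linarith

end PartI2

section PartI3
open Set Topology Filter

theorem fin1_vec (v : Fin 1 → ℂ) : v = v 0 • (1 : Fin 1 → ℂ) := by
  ext i; rw [Subsingleton.elim i 0]; simp

theorem mem_D1 {p : ℕ} {Z : Matrix (Fin p) (Fin 1) ℂ} : Z ∈ typeIDomain p 1 ↔ nsq (Z *ᵥ 1) < 1 := by
  have h1 : nsq (1 : Fin 1 → ℂ) = 1 := by simp [nsq]
  rw [mem_D]
  constructor
  · intro h
    have := h 1 (by simp)
    rwa [h1] at this
  · intro h v hv
    rw [fin1_vec v, mulVec_smul, nsq_smul, nsq_smul, h1]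
    have : v 0 ≠ 0 := fun h0 => hv (by rw [fin1_vec v, h0, zero_smul])
    have : 0 < ‖v 0‖ := norm_pos_iff.2 this
    have : 0 < ‖v 0‖ ^ 2 := by positivity
    nlinarith

theorem ball_case {p p' : ℕ} {g : Matrix (Fin p) (Fin 1) ℂ → Matrix (Fin p') (Fin 1) ℂ}
    (hg : PH p 1 p' 1 g) : p ≤ p' := by
  by_contra hlt
  push Not at hlt
  let emb : (Fin p → ℂ) → Matrix (Fin p) (Fin 1) ℂ := fun v => Matrix.of fun i _ => v i
  have hemb : ∀ v, emb v *ᵥ 1 = v := fun v => by ext i; simp [emb, mulVec, dotProduct]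
  have hembZ : ∀ Z, emb (Z *ᵥ 1) = Z := fun Z => by
    ext i j; rw [Subsingleton.elim j 0]; simp [emb, mulVec, dotProduct]
  have hembd : Differentiable ℂ emb := by
    refine differentiable_pi.2 fun i => differentiable_pi.2 fun j => ?_
    simp only [emb, of_apply]; fun_prop
  let V : Set (Fin p → ℂ) := {v | nsq v < 1}
  have hVo : IsOpen V := isOpen_lt continuous_nsq continuous_const
  have hVD : ∀ v, v ∈ V ↔ emb v ∈ typeIDomain p 1 := fun v => by rw [mem_D1, hemb]; rfl
  let d : (Fin p → ℂ) → Fin p' → ℂ := fun v => g (emb v) *ᵥ 1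
  have hdd : DifferentiableOn ℂ d V := by
    have h1 : DifferentiableOn ℂ (fun v => g (emb v)) V :=
      hg.diff.comp hembd.differentiableOn fun v hv => (hVD v).1 hv
    refine differentiableOn_pi.2 fun i => ?_
    simp only [d, mulVec, dotProduct]
    exact DifferentiableOn.fun_sum fun j _ => (matrix_diff.1 h1 i j).mul (differentiableOn_const _)
  have h0V : (0 : Fin p → ℂ) ∈ V := by change nsq _ < 1; rw [nsq_zero]; norm_num
  have hd1 : ∀ v ∈ V, nsq (d v) < 1 := fun v hv => mem_D1.1 (hg.maps ((hVD v).1 hv))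
  set Φ0 := 1 - nsq (d 0) with hΦ0
  have hΦ0p : 0 < Φ0 := by have := hd1 0 h0V; linarith
  set δ := Φ0 * Real.exp (-1) with hδ
  have hδp : 0 < δ := by positivity
  have hδle : δ ≤ Φ0 := by
    have : Real.exp (-1) ≤ 1 := Real.exp_le_one_iff.2 (by norm_num)
    nlinarith
  let K : Set (Matrix (Fin p') (Fin 1) ℂ) := {W | opN W ≤ 1} ∩ {W | nsq (W *ᵥ 1) ≤ 1 - δ}
  have hmc : ∀ n : ℕ, Continuous fun W : Matrix (Fin n) (Fin 1) ℂ => W *ᵥ (1 : Fin 1 → ℂ) := fun n =>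
    Continuous.matrix_mulVec continuous_id continuous_const
  have hKc : IsCompact K := (isCompact_opN 1).inter_right
    (isClosed_le (continuous_nsq.comp (hmc p')) continuous_const)
  have hKD : K ⊆ typeIDomain p' 1 := fun W hW => mem_D1.2 (by
    have : nsq (W *ᵥ 1) ≤ 1 - δ := hW.2
    linarith)
  have hpre := hg.comp K hKD hKc
  have hmem : ∀ v ∈ V, δ ≤ 1 - nsq (d v) → emb v ∈ typeIDomain p 1 ∩ g ⁻¹' K := fun v hv h =>
    ⟨(hVD v).1 hv, (mem_D_iff.1 (hg.maps ((hVD v).1 hv))).le, by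
      change nsq (d v) ≤ _; linarith⟩
  let Ψ : (Fin p → ℂ) → ℝ := fun v => (1 - nsq (d v)) * Real.exp (nsq v)
  have hΨc : ContinuousOn Ψ V := by
    refine ContinuousOn.mul (continuousOn_const.sub (continuous_nsq.comp_continuousOn hdd.continuousOn)) ?_
    exact (Real.continuous_exp.comp continuous_nsq).continuousOn
  obtain ⟨Z, hZ, hmax⟩ := hpre.exists_isMaxOn ⟨_, hmem 0 h0V hδle⟩
    (f := fun Z => Ψ (Z *ᵥ 1)) (hΨc.comp (hmc p).continuousOn fun Z hZ => by
      rw [hVD, hembZ]; exact hZ.1)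
  set x := Z *ᵥ 1 with hx
  have hxV : x ∈ V := by rw [hVD, hx, hembZ]; exact hZ.1
  have hΨ0 : Ψ 0 = Φ0 := by simp [Ψ, nsq_zero, hΦ0]
  have hΨx : Φ0 ≤ Ψ x := by
    have := hmax (hmem 0 h0V hδle)
    simp only [mem_ofPred_eq, hemb, hΨ0] at this
    exact this
  have hall : ∀ v ∈ V, Ψ v ≤ Ψ x := by
    intro v hv
    by_cases h : δ ≤ 1 - nsq (d v)
    · have := hmax (hmem v hv h)
      simpa only [mem_ofPred_eq, hemb] using this
    · push Not at h
      refine le_trans ?_ hΨx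
      have hv1 : nsq v < 1 := hv
      have hd2 := hd1 v hv
      calc Ψ v ≤ δ * Real.exp 1 := by
            apply mul_le_mul h.le (Real.exp_le_exp.2 hv1.le) (Real.exp_pos _).le hδp.le
        _ = Φ0 := by rw [hδ, mul_assoc, ← Real.exp_add]; simp
  have h1 : nsq (fun _ : Fin 1 => (1:ℂ)) = 1 := by simp [nsq]
  refine lap hlt hVo (c := fun _ => fun _ : Fin 1 => (1:ℂ)) (differentiableOn_const _) hdd hxV 0 ?_ ?_
  · have := hd1 x hxV
    rw [h1]; linarith
  · intro v hv
    have := hall v hv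
    simpa [h1, Ψ] using this

end PartI3

section PartJ1
open Set Topology Filter
variable {p m p' q' : ℕ} {f : Matrix (Fin p) (Fin (m + 1)) ℂ → Matrix (Fin p') (Fin q') ℂ}
  {β : Fin p → ℂ} {γ : Fin m → ℂ}

theorem nsq_para {n : ℕ} (u v : Fin n → ℂ) : nsq (u - v) + nsq (u + v) = 2 * nsq u + 2 * nsq v := by
  rw [sub_eq_add_neg, nsq_add, nsq_add, nsq_neg, dotProduct_neg, Complex.neg_re]; ring

theorem nsq_sub_le {n : ℕ} (u v : Fin n → ℂ) : nsq (u - v) ≤ 2 * nsq u + 2 * nsq v := by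
  have := nsq_para u v
  have := nsq_nonneg (u + v)
  linarith

theorem form_le {F : Matrix (Fin p') (Fin q') ℂ} (hF : F ∈ typeIDomain p' q') (u v : Fin q' → ℂ) :
    nsq (u - v) - nsq (F *ᵥ (u - v)) ≤ 2 * (nsq u - nsq (F *ᵥ u)) + 2 * nsq v := by
  have h1 := nsq_para u v
  have h2 := nsq_para (F *ᵥ u) (F *ᵥ v)
  rw [← mulVec_sub, ← mulVec_add] at h2
  have h3 := D_le hF (u + v)
  have h4 := nsq_nonneg (F *ᵥ v)
  linarith

theorem rho_arith {d2 cj ρ Cj C1 q ε e2 B2 P : ℝ} (hd2 : 0 ≤ d2) (hρ : 0 ≤ ρ)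
    (hC1 : 0 ≤ C1) (hq : 0 ≤ q) (hε : 0 ≤ ε) (hd2B : d2 ≤ B2)
    (hρP : ρ ≤ P) (hCjP : Cj ≤ P) (_hP : 0 ≤ P)
    (he : e2 ≤ C1 * (q * ε))
    (h1 : d2 * cj * ρ ≤ Cj * (2 * (d2 * ε) + 2 * e2)) (hCj : 0 ≤ Cj)
    (h2 : d2 ≤ 2 * (cj * (C1 * q)) + 2 * e2) :
    d2 ^ 2 * ρ ≤ (2 * (C1 * q) * (P * (2 * B2 + 2 * (C1 * q))) + 2 * (C1 * q) * (B2 * P)) * ε := by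
  have hB2 : 0 ≤ B2 := hd2.trans hd2B
  have hK : 0 ≤ C1 * q := by positivity
  have a1 : d2 * cj * ρ ≤ P * (2 * B2 + 2 * (C1 * q)) * ε := by
    refine h1.trans ?_
    calc Cj * (2 * (d2 * ε) + 2 * e2) ≤ Cj * (2 * (B2 * ε) + 2 * (C1 * (q * ε))) := by gcongr
      _ ≤ P * (2 * (B2 * ε) + 2 * (C1 * (q * ε))) := by gcongr
      _ = _ := by ring
  have a2 : d2 ^ 2 * ρ ≤ (2 * (cj * (C1 * q)) + 2 * (C1 * (q * ε))) * (d2 * ρ) := by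
    calc d2 ^ 2 * ρ = d2 * (d2 * ρ) := by ring
      _ ≤ _ := by
        apply mul_le_mul_of_nonneg_right _ (by positivity)
        linarith
  calc d2 ^ 2 * ρ ≤ _ := a2
    _ = 2 * (C1 * q) * (d2 * cj * ρ) + 2 * (C1 * q) * ε * (d2 * ρ) := by ring
    _ ≤ 2 * (C1 * q) * (P * (2 * B2 + 2 * (C1 * q)) * ε) + 2 * (C1 * q) * ε * (B2 * P) := by gcongr
    _ = _ := by ring

theorem rho_bdry (hf : PH p (m + 1) p' q' f) (hβ : nsq β = 1) (hγ : nsq γ < 1)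
    {c0 : Fin q' → ℂ} (hc0 : c0 ≠ 0)
    (hone : ∀ c, (∀ Z ∈ Sset β γ, ∀ Z' ∈ Sset β γ, f (sn Z 0) *ᵥ c = f (sn Z' 0) *ᵥ c) → ∃ k : ℂ, c = k • c0)
    {C : ℂ → Fin q' → ℂ} {Dd : ℂ → Fin p' → ℂ} (hC : Continuous C) (hD : Continuous Dd)
    (hCD : ∀ l : ℂ, ‖l‖ < 1 → ∀ Z ∈ Sset β γ, f (Zl β γ Z l) *ᵥ C l = Dd l)
    {ls : ℂ} (hls : ‖ls‖ = 1) : nsq (C ls) - nsq (Dd ls) = 0 := by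
  classical
  have hZcS := Zc_mem hβ hγ
  obtain ⟨j0, hj0⟩ : ∃ j0, c0 j0 ≠ 0 := by
    by_contra h; push Not at h; exact hc0 (funext h)
  let ρ : ℂ → ℝ := fun l => nsq (C l) - nsq (Dd l)
  have hρc : Continuous ρ := (continuous_nsq.comp hC).sub (continuous_nsq.comp hD)
  have hρ0 : ∀ l : ℂ, ‖l‖ < 1 → 0 ≤ ρ l := by
    intro l hl
    have := D_le (hf.maps (Zl_mem hβ hγ hZcS hl)) (C l)
    rw [hCD l hl _ hZcS] at this
    simp only [ρ]; linarith
  have hρls : 0 ≤ ρ ls := by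
    have hcl : ls ∈ closure (Metric.ball (0:ℂ) 1) := by
      rw [closure_ball _ one_ne_zero]; simp [hls]
    exact closure_minimal (fun l hl => hρ0 l (by simpa using hl))
      (isClosed_le continuous_const hρc) hcl
  by_contra hne
  have hρpos : 0 < ρ ls := lt_of_le_of_ne hρls (Ne.symm hne)
  -- matrix
  let Λ : Option ((Sset β γ) × Fin p') → ℂ → Fin q' → ℂ := fun o l =>
    match o with
    | none => Pi.single j0 1
    | some x => fun j => f (Zl β γ x.1.1 l) x.2 j - f (Zl β γ (Zc β γ) l) x.2 j
  have hΛdot : ∀ x l c, Λ (some x) l ⬝ᵥ c =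
      (f (Zl β γ x.1.1 l) *ᵥ c - f (Zl β γ (Zc β γ) l) *ᵥ c) x.2 := by
    intro x l c
    simp only [Λ, dotProduct, mulVec, Pi.sub_apply, sub_mul, Finset.sum_sub_distrib]
  have hΛnone : ∀ l c, Λ none l ⬝ᵥ c = c j0 := by
    intro l c; simp [Λ]
  obtain ⟨r, hr⟩ := rows_lemma (fun o => Λ o 0) (by
    intro c hc
    obtain ⟨k, hk⟩ := hone c (by
      have : ∀ Z ∈ Sset β γ, f (sn Z 0) *ᵥ c = f (sn (Zc β γ) 0) *ᵥ c := by
        intro Z hZ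
        ext i
        have := hc (some (⟨Z, hZ⟩, i))
        rw [hΛdot, Zl_zero, Zl_zero] at this
        exact sub_eq_zero.1 this
      intro Z hZ Z' hZ'
      rw [this Z hZ, this Z' hZ'])
    have h1 := hc none
    rw [hΛnone 0, hk, Pi.smul_apply, smul_eq_mul] at h1
    rw [hk, (mul_eq_zero.1 h1).resolve_right hj0, zero_smul])
  let M : ℂ → Matrix (Fin q') (Fin q') ℂ := fun l => Matrix.of fun k => Λ (r k) l
  have hMent : ∀ l : ℂ, ‖l‖ < 1 → ∀ i j, ‖M l i j‖ ≤ 2 := by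
    intro l hl i j
    simp only [M, of_apply]
    rcases hri : r i with _ | x
    · simp only [Λ, Pi.single_apply]; split_ifs <;> norm_num
    · simp only [Λ]
      refine (norm_sub_le _ _).trans ?_
      have h1 := F_entry_le hf hβ hγ x.1.2 hl x.2 j
      have h2 := F_entry_le hf hβ hγ hZcS hl x.2 j
      linarith
  have hMd : DifferentiableOn ℂ M (Metric.ball 0 1) := by
    rw [matrix_diff]
    intro i j
    simp only [M, of_apply]
    rcases hri : r i with _ | x
    · simp only [Λ]; exact differentiableOn_const _
    · simp only [Λ]
      exact (F_entry_diff hf hβ hγ x.1.2 _ _).sub (F_entry_diff hf hβ hγ hZcS _ _)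
  let dM : ℂ → ℂ := fun l => (M l).det
  obtain ⟨B, hB⟩ : ∃ B : ℝ, ∀ l : ℂ, ‖l‖ < 1 → ‖dM l‖ ≤ B := by
    refine ⟨Nat.factorial (Fintype.card (Fin q')) • (2:ℝ) ^ (Fintype.card (Fin q')), fun l hl => ?_⟩
    have := Matrix.det_le (A := M l) (abv := (IsAbsoluteValue.toAbsoluteValue (norm : ℂ → ℝ))) (x := 2)
      (fun i j => hMent l hl i j)
    exact this
  obtain ⟨C1, hC1, hadj⟩ := adj_bound q' 2
  -- neighbourhood
  set P := max (ρ ls + 1) (‖C ls j0‖ ^ 2 + 1) with hP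
  have hPpos : 0 < P := lt_max_of_lt_left (by linarith)
  obtain ⟨η, hη, hnear⟩ : ∃ η > 0, ∀ l : ℂ, ‖l - ls‖ < η →
      ρ ls / 2 ≤ ρ l ∧ ρ l ≤ P ∧ ‖C l j0‖ ^ 2 ≤ P := by
    have h1 : ∀ᶠ l in 𝓝 ls, ρ ls / 2 < ρ l := hρc.continuousAt.eventually_const_lt (by linarith)
    have h2 : ∀ᶠ l in 𝓝 ls, ρ l < P :=
      hρc.continuousAt.eventually_lt_const (lt_of_lt_of_le (lt_add_one _) (le_max_left _ _))
    have h3 : ∀ᶠ l in 𝓝 ls, ‖C l j0‖ ^ 2 < P := by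
      have : Continuous fun l => ‖C l j0‖ ^ 2 := by fun_prop
      exact this.continuousAt.eventually_lt_const (lt_of_lt_of_le (lt_add_one _) (le_max_right _ _))
    obtain ⟨η, hη, h⟩ := Metric.eventually_nhds_iff.1 (h1.and (h2.and h3))
    refine ⟨η, hη, fun l hl => ?_⟩
    obtain ⟨a, b, c⟩ := h (by rwa [dist_eq_norm] : dist l ls < η)
    exact ⟨a.le, b.le, c.le⟩
  set K3 := 2 * (C1 * (q':ℝ)) * (P * (2 * B ^ 2 + 2 * (C1 * q'))) + 2 * (C1 * q') * (B ^ 2 * P) with hK3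
  have hK3n : 0 ≤ K3 := by positivity
  have h0 : dM 0 = 0 := by
    refine arc_disc (d := dM) (det_diff (matrix_diff.1 hMd)) B hB ls hls η hη ?_
    intro ε0 hε0
    set ε := ε0 ^ 4 * (ρ ls / 2) / (K3 + 1) with hε
    have hεp : 0 < ε := by positivity
    obtain ⟨rr, hrr, hb⟩ := bdry hf hβ hγ (ι := Fin q')
      (fun k => match r k with | none => Zc β γ | some x => x.1.1)
      (by
        intro k
        rcases hrk : r k with _ | x
        · exact hZcS
        · exact x.1.2) ε hεp
    refine ⟨rr, hrr, fun l hl1 hl2 hl3 => ?_⟩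
    obtain ⟨c, hc1, hc2, hc3⟩ := hb l hl1 hl2
    obtain ⟨hn1, hn2, hn3⟩ := hnear l hl3
    set F := f (Zl β γ (Zc β γ) l) with hF
    have hFD : F ∈ typeIDomain p' q' := hf.maps (Zl_mem hβ hγ hZcS hl2)
    let u : Fin q' → ℂ := fun k => if r k = none then 1 else 0
    have hMC : M l *ᵥ C l = (C l j0) • u := by
      ext k
      change Λ (r k) l ⬝ᵥ C l = C l j0 * u k
      rcases hrk : r k with _ | x
      · rw [hΛnone l]; simp [u, hrk]
      · rw [hΛdot, hCD l hl2 _ x.1.2, hCD l hl2 _ hZcS]; simp [u, hrk]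
    set e := M l *ᵥ c - (c j0) • u with he
    have hen : nsq e ≤ q' * ε := by
      have : ∀ k, ‖e k‖ ^ 2 ≤ ε := by
        intro k
        have h1 : e k = Λ (r k) l ⬝ᵥ c - c j0 * u k := rfl
        have h2 := hc3 k
        rcases hrk : r k with _ | x
        · rw [h1, hrk, hΛnone l]; simp [u, hrk, hεp.le]
        · rw [h1, hrk, hΛdot]
          simp only [hrk] at h2
          refine le_trans ?_ h2
          simp only [u, hrk]
          have := norm_le_sqrt_nsq (f (Zl β γ x.1.1 l) *ᵥ c - f (Zl β γ (Zc β γ) l) *ᵥ c) x.2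
          simpa using this
      calc nsq e ≤ ∑ _k : Fin q', ε := Finset.sum_le_sum fun k _ => this k
        _ = q' * ε := by simp
    have hun : nsq u ≤ q' := by
      calc nsq u ≤ ∑ _k : Fin q', (1:ℝ) := Finset.sum_le_sum fun k _ => by
            simp only [u]; split_ifs <;> simp
        _ = q' := by simp
    set κ := (M l).adjugate *ᵥ u with hκ
    set e' := (M l).adjugate *ᵥ e with he'
    have hadjM : ∀ v, (M l).adjugate *ᵥ (M l *ᵥ v) = dM l • v := by
      intro v; rw [mulVec_mulVec, adjugate_mul, smul_mulVec, one_mulVec]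
    have hx1 : dM l • C l = (C l j0) • κ := by rw [← hadjM, hMC, mulVec_smul]
    have hx2 : dM l • c = (c j0) • κ + e' := by
      rw [← hadjM, he', he, mulVec_sub, mulVec_smul]; abel
    have hx3 : (c j0 * dM l) • C l = (C l j0) • (dM l • c - e') := by
      rw [mul_smul, hx1, hx2, add_sub_cancel_right, smul_comm]
    have he'n : nsq e' ≤ C1 * (q' * ε) :=
      (hadj _ (hMent l hl2) e).trans (mul_le_mul_of_nonneg_left hen hC1.le)
    have hκn : nsq κ ≤ C1 * q' :=
      (hadj _ (hMent l hl2) u).trans (mul_le_mul_of_nonneg_left hun hC1.le)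
    have q1 : ‖dM l‖ ^ 2 * ‖c j0‖ ^ 2 * ρ l ≤
        ‖C l j0‖ ^ 2 * (2 * (‖dM l‖ ^ 2 * ε) + 2 * nsq e') := by
      have h1 : ‖dM l‖ ^ 2 * ‖c j0‖ ^ 2 * ρ l =
          nsq ((c j0 * dM l) • C l) - nsq (F *ᵥ ((c j0 * dM l) • C l)) := by
        rw [mulVec_smul, nsq_smul, nsq_smul, hF, hCD l hl2 _ hZcS, norm_mul]
        simp only [ρ]; ring
      rw [h1, hx3, mulVec_smul, nsq_smul, nsq_smul, ← mul_sub]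
      apply mul_le_mul_of_nonneg_left _ (sq_nonneg _)
      refine (form_le hFD _ _).trans ?_
      have h2 : nsq (dM l • c) - nsq (F *ᵥ (dM l • c)) ≤ ‖dM l‖ ^ 2 * ε := by
        rw [mulVec_smul, nsq_smul, nsq_smul, ← mul_sub]
        apply mul_le_mul_of_nonneg_left _ (sq_nonneg _)
        linarith
      linarith
    have q2 : ‖dM l‖ ^ 2 ≤ 2 * (‖c j0‖ ^ 2 * (C1 * q')) + 2 * nsq e' := by
      have h1 : ‖dM l‖ ^ 2 = nsq (dM l • c) := by rw [nsq_smul, hc1, mul_one]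
      rw [h1, hx2, ← sub_neg_eq_add]
      refine (nsq_sub_le _ _).trans ?_
      rw [nsq_neg, nsq_smul]
      have := mul_le_mul_of_nonneg_left hκn (sq_nonneg ‖c j0‖)
      linarith
    have hfin := rho_arith (sq_nonneg ‖dM l‖) (hρ0 l hl2) hC1.le (Nat.cast_nonneg q') hεp.le
      (show ‖dM l‖ ^ 2 ≤ B ^ 2 from by have := hB l hl2; gcongr) hn2 hn3 hPpos.le he'n q1 (sq_nonneg _) q2
    rw [← hK3] at hfin
    have hfin2 : (‖dM l‖ ^ 2) ^ 2 * (ρ ls / 2) ≤ ε0 ^ 4 * (ρ ls / 2) := by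
      calc (‖dM l‖ ^ 2) ^ 2 * (ρ ls / 2) ≤ (‖dM l‖ ^ 2) ^ 2 * ρ l := by gcongr
        _ ≤ K3 * ε := hfin
        _ ≤ (K3 + 1) * ε := by gcongr; linarith
        _ = _ := by rw [hε]; field_simp
    have hfin3 := le_of_mul_le_mul_right hfin2 (by linarith)
    rw [← pow_mul] at hfin3
    exact le_of_pow_le_pow_left₀ (by norm_num) hε0.le hfin3
  exact hr h0

end PartJ1

section PartJ2
open Set Topology Filter
variable {p m p' q' : ℕ} {f : Matrix (Fin p) (Fin (m + 1)) ℂ → Matrix (Fin p') (Fin q') ℂ}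

/-- append one -/
def s1 (α : Fin m → ℂ) : Fin (m + 1) → ℂ := Fin.snoc (α := fun _ => ℂ) α 1

theorem sn_s1 (Z : Matrix (Fin p) (Fin m) ℂ) (z : Fin p → ℂ) (α : Fin m → ℂ) :
    sn Z z *ᵥ s1 α = Z *ᵥ α + z := by
  rw [sn_mulVec]; simp [s1]

theorem nsq_s1 (α : Fin m → ℂ) : nsq (s1 α) = nsq α + 1 := by
  rw [nsq_split]; simp [s1]

theorem exists_through (α : Fin m → ℂ) (v : Fin p → ℂ) (h : nsq v < nsq α + 1) :
    ∃ Z ∈ typeIDomain p (m + 1), Z *ᵥ s1 α = v := by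
  rw [← nsq_s1] at h
  set a := s1 α
  have ha : 0 < nsq a := (nsq_nonneg _).trans_lt h
  have hac : (nsq a : ℂ) ≠ 0 := by exact_mod_cast ha.ne'
  have hm : ∀ u, ((1 / (nsq a : ℂ)) • vecMulVec v (star a)) *ᵥ u = ((star a ⬝ᵥ u) / (nsq a : ℂ)) • v := by
    intro u
    ext i
    simp only [mulVec, dotProduct, Matrix.smul_apply, vecMulVec_apply, smul_eq_mul, Pi.smul_apply,
      Finset.sum_div, Finset.sum_mul, Pi.star_apply]
    exact Finset.sum_congr rfl fun j _ => by ring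
  refine ⟨(1 / (nsq a : ℂ)) • vecMulVec v (star a), mem_D.2 fun u hu => ?_, ?_⟩
  · rw [hm, nsq_smul]
    have h1 := nsq_sub_proj a u ha
    have h2 := nsq_pos hu
    by_cases h3 : ‖star a ⬝ᵥ u / (nsq a : ℂ)‖ ^ 2 = 0
    · rw [h3, zero_mul]; exact h2
    · have : 0 < ‖star a ⬝ᵥ u / (nsq a : ℂ)‖ ^ 2 := lt_of_le_of_ne (sq_nonneg _) (Ne.symm h3)
      nlinarith
  · rw [hm, star_dot_self, div_self hac, one_smul]

/-- one dimensionality along a slice -/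
def Good (f : Matrix (Fin p) (Fin (m + 1)) ℂ → Matrix (Fin p') (Fin q') ℂ) (c0 : Fin q' → ℂ)
    (w : (Fin m → ℂ) × (Fin p → ℂ)) : Prop :=
  ∀ c, (∀ Z ∈ Sset (star w.2) (star w.1), ∀ Z' ∈ Sset (star w.2) (star w.1),
    f (sn Z 0) *ᵥ c = f (sn Z' 0) *ᵥ c) → ∃ k : ℂ, c = k • c0

theorem good_smul {c0 : Fin q' → ℂ} {w : (Fin m → ℂ) × (Fin p → ℂ)} {k : ℂ} (hk : k ≠ 0)
    (h : Good f c0 w) : Good f c0 (k • w) := by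
  unfold Good at *
  simp only [Prod.smul_fst, Prod.smul_snd, star_smul]
  rw [Sset_smul (star k) (by simpa using hk)]
  exact h

theorem good_rho (hf : PH p (m + 1) p' q' f) {c0 : Fin q' → ℂ} (hc0 : c0 ≠ 0)
    {C : (Fin m → ℂ) × (Fin p → ℂ) → Fin q' → ℂ} {Dd : (Fin m → ℂ) × (Fin p → ℂ) → Fin p' → ℂ}
    (hC : Continuous C) (hD : Continuous Dd)
    (hCD : ∀ Z ∈ typeIDomain p (m + 1), ∀ α, f Z *ᵥ C (α, Z *ᵥ s1 α) = Dd (α, Z *ᵥ s1 α))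
    {w : (Fin m → ℂ) × (Fin p → ℂ)} (hw : nsq w.2 = nsq w.1 + 1) (hg : Good f c0 w) :
    nsq (C w) - nsq (Dd w) = 0 := by
  have hn : 0 < nsq w.2 := by have := nsq_nonneg w.1; linarith
  set s := Real.sqrt (nsq w.2) with hs
  have hsp : 0 < s := Real.sqrt_pos.2 hn
  have hs2 : s ^ 2 = nsq w.2 := Real.sq_sqrt hn.le
  set k : ℂ := ((1 / s : ℝ) : ℂ) with hk
  have hk0 : k ≠ 0 := by rw [hk]; exact_mod_cast (by positivity : (1 / s : ℝ) ≠ 0)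
  have hkn : ‖k‖ ^ 2 = 1 / nsq w.2 := by
    rw [hk, Complex.norm_real, Real.norm_eq_abs, sq_abs, div_pow, hs2, one_pow]
  have hks : star k = k := by rw [hk]; exact Complex.conj_ofReal _
  have hβ : nsq (k • star w.2) = 1 := by rw [nsq_smul, nsq_star, hkn]; field_simp
  have hγ' : 1 - nsq (k • star w.1) = (1 / s) ^ 2 := by
    rw [nsq_smul, nsq_star, hkn, div_pow, hs2, one_pow, eq_sub_of_add_eq hw.symm]; field_simp; ring
  have hγ : nsq (k • star w.1) < 1 := by
    have : 0 < (1 / s) ^ 2 := by positivity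
    linarith
  have hg' := hg
  unfold Good at hg'
  rw [← Sset_smul k hk0] at hg'
  have := rho_bdry hf hβ hγ hc0 hg' (C := fun l => C (l • w)) (Dd := fun l => Dd (l • w))
    (hC.comp (by fun_prop)) (hD.comp (by fun_prop)) (by
      intro l hl Z hZ
      have h1 := hCD _ (Zl_mem hβ hγ hZ hl) (l • w.1)
      have h2 : Zl (k • star w.2) (k • star w.1) Z l *ᵥ s1 (l • w.1) = l • w.2 := by
        rw [Zl, hγ', Real.sqrt_sq (by positivity), ← hk, sn_s1, star_smul, star_smul, star_star,
          star_star, hks, mulVec_smul, mulVec_smul, ← smul_sub, smul_smul, div_mul_cancel₀ _ hk0, smul_sub]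
        abel
      rw [h2] at h1
      exact h1) (ls := 1) (by simp)
  simpa using this

theorem good_exists (hf : PH p (m + 1) p' q' f) (hqp : q' < p) {c0 : Fin q' → ℂ}
    (hone : ∀ c, (∀ Z ∈ typeIDomain p m, ∀ Z' ∈ typeIDomain p m,
      f (sn Z 0) *ᵥ c = f (sn Z' 0) *ᵥ c) → ∃ k : ℂ, c = k • c0)
    {C : (Fin m → ℂ) × (Fin p → ℂ) → Fin q' → ℂ} (hC : Differentiable ℂ C) (hC0 : ∃ w, C w ≠ 0) :
    ∃ w : (Fin m → ℂ) × (Fin p → ℂ), nsq w.2 = nsq w.1 + 1 ∧ (∀ᶠ y in 𝓝 w, Good f c0 y) ∧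
      ∃ t : ℂ, C (t • w) ≠ 0 := by
  obtain ⟨U', hU', hU'o, ⟨u0, hu0⟩, hU⟩ := ord_open hf.restrict.diff hf.restrict.maps hqp isOpen_Om subset_rfl
    (Om_nonempty (m := m) (by omega))
  let st : (Fin m → ℂ) × (Fin p → ℂ) → (Fin p → ℂ) × (Fin m → ℂ) := fun w => (star w.2, star w.1)
  have hst : Continuous st := by fun_prop
  have hUs : IsOpen (st ⁻¹' U') := hU'o.preimage hst
  have hgood : ∀ w ∈ st ⁻¹' U', Good f c0 w := fun w hw c hc => hone c (hU _ _ hw c hc)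
  obtain ⟨w, hwU, hwC⟩ : ∃ w ∈ st ⁻¹' U', C w ≠ 0 := by
    by_contra hcon
    push Not at hcon
    obtain ⟨w, hw⟩ := hC0
    apply hw
    have hmem : ((star u0.2, star u0.1) : (Fin m → ℂ) × (Fin p → ℂ)) ∈ st ⁻¹' U' := by
      simpa [st] using hu0
    exact holo_ident isOpen_univ convex_univ hC.differentiableOn (mem_univ _)
      (by filter_upwards [hUs.mem_nhds hmem] with y hy using hcon y hy) w (mem_univ _)
  have hlt : nsq w.1 < nsq w.2 := by
    have := hU' hwU
    simpa [st, Om, nsq_star] using this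
  set h := nsq w.2 - nsq w.1 with hh
  have hhp : 0 < h := by linarith
  set s : ℂ := ((1 / Real.sqrt h : ℝ) : ℂ) with hs
  have hsq : 0 < Real.sqrt h := Real.sqrt_pos.2 hhp
  have hs0 : s ≠ 0 := by rw [hs]; exact_mod_cast (by positivity : (1 / Real.sqrt h : ℝ) ≠ 0)
  have hsn : ‖s‖ ^ 2 = 1 / h := by
    rw [hs, Complex.norm_real, Real.norm_eq_abs, sq_abs, div_pow, Real.sq_sqrt hhp.le, one_pow]
  refine ⟨s • w, ?_, ?_, s⁻¹, by rwa [inv_smul_smul₀ hs0]⟩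
  · rw [Prod.smul_snd, Prod.smul_fst, nsq_smul, nsq_smul, hsn]
    field_simp; linarith
  · have hc : Continuous fun y : (Fin m → ℂ) × (Fin p → ℂ) => s⁻¹ • y := by fun_prop
    filter_upwards [(hUs.preimage hc).mem_nhds (by
      simp only [mem_preimage, inv_smul_smul₀ hs0]; exact hwU)] with y hy
    have := good_smul hs0 (hgood _ hy)
    rwa [smul_inv_smul₀ hs0] at this

end PartJ2

section PartJ3
open Set Topology Filter
variable {p m p' q' : ℕ} {f : Matrix (Fin p) (Fin (m + 1)) ℂ → Matrix (Fin p') (Fin q') ℂ}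

theorem real_nonzero {E F : Type} [NormedAddCommGroup E] [NormedSpace ℂ E] [NormedAddCommGroup F]
    [NormedSpace ℂ F] [CompleteSpace F] {C : E → F} (hC : Differentiable ℂ C) (w : E) {t : ℂ}
    (ht : C (t • w) ≠ 0) {a b : ℝ} (hab : a < b) :
    ∃ r : ℝ, a < r ∧ r < b ∧ C ((r : ℂ) • w) ≠ 0 := by
  by_contra hcon
  push Not at hcon
  apply ht
  have hd : Differentiable ℂ fun l : ℂ => C (l • w) := hC.comp (by fun_prop)
  have han : AnalyticOnNhd ℂ (fun l : ℂ => C (l • w)) univ := fun z _ => hd.analyticAt z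
  set x0 := (a + b) / 2 with hx0
  refine han.eqOn_zero_of_preconnected_of_frequently_eq_zero isPreconnected_univ
    (mem_univ ((x0 : ℝ) : ℂ)) ?_ (mem_univ t)
  have h1 : Tendsto (fun r : ℝ => (r : ℂ)) (𝓝[≠] x0) (𝓝[≠] ((x0 : ℝ) : ℂ)) := by
    refine tendsto_nhdsWithin_iff.2 ⟨?_, ?_⟩
    · exact (Complex.continuous_ofReal.tendsto x0).mono_left nhdsWithin_le_nhds
    · filter_upwards [self_mem_nhdsWithin] with r hr
      simpa using hr
  refine h1.frequently ?_
  have h2 : ∀ᶠ r : ℝ in 𝓝[≠] x0, C ((r : ℂ) • w) = 0 := by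
    have : Ioo a b ∈ 𝓝 x0 := Ioo_mem_nhds (by rw [hx0]; linarith) (by rw [hx0]; linarith)
    filter_upwards [mem_nhdsWithin_of_mem_nhds this] with r hr
    exact hcon r hr.1 hr.2
  exact h2.frequently

theorem nsq_nhds {n : ℕ} {v : Fin n → ℂ} {P : (Fin n → ℂ) → Prop} (h : ∀ᶠ y in 𝓝 v, P y) :
    ∃ δ > 0, ∀ y, nsq (y - v) < δ → P y := by
  obtain ⟨ε, hε, h⟩ := Metric.eventually_nhds_iff.1 h
  refine ⟨ε ^ 2, by positivity, fun y hy => h ?_⟩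
  rw [dist_eq_norm, pi_norm_lt_iff hε]
  intro i
  have := norm_le_sqrt_nsq (y - v) i
  exact lt_of_pow_lt_pow_left₀ 2 hε.le (this.trans_lt hy)

theorem r6 (hf : PH p (m + 1) p' q' f) (hqp : q' < p) {c0 : Fin q' → ℂ} (hc0 : c0 ≠ 0)
    (hone : ∀ c, (∀ Z ∈ typeIDomain p m, ∀ Z' ∈ typeIDomain p m,
      f (sn Z 0) *ᵥ c = f (sn Z' 0) *ᵥ c) → ∃ k : ℂ, c = k • c0)
    {C : (Fin m → ℂ) × (Fin p → ℂ) → Fin q' → ℂ} {Dd : (Fin m → ℂ) × (Fin p → ℂ) → Fin p' → ℂ}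
    (hC : Differentiable ℂ C) (hD : Differentiable ℂ Dd)
    (hCD : ∀ Z ∈ typeIDomain p (m + 1), ∀ α, f Z *ᵥ C (α, Z *ᵥ s1 α) = Dd (α, Z *ᵥ s1 α))
    (hC0 : ∃ w, C w ≠ 0) : p ≤ p' := by
  by_contra hpp
  push Not at hpp
  obtain ⟨⟨α, v1⟩, hw, hgood, t, ht⟩ := good_exists hf hqp hone hC hC0
  simp only at hw
  set n1 := nsq v1 with hn1
  have hα := nsq_nonneg α
  have hn1p : 1 ≤ n1 := by linarith
  have hn1c : (n1 : ℂ) ≠ 0 := by exact_mod_cast (by linarith : n1 ≠ 0)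
  let ℓ : (Fin p → ℂ) →ₗ[ℂ] ℂ :=
    { toFun := fun v => (star v1 ⬝ᵥ v) / (n1 : ℂ)
      map_add' := fun x y => by rw [dotProduct_add, add_div]
      map_smul' := fun k x => by rw [dotProduct_smul, smul_eq_mul, RingHom.id_apply, smul_eq_mul, mul_div_assoc] }
  have hℓ : ∀ v, ℓ v = (star v1 ⬝ᵥ v) / (n1 : ℂ) := fun _ => rfl
  have hℓ1 : ℓ v1 = 1 := by rw [hℓ, star_dot_self, div_self hn1c]
  have hℓc : Continuous ℓ := ℓ.continuous_of_finiteDimensional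
  let L : (Fin p → ℂ) →ₗ[ℂ] (Fin m → ℂ) × (Fin p → ℂ) :=
    { toFun := fun v => (ℓ v • α, v)
      map_add' := fun x y => by simp [add_smul]
      map_smul' := fun k x => by simp [mul_smul] }
  have hL : ∀ v, L v = (ℓ v • α, v) := fun _ => rfl
  have hLd : Differentiable ℂ L := (LinearMap.toContinuousLinearMap L).differentiable
  have hLc : Continuous L := hLd.continuous
  have hLv1 : L v1 = (α, v1) := by rw [hL, hℓ1, one_smul]
  let h : (Fin p → ℂ) → ℝ := fun v => nsq v - ‖ℓ v‖ ^ 2 * nsq α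
  have hh : ∀ v, h v = nsq v - ‖ℓ v‖ ^ 2 * nsq α := fun _ => rfl
  have hhc : Continuous h := by
    have := continuous_nsq (ι := Fin p)
    fun_prop
  have hcs : ∀ v, ‖ℓ v‖ ^ 2 * n1 ≤ nsq v := fun v => nsq_sub_proj v1 v (by rw [← hn1]; linarith)
  have hh1 : ∀ v, nsq v ≤ n1 * h v := by
    intro v
    have := hcs v
    rw [hh]
    have h3 : nsq α = n1 - 1 := by linarith
    rw [h3]
    nlinarith
  have hh2 : ∀ v, h (v - v1) = h v - 2 * (ℓ v).re + 1 := by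
    intro v
    have e1 : nsq (v - v1) = nsq v - 2 * n1 * (ℓ v).re + n1 := by
      have e2 : (star v1 ⬝ᵥ v) = (n1 : ℂ) * ℓ v := by rw [hℓ]; field_simp
      have e3 : v - v1 = -(v1 + -v) := by abel
      rw [e3, nsq_neg, nsq_add, nsq_neg, dotProduct_neg, e2, Complex.neg_re, Complex.re_ofReal_mul]; ring
    have e4 : ‖ℓ (v - v1)‖ ^ 2 = ‖ℓ v‖ ^ 2 - 2 * (ℓ v).re + 1 := by
      rw [map_sub, hℓ1, ← Complex.normSq_eq_norm_sq, ← Complex.normSq_eq_norm_sq, Complex.normSq_apply,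
        Complex.normSq_apply]
      simp; ring
    rw [hh, hh, e1, e4]
    have h3 : nsq α = n1 - 1 := by linarith
    rw [h3]; ring
  obtain ⟨δ, hδ, hG⟩ := nsq_nhds (v := v1) (P := fun v => Good f c0 (L v))
    (hLc.continuousAt.eventually (by rw [hLv1]; exact hgood))
  set η := δ / (2 * n1) with hη
  have hηp : 0 < η := by positivity
  obtain ⟨r, hr1, hr2, hrC⟩ := real_nonzero hC _ ht (a := max (1 - η) 0) (b := 1)
    (max_lt (by linarith) one_pos)
  have hrη : 1 - η < r := (le_max_left _ _).trans_lt hr1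
  have hr0 : 0 < r := (le_max_right _ _).trans_lt hr1
  set v0 : Fin p → ℂ := (r : ℂ) • v1 with hv0
  have hLv0 : L v0 = (r : ℂ) • (α, v1) := by rw [hv0, map_smul, hLv1]
  have hℓv0 : ℓ v0 = (r : ℂ) := by rw [hv0, map_smul, hℓ1, smul_eq_mul, mul_one]
  have hrn : ‖(r : ℂ)‖ ^ 2 = r ^ 2 := by rw [Complex.norm_real, Real.norm_eq_abs, sq_abs]
  have hhv0 : h v0 = r ^ 2 := by
    rw [hh, hℓv0, hv0, nsq_smul, hrn, ← hn1, hw]; ring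
  have hr2' : r ^ 2 < 1 := by nlinarith
  let ρ : (Fin p → ℂ) → ℝ := fun v => nsq (C (L v)) - nsq (Dd (L v))
  have hρc : Continuous ρ := by
    have h1 := (continuous_nsq (ι := Fin q')).comp (hC.continuous.comp hLc)
    have h2 := (continuous_nsq (ι := Fin p')).comp (hD.continuous.comp hLc)
    exact h1.sub h2
  have hρ0 : 0 < ρ v0 := by
    obtain ⟨Z, hZ, hZ2⟩ := exists_through ((r : ℂ) • α) v0 (by
      rw [hv0, nsq_smul, nsq_smul, hrn, ← hn1, hw]; nlinarith)
    have h1 := hCD Z hZ ((r : ℂ) • α)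
    rw [hZ2] at h1
    have h2 : ((r : ℂ) • α, v0) = L v0 := by rw [hLv0, hv0, Prod.smul_mk]
    rw [h2] at h1
    have h3 := mem_D.1 (hf.maps hZ) (C (L v0)) (by rw [hLv0]; exact hrC)
    rw [h1] at h3
    exact sub_pos.2 h3
  let Gc : Set (Fin p → ℂ) := {v | h v ≤ 1}
  have hGcn : ∀ v ∈ Gc, nsq v ≤ n1 := fun v hv => by
    have h1 := hh1 v
    have h2 : h v ≤ 1 := hv
    nlinarith
  have hGcc : IsCompact Gc := by
    refine Metric.isCompact_of_isClosed_isBounded (isClosed_le hhc continuous_const) ?_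
    refine (Metric.isBounded_closedBall (x := (0 : Fin p → ℂ)) (r := n1)).subset fun v hv => ?_
    rw [mem_closedBall_zero_iff, pi_norm_le_iff_of_nonneg (by linarith)]
    intro i
    have h1 := norm_le_sqrt_nsq v i
    have h2 := hGcn v hv
    nlinarith [norm_nonneg (v i)]
  have hv0G : v0 ∈ Gc := by
    change h v0 ≤ 1
    rw [hhv0]; exact hr2'.le
  obtain ⟨b, hbG, hb⟩ := hGcc.exists_isMaxOn ⟨v0, hv0G⟩ hρc.continuousOn
  have hb' : ∀ v ∈ Gc, ρ v ≤ ρ b := fun v hv => hb hv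
  set B := ρ b with hB
  have hBp : 0 < B := hρ0.trans_le (hb' _ hv0G)
  set s := r - (1 - η) with hs
  have hsp : 0 < s := by rw [hs]; linarith
  set A : ℝ := B * Real.exp n1 / (ρ v0 * s) with hA
  have hAp : 0 < A := by positivity
  have hAk : B * Real.exp n1 < ρ v0 * Real.exp (A * s) := by
    have h1 := Real.add_one_le_exp (A * s)
    have h2 : ρ v0 * (A * s) = B * Real.exp n1 := by rw [hA]; field_simp
    nlinarith
  let Φ : (Fin p → ℂ) → ℝ := fun v => ρ v * Real.exp ((((A : ℂ) • ℓ) v).re + nsq v)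
  have hΦ : ∀ v, Φ v = ρ v * Real.exp (A * (ℓ v).re + nsq v) := by
    intro v
    simp only [Φ, LinearMap.smul_apply, smul_eq_mul, Complex.re_ofReal_mul]
  have hΦc : Continuous Φ := by
    have e : Φ = fun v => ρ v * Real.exp (A * (ℓ v).re + nsq v) := funext hΦ
    rw [e]
    have := continuous_nsq (ι := Fin p)
    have h2 : Continuous fun v => (ℓ v).re := Complex.continuous_re.comp hℓc
    fun_prop
  obtain ⟨x, hxG, hx⟩ := hGcc.exists_isMaxOn ⟨v0, hv0G⟩ hΦc.continuousOn
  have hx' : ∀ v ∈ Gc, Φ v ≤ Φ x := fun v hv => hx hv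
  have hΦ0 : B * Real.exp (A * (1 - η) + n1) < Φ v0 := by
    rw [hΦ, hℓv0, Complex.ofReal_re]
    have e1 : A * r + nsq v0 = A * s + (A * (1 - η) + nsq v0) := by rw [hs]; ring
    rw [e1, Real.exp_add (A * s), Real.exp_add (A * (1 - η)), Real.exp_add (A * (1 - η))]
    have h2 : 1 ≤ Real.exp (nsq v0) := Real.one_le_exp (nsq_nonneg _)
    have h3 := Real.exp_pos (A * (1 - η))
    have h4 := Real.exp_pos (A * s)
    calc B * (Real.exp (A * (1 - η)) * Real.exp n1) = (B * Real.exp n1) * Real.exp (A * (1 - η)) := by ring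
      _ < (ρ v0 * Real.exp (A * s)) * Real.exp (A * (1 - η)) := mul_lt_mul_of_pos_right hAk h3
      _ ≤ (ρ v0 * Real.exp (A * s)) * Real.exp (A * (1 - η)) * Real.exp (nsq v0) :=
          le_mul_of_one_le_right (by positivity) h2
      _ = _ := by ring
  have hΦx : B * Real.exp (A * (1 - η) + n1) < Φ x := hΦ0.trans_le (hx' _ hv0G)
  have hρx : 0 < ρ x := by
    have h1 : 0 < Φ x := (by positivity : 0 < B * Real.exp (A * (1 - η) + n1)).trans hΦx
    rw [hΦ] at h1
    exact pos_of_mul_pos_left h1 (Real.exp_pos _).le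
  have hre : 1 - η < (ℓ x).re := by
    by_contra hcon
    push Not at hcon
    have h1 : Φ x ≤ B * Real.exp (A * (1 - η) + n1) := by
      rw [hΦ]
      have h2 := hGcn x hxG
      have h3 := hb' x hxG
      gcongr
    linarith
  have hgx : Good f c0 (L x) := by
    apply hG
    have h1 := hh1 (x - v1)
    rw [hh2] at h1
    have h2 : h x ≤ 1 := hxG
    have h3 : 2 * n1 * η = δ := by rw [hη]; field_simp
    nlinarith
  have hhx : h x < 1 := by
    refine lt_of_le_of_ne hxG fun he => ?_
    have h1 := good_rho hf hc0 hC.continuous hD.continuous hCD (w := L x) (by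
      rw [hL]
      simp only [nsq_smul]
      rw [hh] at he
      linarith) hgx
    exact hρx.ne' h1
  refine lap hpp (V := {v | h v < 1}) (isOpen_lt hhc continuous_const) (c := fun v => C (L v))
    (d := fun v => Dd (L v)) (hC.comp hLd).differentiableOn (hD.comp hLd).differentiableOn hhx
    ((A : ℂ) • ℓ) hρx fun v hv => hx' v (show h v ≤ 1 from le_of_lt (show h v < 1 from hv))

end PartJ3

section PartJ4
open Set Topology Filter

/-- Taylor coefficient at the origin -/
noncomputable def tc (n : ℕ) (g : ℂ → ℂ) : ℂ := iteratedDeriv n g 0 / (n.factorial : ℂ)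

theorem iteratedDeriv_poly (Q : Polynomial ℂ) (n : ℕ) :
    iteratedDeriv n (fun t => Q.eval t) = fun t => (Polynomial.derivative^[n] Q).eval t := by
  induction n with
  | zero => simp
  | succ n ih =>
    rw [iteratedDeriv_succ, ih, Function.iterate_succ_apply']
    ext t
    exact Polynomial.deriv _

theorem tc_poly (Q : Polynomial ℂ) (n : ℕ) : tc n (fun t => Q.eval t) = Q.coeff n := by
  have h : (n.factorial : ℂ) ≠ 0 := by exact_mod_cast n.factorial_ne_zero
  rw [tc, iteratedDeriv_poly]
  simp only [← Polynomial.coeff_zero_eq_eval_zero]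
  rw [Polynomial.coeff_iterate_derivative, zero_add, Nat.descFactorial_self, nsmul_eq_mul]
  field_simp

theorem tc_mul (Q : Polynomial ℂ) {g : ℂ → ℂ} (n : ℕ) (hg : ContDiffAt ℂ n g 0) :
    tc n (fun t => Q.eval t * g t) = ∑ i ∈ Finset.range (n + 1), Q.coeff i * tc (n - i) g := by
  have hQ : ContDiffAt ℂ n (fun t : ℂ => Q.eval t) 0 := (Q.differentiable.analyticAt 0).contDiffAt
  rw [tc, iteratedDeriv_fun_mul hQ hg, Finset.sum_div]
  refine Finset.sum_congr rfl fun i hi => ?_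
  have hi' : i ≤ n := Nat.lt_succ_iff.1 (Finset.mem_range.1 hi)
  rw [← tc_poly Q i, tc, tc]
  have h1 : (n.factorial : ℂ) ≠ 0 := by exact_mod_cast n.factorial_ne_zero
  have h2 : (i.factorial : ℂ) ≠ 0 := by exact_mod_cast i.factorial_ne_zero
  have h3 : ((n - i).factorial : ℂ) ≠ 0 := by exact_mod_cast (n - i).factorial_ne_zero
  have h4 : (n.choose i : ℂ) * i.factorial * (n - i).factorial = n.factorial := by
    exact_mod_cast Nat.choose_mul_factorial_mul_factorial hi'
  rw [← h4]
  have h5 : (n.choose i : ℂ) ≠ 0 := by exact_mod_cast (Nat.choose_pos hi').ne'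
  field_simp

theorem tc_zero {V : Set ℂ} (hV : IsOpen V) (hc : Convex ℝ V) (h0 : (0 : ℂ) ∈ V) {g : ℂ → ℂ}
    (hg : DifferentiableOn ℂ g V) (h : ∀ n, tc n g = 0) : ∀ t ∈ V, g t = 0 := by
  have han : AnalyticAt ℂ g 0 := hg.analyticAt (hV.mem_nhds h0)
  have ho : analyticOrderAt g 0 = ⊤ := by
    refine ENat.eq_top_iff_forall_ge.2 fun n => ?_
    rw [natCast_le_analyticOrderAt_iff_iteratedDeriv_eq_zero han]
    intro i _
    have := h i
    rw [tc, div_eq_zero_iff] at this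
    exact this.resolve_right (by exact_mod_cast i.factorial_ne_zero)
  exact holo_ident hV hc hg h0 (analyticOrderAt_eq_top.1 ho)

variable {E : Type} [NormedAddCommGroup E] [NormedSpace ℂ E]

/-- homogeneous components -/
noncomputable def hcp (φ : E → ℂ) (k : ℕ) (w : E) : ℂ :=
  iteratedFDeriv ℂ k φ 0 (fun _ => w) / (k.factorial : ℂ)

theorem hcp_eq (φ : E → ℂ) (k : ℕ) : hcp φ k = fun w => iteratedFDeriv ℂ k φ 0 (fun _ => w) / (k.factorial : ℂ) := rfl

theorem hcp_diff (φ : E → ℂ) (k : ℕ) : Differentiable ℂ (hcp φ k) := by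
  have h1 : Differentiable ℂ fun w : E => iteratedFDeriv ℂ k φ 0 (fun _ => w) :=
    ((iteratedFDeriv ℂ k φ 0).contDiff (n := 1)).differentiable (by simp) |>.comp (by fun_prop)
  simp only [hcp_eq, div_eq_mul_inv]
  exact h1.mul_const _

variable [FiniteDimensional ℂ E]

theorem hcp_tc {U : Set E} (hU : IsOpen U) (h0 : (0 : E) ∈ U) {φ : E → ℂ} (hφ : DifferentiableOn ℂ φ U)
    (k : ℕ) (w : E) : hcp φ k w = tc k (fun t => φ (t • w)) := by
  have h := iteratedDeriv_line hU hφ 0 w k 0 (by simpa using h0)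
  simp only [zero_add, zero_smul] at h
  rw [tc, h, ← iteratedFDeriv_eq_Dir hU hφ w k 0 h0, hcp]

/-- entire functions -/
def entSub (E : Type) [NormedAddCommGroup E] [NormedSpace ℂ E] : Subring (E → ℂ) where
  carrier := {f | Differentiable ℂ f}
  mul_mem' := fun ha hb => Differentiable.mul ha hb
  one_mem' := differentiable_const _
  add_mem' := fun ha hb => Differentiable.add ha hb
  zero_mem' := differentiable_const _
  neg_mem' := fun ha => Differentiable.neg ha

theorem pade {ι : Type} {φ : ι → E → ℂ} {ε : ℝ} (hε : 0 < ε)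
    (hφ : ∀ i, DifferentiableOn ℂ (φ i) (Metric.ball 0 ε)) {D : ℕ} {O : Set E} (hO : IsOpen O)
    (hOn : O.Nonempty) (hQ : ∀ w ∈ O, ∃ Q : Polynomial ℂ, Q ≠ 0 ∧ Q.natDegree ≤ D ∧ ∀ i,
      ∃ P : Polynomial ℂ, P.natDegree ≤ D ∧ ∀ᶠ t in 𝓝[≠] (0 : ℂ), Q.eval t * φ i (t • w) = P.eval t) :
    ∃ (Φ : ι → E → ℂ) (Qt : E → ℂ), (∀ i, Differentiable ℂ (Φ i)) ∧
      (∀ i, ∀ w ∈ Metric.ball (0 : E) ε, Φ i w = Qt w * φ i w) ∧ ∃ w ∈ Metric.ball (0 : E) ε, Qt w ≠ 0 := by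
  have hb0 : (0 : E) ∈ Metric.ball (0 : E) ε := Metric.mem_ball_self hε
  have hbo : IsOpen (Metric.ball (0 : E) ε) := Metric.isOpen_ball
  let Vw : E → Set ℂ := fun w => {t : ℂ | t • w ∈ Metric.ball (0 : E) ε}
  have hVo : ∀ w, IsOpen (Vw w) := fun w => hbo.preimage (by fun_prop : Continuous fun t : ℂ => t • w)
  have hV0 : ∀ w, (0 : ℂ) ∈ Vw w := fun w => by
    change (0 : ℂ) • w ∈ Metric.ball (0 : E) ε
    rw [zero_smul]; exact hb0
  have hVc : ∀ w, Convex ℝ (Vw w) := by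
    intro w a ha b hb s t hs ht hst
    have := convex_ball (0 : E) ε ha hb hs ht hst
    change (s • a + t • b) • w ∈ Metric.ball (0 : E) ε
    rw [add_smul, smul_assoc, smul_assoc]
    exact this
  have hgd : ∀ i w, DifferentiableOn ℂ (fun t : ℂ => φ i (t • w)) (Vw w) := fun i w =>
    (hφ i).comp (by fun_prop : Differentiable ℂ fun t : ℂ => t • w).differentiableOn (fun t ht => ht)
  have hgan : ∀ i w, AnalyticAt ℂ (fun t : ℂ => φ i (t • w)) 0 := fun i w =>
    (hgd i w).analyticAt ((hVo w).mem_nhds (hV0 w))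
  let a : ι → ℕ → E → ℂ := fun i k w => hcp (φ i) k w
  have ha : ∀ i k w, a i k w = tc k (fun t => φ i (t • w)) := fun i k w => hcp_tc hbo hb0 (hφ i) k w
  have had : ∀ i k, Differentiable ℂ (a i k) := fun i k => hcp_diff _ _
  let Λ : ι × ℕ → E → Fin (D + 1) → ℂ := fun x w j => a x.1 (D + 1 + x.2 - j) w
  have hΛ : ∀ x j, (fun w => Λ x w j) ∈ entSub E := fun x j => had _ _
  obtain ⟨ρ, r, s, ⟨w1, hw1, hdet1⟩, hker⟩ := ker_lemma Λ O hOn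
  have hdd : Differentiable ℂ fun w => (kB Λ r s w).det := kB_mem (entSub E) Λ hΛ r s
  have hqd : ∀ j i, Differentiable ℂ fun w => kq Λ r s j w i := fun j i => kq_mem (entSub E) Λ hΛ r s j i
  obtain ⟨jj, hjj⟩ : ∃ j, kq Λ r s j w1 ≠ 0 := by
    by_contra hcon
    push Not at hcon
    obtain ⟨Q, hQ0, hQD, hQP⟩ := hQ w1 hw1
    have hz := kq_span Λ r s w1 (fun j => Q.coeff j) (by
      rintro ⟨i, l⟩
      obtain ⟨P, hPD, hP⟩ := hQP i
      have h1 : (fun t : ℂ => Q.eval t * φ i (t • w1)) =ᶠ[𝓝 0] fun t => P.eval t := by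
        refine (ContinuousAt.eventuallyEq_nhds_iff_eventuallyEq_nhdsNE ?_ ?_).1 hP
        · exact (Q.continuous.continuousAt).mul (hgan i w1).continuousAt
        · exact P.continuous.continuousAt
      have h2 : tc (D + 1 + l) (fun t : ℂ => Q.eval t * φ i (t • w1)) = P.coeff (D + 1 + l) := by
        rw [← tc_poly, tc, tc, h1.iteratedDeriv_eq]
      rw [tc_mul Q _ (hgan i w1).contDiffAt, Polynomial.coeff_eq_zero_of_natDegree_lt (by omega)] at h2
      rw [← h2]
      simp only [dotProduct, Λ]
      rw [Fin.sum_univ_eq_sum_range (fun j => a i (D + 1 + l - j) w1 * Q.coeff j) (D + 1)]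
      rw [Finset.sum_subset (Finset.range_subset_range.2 (by omega : D + 1 ≤ D + 1 + l + 1))]
      · exact Finset.sum_congr rfl fun j _ => by rw [ha, mul_comm]
      · intro x _ hx
        rw [Finset.mem_range] at hx
        rw [Polynomial.coeff_eq_zero_of_natDegree_lt (by omega), mul_zero])
    simp only [hcon, smul_zero, Finset.sum_const_zero] at hz
    apply hQ0
    have hz' := (smul_eq_zero.1 hz).resolve_left hdet1
    ext n
    by_cases hn : n < D + 1
    · exact congrFun hz' ⟨n, hn⟩
    · rw [Polynomial.coeff_eq_zero_of_natDegree_lt (by omega), Polynomial.coeff_zero]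
  let qc : ℕ → E → ℂ := fun j w => if h : j < D + 1 then kq Λ r s jj w ⟨j, h⟩ else 0
  have hqc : ∀ j, Differentiable ℂ (qc j) := by
    intro j
    by_cases h : j < D + 1
    · have : qc j = fun w => kq Λ r s jj w ⟨j, h⟩ := by ext w; exact dif_pos h
      rw [this]; exact hqd _ _
    · have : qc j = fun _ => 0 := by ext w; exact dif_neg h
      rw [this]; exact differentiable_const _
  have hqc0 : ∀ j w, D < j → qc j w = 0 := fun j w h => dif_neg (by omega)
  have hqc1 : ∀ (j : Fin (D + 1)) w, qc j w = kq Λ r s jj w j := fun j w => dif_pos j.2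
  have hpade : ∀ i l w, ∑ j ∈ Finset.range (D + 1 + l + 1), qc j w * a i (D + 1 + l - j) w = 0 := by
    intro i l w
    refine holo_ident isOpen_univ convex_univ (f := fun w => ∑ j ∈ Finset.range (D + 1 + l + 1), qc j w * a i (D + 1 + l - j) w)
      ?_ (mem_univ w1) ?_ w (mem_univ w)
    · exact (Differentiable.fun_sum fun j _ => (hqc j).mul (had _ _)).differentiableOn
    · have hop : ∀ᶠ w in 𝓝 w1, (kB Λ r s w).det ≠ 0 := hdd.continuous.continuousAt.eventually_ne hdet1
      filter_upwards [hop, hO.mem_nhds hw1] with w hw hwO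
      have := hker w hwO hw (i, l) jj
      simp only [dotProduct, Λ] at this
      simp only [Pi.zero_apply]
      rw [← this, ← Finset.sum_subset (Finset.range_subset_range.2 (by omega : D + 1 ≤ D + 1 + l + 1)),
        ← Fin.sum_univ_eq_sum_range (fun j => qc j w * a i (D + 1 + l - j) w) (D + 1)]
      · refine Finset.sum_congr rfl fun j _ => ?_
        rw [mul_comm, hqc1]
      · intro x _ hx
        rw [Finset.mem_range] at hx
        rw [hqc0 x w (by omega), zero_mul]
  let Qp : E → Polynomial ℂ := fun w => ∑ j ∈ Finset.range (D + 1), Polynomial.C (qc j w) * Polynomial.X ^ j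
  have hQc : ∀ w n, (Qp w).coeff n = qc n w := by
    intro w n
    simp only [Qp, Polynomial.finsetSum_coeff, Polynomial.coeff_C_mul_X_pow]
    by_cases h : n < D + 1
    · simp [h]
    · rw [hqc0 n w (by omega)]; simp [h]
  let pc : ι → ℕ → E → ℂ := fun i l w => ∑ j ∈ Finset.range (l + 1), qc j w * a i (l - j) w
  have hpcd : ∀ i l, Differentiable ℂ (pc i l) := fun i l =>
    Differentiable.fun_sum fun j _ => (hqc j).mul (had _ _)
  let Pp : ι → E → Polynomial ℂ := fun i w =>
    ∑ l ∈ Finset.range (D + 1), Polynomial.C (pc i l w) * Polynomial.X ^ l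
  have hPc : ∀ i w n, (Pp i w).coeff n = pc i n w := by
    intro i w n
    simp only [Pp, Polynomial.finsetSum_coeff, Polynomial.coeff_C_mul_X_pow]
    by_cases h : n < D + 1
    · simp [h]
    · obtain ⟨l, rfl⟩ : ∃ l, n = D + 1 + l := ⟨n - (D + 1), by omega⟩
      have : pc i (D + 1 + l) w = 0 := hpade i l w
      rw [this]
      refine Finset.sum_eq_zero fun x hx => if_neg ?_
      rw [Finset.mem_range] at hx; omega
  have hmain : ∀ i w, ∀ t ∈ Vw w, (Qp w).eval t * φ i (t • w) = (Pp i w).eval t := by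
    intro i w t ht
    refine sub_eq_zero.1 (tc_zero (hVo w) (hVc w) (hV0 w)
      (g := fun t => (Qp w).eval t * φ i (t • w) - (Pp i w).eval t) ?_ ?_ t ht)
    · exact ((Qp w).differentiable.differentiableOn.mul (hgd i w)).sub (Pp i w).differentiable.differentiableOn
    · intro n
      have h1 : ContDiffAt ℂ n (fun t => (Qp w).eval t * φ i (t • w)) 0 :=
        ((Qp w).differentiable.analyticAt 0).contDiffAt.mul (hgan i w).contDiffAt
      have h2 : ContDiffAt ℂ n (fun t => (Pp i w).eval t) 0 := ((Pp i w).differentiable.analyticAt 0).contDiffAt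
      have h3 : tc n (fun t => (Qp w).eval t * φ i (t • w) - (Pp i w).eval t) =
          tc n (fun t => (Qp w).eval t * φ i (t • w)) - tc n (fun t => (Pp i w).eval t) := by
        rw [tc, tc, tc, ← sub_div, ← iteratedDeriv_fun_sub h1 h2]
      rw [h3, tc_mul _ _ (hgan i w).contDiffAt, tc_poly, hPc, sub_eq_zero]
      exact Finset.sum_congr rfl fun j _ => by rw [hQc, ha]
  have hQne : Qp w1 ≠ 0 := by
    intro h
    apply hjj
    ext j
    have := hQc w1 j
    rw [h, Polynomial.coeff_zero] at this
    rw [hqc1] at this; exact this.symm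
  obtain ⟨t1, ht1V, ht10, ht1Q⟩ : ∃ t ∈ Vw w1, t ≠ 0 ∧ (Qp w1).eval t ≠ 0 := by
    have h1 : ∀ᶠ t in 𝓝[≠] (0 : ℂ), t ∈ Vw w1 := mem_nhdsWithin_of_mem_nhds ((hVo w1).mem_nhds (hV0 w1))
    have h2 : ∀ᶠ t in 𝓝[≠] (0 : ℂ), t ≠ 0 := eventually_mem_nhdsWithin
    have h3 : ∀ᶠ t in 𝓝[≠] (0 : ℂ), (Qp w1).eval t ≠ 0 := by
      have hfin : ((Qp w1).roots.toFinset : Set ℂ).Finite := Finset.finite_toSet _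
      have := hfin.isClosed.isOpen_compl
      have h4 : ∀ᶠ t in 𝓝[≠] (0 : ℂ), t ∉ (((Qp w1).roots.toFinset : Set ℂ) \ {0}) :=
        mem_nhdsWithin_of_mem_nhds ((hfin.subset sdiff_subset).isClosed.isOpen_compl.mem_nhds (by simp))
      filter_upwards [h2, h4] with t ht ht4 he
      apply ht4
      refine ⟨?_, ht⟩
      simp [hQne, he]
    obtain ⟨t, h⟩ := (h1.and (h2.and h3)).exists
    exact ⟨t, h.1, h.2.1, h.2.2⟩
  refine ⟨fun i w => (Pp i (t1⁻¹ • w)).eval t1, fun w => (Qp (t1⁻¹ • w)).eval t1, ?_, ?_, ?_⟩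
  · intro i
    have : (fun w => (Pp i (t1⁻¹ • w)).eval t1) =
        fun w => ∑ l ∈ Finset.range (D + 1), pc i l (t1⁻¹ • w) * t1 ^ l := by
      ext w; simp [Pp, Polynomial.eval_finsetSum]
    change Differentiable ℂ (fun w => (Pp i (t1⁻¹ • w)).eval t1)
    rw [this]
    exact Differentiable.fun_sum fun l _ => ((hpcd i l).comp (by fun_prop)).mul_const _
  · intro i w hw
    have := hmain i (t1⁻¹ • w) t1 (by
      change t1 • t1⁻¹ • w ∈ Metric.ball (0 : E) ε
      rwa [smul_inv_smul₀ ht10])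
    rw [smul_inv_smul₀ ht10] at this
    exact this.symm
  · refine ⟨t1 • w1, ht1V, ?_⟩
    simp only [inv_smul_smul₀ ht10]
    exact ht1Q

end PartJ4

section PartJ5
open Set Topology Filter
variable {p m p' q' : ℕ} {f : Matrix (Fin p) (Fin (m + 1)) ℂ → Matrix (Fin p') (Fin q') ℂ}

/-- points through a slice -/
def ptI (x : Option ({Z // Z ∈ typeIDomain p m} × Fin p')) (w : (Fin m → ℂ) × (Fin p → ℂ)) :
    Matrix (Fin p) (Fin (m + 1)) ℂ :=
  match x with
  | none => sn 0 w.2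
  | some y => sn y.1.1 (w.2 - y.1.1 *ᵥ w.1)

theorem ptI_diff (x : Option ({Z // Z ∈ typeIDomain p m} × Fin p')) (s : Set ((Fin m → ℂ) × (Fin p → ℂ))) :
    DifferentiableOn ℂ (ptI x) s := by
  rcases x with _ | y
  · exact sn_diff (differentiableOn_const _) (by fun_prop)
  · exact sn_diff (differentiableOn_const _)
      (DifferentiableOn.sub (by fun_prop) (vec_diff (differentiableOn_const _) (by fun_prop)))

theorem ptI_zero (x : Option ({Z // Z ∈ typeIDomain p m} × Fin p')) : ptI x 0 ∈ typeIDomain p (m + 1) := by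
  rcases x with _ | y
  · exact sn_zero_mem.2 zero_mem_D
  · simp only [ptI, Prod.snd_zero, Prod.fst_zero, mulVec_zero, sub_zero]
    exact sn_zero_mem.2 y.1.2

theorem ptI_s1 (x : Option ({Z // Z ∈ typeIDomain p m} × Fin p')) (w : (Fin m → ℂ) × (Fin p → ℂ)) :
    ptI x w *ᵥ s1 w.1 = w.2 := by
  rcases x with _ | y <;> simp [ptI, sn_s1]

/-- rows of the local system -/
noncomputable def rwI (f : Matrix (Fin p) (Fin (m + 1)) ℂ → Matrix (Fin p') (Fin q') ℂ) (j0 : Fin q')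
    (x : Option ({Z // Z ∈ typeIDomain p m} × Fin p')) (w : (Fin m → ℂ) × (Fin p → ℂ)) : Fin q' → ℂ :=
  match x with
  | none => Pi.single j0 1
  | some y => fun j => f (ptI (some y) w) y.2 j - f (sn 0 w.2) y.2 j

theorem loc_sec (hf : PH p (m + 1) p' q' f) (hqp : q' < p) {c0 : Fin q' → ℂ} (hc0 : c0 ≠ 0)
    (hone : ∀ c, (∀ Z ∈ typeIDomain p m, ∀ Z' ∈ typeIDomain p m,
      f (sn Z 0) *ᵥ c = f (sn Z' 0) *ᵥ c) → ∃ k : ℂ, c = k • c0) :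
    ∃ (j0 : Fin q') (ε : ℝ) (c : (Fin m → ℂ) × (Fin p → ℂ) → Fin q' → ℂ), 0 < ε ∧
      DifferentiableOn ℂ c (Metric.ball 0 ε) ∧ ∀ w ∈ Metric.ball (0 : (Fin m → ℂ) × (Fin p → ℂ)) ε,
        c w j0 = 1 ∧ sn 0 w.2 ∈ typeIDomain p (m + 1) ∧
        (∀ Z ∈ typeIDomain p (m + 1), Z *ᵥ s1 w.1 = w.2 → f Z *ᵥ c w = f (sn 0 w.2) *ᵥ c w) ∧
        ∀ c', (∀ Z ∈ typeIDomain p (m + 1), Z *ᵥ s1 w.1 = w.2 → f Z *ᵥ c' = f (sn 0 w.2) *ᵥ c') →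
          c' = c' j0 • c w := by
  obtain ⟨j0, hj0⟩ : ∃ j, c0 j ≠ 0 := by
    by_contra h; push Not at h; exact hc0 (funext h)
  obtain ⟨r, hr⟩ := rows_lemma (fun x => rwI f j0 x (0 : (Fin m → ℂ) × (Fin p → ℂ))) (by
    intro c hc
    have h1 : ∀ Z ∈ typeIDomain p m, f (sn Z 0) *ᵥ c = f (sn 0 0) *ᵥ c := by
      intro Z hZ
      ext i
      have := hc (some (⟨Z, hZ⟩, i))
      simp only [rwI, ptI, Prod.snd_zero, Prod.fst_zero, mulVec_zero, sub_zero, dotProduct, sub_mul,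
        Finset.sum_sub_distrib] at this
      exact sub_eq_zero.1 this
    obtain ⟨k, rfl⟩ := hone c fun Z hZ Z' hZ' => (h1 Z hZ).trans (h1 Z' hZ').symm
    have := hc none
    simp only [rwI, single_one_dotProduct, Pi.smul_apply, smul_eq_mul] at this
    rw [(mul_eq_zero.1 this).resolve_right hj0, zero_smul])
  let M : (Fin m → ℂ) × (Fin p → ℂ) → Matrix (Fin q') (Fin q') ℂ :=
    fun w => Matrix.of fun k => rwI f j0 (r k) w
  have hM : ∀ w k, M w k = rwI f j0 (r k) w := fun _ _ => rfl
  let U0 : Set ((Fin m → ℂ) × (Fin p → ℂ)) := {w | ptI (p' := p') none w ∈ typeIDomain p (m + 1) ∧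
    ∀ k, ptI (r k) w ∈ typeIDomain p (m + 1)}
  have hU0 : IsOpen U0 := by
    have hc : ∀ x : Option ({Z // Z ∈ typeIDomain p m} × Fin p'), IsOpen {w | ptI x w ∈ typeIDomain p (m + 1)} :=
      fun x => isOpen_D.preimage (continuousOn_univ.1 (ptI_diff x univ).continuousOn)
    have : U0 = {w | ptI (p' := p') none w ∈ typeIDomain p (m + 1)} ∩
        ⋂ k, {w | ptI (r k) w ∈ typeIDomain p (m + 1)} := by
      ext w; simp [U0]
    rw [this]
    exact (hc _).inter (isOpen_iInter_of_finite fun k => hc _)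
  have h00 : (0 : (Fin m → ℂ) × (Fin p → ℂ)) ∈ U0 := ⟨ptI_zero _, fun k => ptI_zero _⟩
  have hMd : ∀ i j, DifferentiableOn ℂ (fun w => M w i j) U0 := by
    intro i j
    simp only [hM]
    have h0 : DifferentiableOn ℂ (fun w => f (ptI (p' := p') none w)) U0 :=
      hf.diff.comp (ptI_diff _ _) fun w hw => hw.1
    have h1 : DifferentiableOn ℂ (fun w => f (ptI (r i) w)) U0 :=
      hf.diff.comp (ptI_diff _ _) fun w hw => hw.2 i
    rcases hri : r i with _ | y
    · exact differentiableOn_const _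
    · rw [hri] at h1
      exact (matrix_diff.1 h1 y.2 j).sub (matrix_diff.1 h0 y.2 j)
  have hdd := det_diff hMd
  have hU : IsOpen (U0 ∩ (fun w => (M w).det) ⁻¹' {0}ᶜ) :=
    hdd.continuousOn.isOpen_inter_preimage hU0 isOpen_compl_singleton
  obtain ⟨ε, hε, hεU⟩ := Metric.isOpen_iff.1 hU 0 ⟨h00, hr⟩
  let u : Fin q' → ℂ := fun k => match r k with
    | none => 1
    | some _ => 0
  let c : (Fin m → ℂ) × (Fin p → ℂ) → Fin q' → ℂ := fun w => ((M w).det)⁻¹ • ((M w).adjugate *ᵥ u)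
  have hinv : ∀ w, (M w).det ≠ 0 → ∀ v (k : ℂ), M w *ᵥ v = k • u → v = k • c w := by
    intro w hw v k hv
    have h1 : (M w).adjugate *ᵥ (M w *ᵥ v) = (M w).det • v := by
      rw [mulVec_mulVec, adjugate_mul, smul_mulVec, one_mulVec]
    rw [hv, mulVec_smul] at h1
    simp only [c]
    rw [smul_comm, h1, inv_smul_smul₀ hw]
  have huniq : ∀ w ∈ U0, (M w).det ≠ 0 → ∀ c', (∀ Z ∈ typeIDomain p (m + 1), Z *ᵥ s1 w.1 = w.2 →
      f Z *ᵥ c' = f (sn 0 w.2) *ᵥ c') → c' = c' j0 • c w := by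
    intro w hw hwd c' hc'
    refine hinv w hwd c' _ ?_
    ext k
    change M w k ⬝ᵥ c' = c' j0 * u k
    rw [hM]
    have h2 := hc' _ (hw.2 k) (ptI_s1 _ _)
    simp only [u]
    rcases hri : r k with _ | y
    · simp [rwI]
    · rw [hri] at h2
      simp only [rwI, dotProduct, sub_mul, Finset.sum_sub_distrib, mul_zero]
      exact sub_eq_zero.2 (congrFun h2 y.2)
  refine ⟨j0, ε, c, hε, ?_, fun w hw => ?_⟩
  · have h1 : DifferentiableOn ℂ c (U0 ∩ (fun w => (M w).det) ⁻¹' {0}ᶜ) := by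
      refine DifferentiableOn.smul (DifferentiableOn.inv (hdd.mono inter_subset_left) fun w hw => hw.2) ?_
      exact (vec_diff (matrix_diff.2 fun i j => adj_diff hMd i j) (differentiableOn_const _)).mono inter_subset_left
    exact h1.mono hεU
  · obtain ⟨hwU, hwd⟩ := hεU hw
    have hwd' : (M w).det ≠ 0 := hwd
    have hs := hwU.1
    have hlt : nsq w.2 < nsq (s1 w.1) := by
      have h1 := mem_D.1 hs (s1 w.1) (by
        intro h
        have := nsq_s1 w.1
        rw [h, nsq_zero] at this
        have := nsq_nonneg w.1
        linarith)
      rwa [ptI_s1] at h1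
    obtain ⟨c', d', hcd, hc'⟩ := part_i hf hqp _ _ hlt
    have hc'2 : ∀ Z ∈ typeIDomain p (m + 1), Z *ᵥ s1 w.1 = w.2 → f Z *ᵥ c' = f (sn 0 w.2) *ᵥ c' := by
      intro Z hZ hZw
      rw [hc' Z hZ hZw]
      exact (hc' _ hs (ptI_s1 _ _)).symm
    have hcc := huniq w hwU hwd' c' hc'2
    have hne : c' j0 ≠ 0 := by
      intro h
      rw [h, zero_smul] at hcc
      rw [hcc, nsq_zero] at hcd
      exact absurd hcd (not_lt.2 (nsq_nonneg _))
    have hcw : c w = (c' j0)⁻¹ • c' := by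
      conv_rhs => rw [hcc]
      rw [Pi.smul_apply, smul_smul]
      have : c' j0 = c' j0 * c w j0 := by
        conv_lhs => rw [hcc]
        simp
      rw [smul_eq_mul, ← this, inv_mul_cancel₀ hne, one_smul]
    refine ⟨?_, hs, ?_, huniq w hwU hwd'⟩
    · rw [hcw]; simp [hne]
    · intro Z hZ hZw
      rw [hcw, mulVec_smul, mulVec_smul, hc'2 Z hZ hZw]

end PartJ5

section PartJ6
open Set Topology Filter

theorem poly_ev_ne {Q : Polynomial ℂ} (hQ : Q ≠ 0) : ∀ᶠ t in 𝓝[≠] (0 : ℂ), Q.eval t ≠ 0 := by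
  have h2 : ∀ᶠ t in 𝓝[≠] (0 : ℂ), t ≠ 0 := eventually_mem_nhdsWithin
  have hfin : (Q.roots.toFinset : Set ℂ).Finite := Finset.finite_toSet _
  have h4 : ∀ᶠ t in 𝓝[≠] (0 : ℂ), t ∉ ((Q.roots.toFinset : Set ℂ) \ {0}) :=
    mem_nhdsWithin_of_mem_nhds ((hfin.subset sdiff_subset).isClosed.isOpen_compl.mem_nhds (by simp))
  filter_upwards [h2, h4] with t ht ht4 he
  apply ht4
  refine ⟨?_, ht⟩
  simp [hQ, he]

theorem multi_poly {V W : Type} [NormedAddCommGroup V] [NormedSpace ℂ V] [NormedAddCommGroup W]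
    [NormedSpace ℂ W] {n : ℕ} (M : ContinuousMultilinearMap ℂ (fun _ : Fin n => V) W) (L : W →L[ℂ] ℂ) (a b : V) :
    ∃ P : Polynomial ℂ, P.natDegree ≤ n ∧ ∀ t : ℂ, L (M fun _ => a + t • b) = P.eval t := by
  classical
  refine ⟨∑ s : Finset (Fin n), Polynomial.C (L (M (s.piecewise (fun _ => a) fun _ => b))) *
    Polynomial.X ^ (sᶜ.card), ?_, ?_⟩
  · refine Polynomial.natDegree_sum_le_of_forall_le _ _ fun s _ => ?_
    refine (Polynomial.natDegree_C_mul_X_pow_le _ _).trans ?_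
    simpa using Finset.card_le_univ sᶜ
  · intro t
    have h1 : (fun _ : Fin n => a + t • b) = (fun _ => a) + fun _ => t • b := rfl
    rw [h1, M.map_add_univ, map_sum, Polynomial.eval_finsetSum]
    refine Finset.sum_congr rfl fun s _ => ?_
    have h2 : s.piecewise (fun _ : Fin n => a) (fun _ => t • b) =
        sᶜ.piecewise (fun i => t • (s.piecewise (fun _ : Fin n => a) (fun _ => b)) i)
          (s.piecewise (fun _ : Fin n => a) (fun _ => b)) := by
      ext i
      by_cases hi : i ∈ s <;> simp [hi]
    have h3 := M.toMultilinearMap.map_piecewise_smul (fun _ => t)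
      (s.piecewise (fun _ : Fin n => a) (fun _ => b)) sᶜ
    rw [h2]
    simp only [ContinuousMultilinearMap.coe_coe] at h3
    rw [h3, map_smul, Finset.prod_const, smul_eq_mul]
    simp only [Polynomial.eval_mul, Polynomial.eval_C, Polynomial.eval_pow, Polynomial.eval_X]
    exact mul_comm _ _

theorem cmm_ev {V W : Type} [NormedAddCommGroup V] [NormedSpace ℂ V] [NormedAddCommGroup W]
    [NormedSpace ℂ W] (n : ℕ) : Continuous fun x : ContinuousMultilinearMap ℂ (fun _ : Fin n => V) W × (Fin n → V) =>
      x.1 x.2 := by fun_prop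

theorem dir_const {E F : Type} [NormedAddCommGroup E] [NormedSpace ℂ E]
    [NormedAddCommGroup F] [NormedSpace ℂ F] [FiniteDimensional ℂ E] [FiniteDimensional ℂ F]
    {U : Set E} (hU : IsOpen U) {f : E → F} (hf : DifferentiableOn ℂ f U)
    (L : F →L[ℂ] ℂ) {z X : E} (hz : z ∈ U) {κ : ℂ} (h : ∀ᶠ s in 𝓝 (0 : ℂ), L (f (z + s • X)) = κ) (k : ℕ) :
    L ((Dir X)^[k + 1] f z) = 0 := by
  have hU' : ∀ᶠ s in 𝓝 (0 : ℂ), z + s • X ∈ U :=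
    (by fun_prop : Continuous fun s : ℂ => z + s • X).continuousAt.eventually (hU.mem_nhds (by simpa using hz))
  have step : ∀ k, (∃ κ, ∀ᶠ s in 𝓝 (0 : ℂ), L ((Dir X)^[k] f (z + s • X)) = κ) →
      ∀ᶠ s in 𝓝 (0 : ℂ), L ((Dir X)^[k + 1] f (z + s • X)) = 0 := by
    rintro k ⟨κ, hκ⟩
    filter_upwards [hκ.eventually_nhds, hU'] with s hs hsU
    have hd := deriv_line (((holo_Dir_iter hU hf X k) _ hsU).differentiableAt (hU.mem_nhds hsU))
    have hd2 := (L.hasFDerivAt.comp_hasDerivAt s hd)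
    have hd3 : HasDerivAt (L ∘ fun s : ℂ => (Dir X)^[k] f (z + s • X)) 0 s :=
      (hasDerivAt_const s κ).congr_of_eventuallyEq hs
    rw [Function.iterate_succ_apply']
    exact hd2.unique hd3
  have all : ∀ k, ∀ᶠ s in 𝓝 (0 : ℂ), L ((Dir X)^[k + 1] f (z + s • X)) = 0 := by
    intro k
    induction k with
    | zero => exact step 0 ⟨κ, h⟩
    | succ k ih => exact step (k + 1) ⟨0, ih⟩
  have := (all k).self_of_nhds
  simpa using this

/-- functions polynomial in the last variable -/
def polySub {X : Type} [TopologicalSpace X] (O : Set X) : Subring (X × ℂ → ℂ) where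
  carrier := {F | (∀ t, ContinuousOn (fun w => F (w, t)) O) ∧ ∃ n : ℕ, ∀ w ∈ O, ∃ P : Polynomial ℂ,
    P.natDegree ≤ n ∧ ∀ t, F (w, t) = P.eval t}
  mul_mem' := by
    rintro F G ⟨hF, n, hn⟩ ⟨hG, k, hk⟩
    refine ⟨fun t => (hF t).mul (hG t), n + k, fun w hw => ?_⟩
    obtain ⟨P, hP, hP'⟩ := hn w hw
    obtain ⟨Q, hQ, hQ'⟩ := hk w hw
    exact ⟨P * Q, Polynomial.natDegree_mul_le.trans (by omega), fun t => by simp [hP', hQ']⟩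
  one_mem' := ⟨fun t => continuousOn_const, 0, fun w _ => ⟨1, by simp, by simp⟩⟩
  add_mem' := by
    rintro F G ⟨hF, n, hn⟩ ⟨hG, k, hk⟩
    refine ⟨fun t => (hF t).add (hG t), max n k, fun w hw => ?_⟩
    obtain ⟨P, hP, hP'⟩ := hn w hw
    obtain ⟨Q, hQ, hQ'⟩ := hk w hw
    exact ⟨P + Q, (Polynomial.natDegree_add_le _ _).trans (by omega), fun t => by simp [hP', hQ']⟩
  zero_mem' := ⟨fun t => continuousOn_const, 0, fun w _ => ⟨0, by simp, by simp⟩⟩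
  neg_mem' := by
    rintro F ⟨hF, n, hn⟩
    refine ⟨fun t => (hF t).neg, n, fun w hw => ?_⟩
    obtain ⟨P, hP, hP'⟩ := hn w hw
    exact ⟨-P, by simpa using hP, fun t => by simp [hP']⟩

variable {p m p' q' : ℕ} {f : Matrix (Fin p) (Fin (m + 1)) ℂ → Matrix (Fin p') (Fin q') ℂ}

/-- row-dot functional -/
noncomputable def rdL (i : Fin p') (c : Fin q' → ℂ) : Matrix (Fin p') (Fin q') ℂ →L[ℂ] ℂ :=
  LinearMap.toContinuousLinearMap
    { toFun := fun A => (A *ᵥ c) i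
      map_add' := fun u v => by simp [add_mulVec]
      map_smul' := fun a v => by simp [smul_mulVec] }

theorem rdL_apply (i : Fin p') (c : Fin q' → ℂ) (A : Matrix (Fin p') (Fin q') ℂ) :
    rdL i c A = (A *ᵥ c) i := rfl

/-- base point -/
noncomputable def Zw (i0 : Fin m) (w : (Fin m → ℂ) × (Fin p → ℂ)) : Matrix (Fin p) (Fin (m + 1)) ℂ :=
  sn (vecMulVec w.2 (Pi.single i0 (w.1 i0)⁻¹)) 0

/-- cone -/
def Ow (p : ℕ) (i0 : Fin m) : Set ((Fin m → ℂ) × (Fin p → ℂ)) := {w | nsq w.2 < ‖w.1 i0‖ ^ 2}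

theorem Ow_open (i0 : Fin m) : IsOpen (Ow p i0) :=
  isOpen_lt (continuous_nsq.comp continuous_snd) (by fun_prop)

theorem Ow_ne {i0 : Fin m} {w : (Fin m → ℂ) × (Fin p → ℂ)} (hw : w ∈ Ow p i0) : w.1 i0 ≠ 0 := by
  intro h
  have h1 : nsq w.2 < ‖w.1 i0‖ ^ 2 := hw
  rw [h] at h1
  have := nsq_nonneg w.2
  simp at h1
  linarith

theorem vMV (i0 : Fin m) (u : Fin p → ℂ) (x : ℂ) (v : Fin m → ℂ) :
    vecMulVec u (Pi.single i0 x) *ᵥ v = (x * v i0) • u := by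
  ext i
  simp [mulVec, dotProduct, vecMulVec_apply, Pi.single_apply]
  ring

theorem Zw_mem {i0 : Fin m} {w : (Fin m → ℂ) × (Fin p → ℂ)} (hw : w ∈ Ow p i0) :
    Zw i0 w ∈ typeIDomain p (m + 1) := by
  refine sn_zero_mem.2 (mem_D.2 fun v hv => ?_)
  have hne := Ow_ne hw
  have h1 : nsq w.2 < ‖w.1 i0‖ ^ 2 := hw
  have hp : 0 < ‖w.1 i0‖ ^ 2 := by positivity
  have h2 := nsq_pos hv
  have h3 := norm_le_sqrt_nsq v i0
  rw [vMV, nsq_smul, norm_mul, mul_pow, norm_inv, inv_pow]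
  by_cases h4 : v i0 = 0
  · rw [h4]; simpa using h2
  · have h5 : 0 < ‖v i0‖ ^ 2 := by positivity
    calc (‖w.1 i0‖ ^ 2)⁻¹ * ‖v i0‖ ^ 2 * nsq w.2 < (‖w.1 i0‖ ^ 2)⁻¹ * ‖v i0‖ ^ 2 * ‖w.1 i0‖ ^ 2 :=
          mul_lt_mul_of_pos_left h1 (by positivity)
      _ = ‖v i0‖ ^ 2 := by field_simp
      _ ≤ nsq v := h3

theorem Zw_s1 {i0 : Fin m} {w : (Fin m → ℂ) × (Fin p → ℂ)} (hw : w ∈ Ow p i0) (t : ℂ) :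
    Zw i0 w *ᵥ s1 (t • w.1) = t • w.2 := by
  have hne := Ow_ne hw
  rw [Zw, sn_s1, vMV, add_zero, Pi.smul_apply, smul_eq_mul]
  congr 1
  field_simp

theorem Zw_cont (i0 : Fin m) : ContinuousOn (Zw (p := p) i0) (Ow p i0) := by
  have h1 : ContinuousOn (fun w : (Fin m → ℂ) × (Fin p → ℂ) => vecMulVec w.2 (Pi.single i0 (w.1 i0)⁻¹)) (Ow p i0) := by
    refine continuousOn_pi.2 fun i => continuousOn_pi.2 fun j => ?_
    simp only [vecMulVec_apply, Pi.single_apply]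
    by_cases hj : j = i0
    · simp only [hj, if_true]
      exact ContinuousOn.mul (by fun_prop) (ContinuousOn.inv₀ (by fun_prop) fun w hw => Ow_ne hw)
    · simp only [hj, if_false]
      fun_prop
  exact (snL p m).continuous.comp_continuousOn (h1.prodMk continuousOn_const)

/-- directions -/
def Xd (Y : Matrix (Fin p) (Fin m) ℂ) (w : (Fin m → ℂ) × (Fin p → ℂ)) (t : ℂ) :
    Matrix (Fin p) (Fin (m + 1)) ℂ := sn Y 0 + t • sn 0 (-(Y *ᵥ w.1))

theorem Xd_s1 (Y : Matrix (Fin p) (Fin m) ℂ) (w : (Fin m → ℂ) × (Fin p → ℂ)) (t : ℂ) :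
    Xd Y w t *ᵥ s1 (t • w.1) = 0 := by
  rw [Xd, add_mulVec, smul_mulVec, sn_s1, sn_s1]
  simp [mulVec_smul]

theorem eq_Xd {X : Matrix (Fin p) (Fin (m + 1)) ℂ} {w : (Fin m → ℂ) × (Fin p → ℂ)} {t : ℂ}
    (h : X *ᵥ s1 (t • w.1) = 0) : X = Xd (dr X) w t := by
  rw [← sn_dr X, sn_s1, mulVec_smul] at h
  have h2 : (fun i => X i (Fin.last m)) = t • (-(dr X *ᵥ w.1)) := by
    rw [smul_neg]; exact eq_neg_of_add_eq_zero_right h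
  conv_lhs => rw [← sn_dr X, h2]
  rw [Xd, sn_eq, sn_eq, sn_eq, ← map_smul, ← map_add]
  simp

/-- derivative rows -/
noncomputable def rwD (f : Matrix (Fin p) (Fin (m + 1)) ℂ → Matrix (Fin p') (Fin q') ℂ) (i0 : Fin m)
    (x : ℕ × Matrix (Fin p) (Fin m) ℂ × Fin p') (y : ((Fin m → ℂ) × (Fin p → ℂ)) × ℂ) : Fin q' → ℂ :=
  fun j => (iteratedFDeriv ℂ (x.1 + 1) f (Zw i0 y.1) (fun _ => Xd x.2.1 y.1 y.2)) x.2.2 j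

theorem rwD_mem (hf : PH p (m + 1) p' q' f) (i0 : Fin m) (x : ℕ × Matrix (Fin p) (Fin m) ℂ × Fin p') (j : Fin q') :
    (fun y => rwD f i0 x y j) ∈ polySub (Ow p i0) := by
  refine ⟨fun t => ?_, x.1 + 1, fun w hw => ?_⟩
  · have h1 : ContinuousOn (iteratedFDeriv ℂ (x.1 + 1) f) (typeIDomain p (m + 1)) := by
      have h2 := (holo_contDiffOn isOpen_D (x.1 + 1) hf.diff).continuousOn_iteratedFDerivWithin
        (m := x.1 + 1) le_rfl isOpen_D.uniqueDiffOn
      exact h2.congr fun z hz => (iteratedFDerivWithin_of_isOpen _ isOpen_D hz).symm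
    have h3 : ContinuousOn (fun w => iteratedFDeriv ℂ (x.1 + 1) f (Zw i0 w)) (Ow p i0) :=
      h1.comp (Zw_cont i0) fun w hw => Zw_mem hw
    have h4 : Continuous fun w : (Fin m → ℂ) × (Fin p → ℂ) => Xd x.2.1 w t := by
      refine continuous_const.add (Continuous.const_smul (sn_cont continuous_const ?_) t)
      exact (Continuous.matrix_mulVec continuous_const continuous_fst).neg
    have h5 : ContinuousOn (fun w => iteratedFDeriv ℂ (x.1 + 1) f (Zw i0 w) (fun _ => Xd x.2.1 w t)) (Ow p i0) := by
      exact (cmm_ev (V := Matrix (Fin p) (Fin (m + 1)) ℂ) (W := Matrix (Fin p') (Fin q') ℂ) (x.1 + 1)).comp_continuousOn (h3.prodMk (continuous_pi fun _ => h4).continuousOn)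
    exact (continuous_apply j).comp_continuousOn ((continuous_apply x.2.2).comp_continuousOn h5)
  · obtain ⟨P, hP, hP2⟩ := multi_poly (iteratedFDeriv ℂ (x.1 + 1) f (Zw i0 w)) (rdL x.2.2 (Pi.single j 1))
      (sn x.2.1 0) (sn 0 (-(x.2.1 *ᵥ w.1)))
    refine ⟨P, hP, fun t => ?_⟩
    refine Eq.trans ?_ (hP2 t)
    refine Eq.trans ?_ (rdL_apply _ _ _).symm
    rw [mulVec_single_one]
    rfl

theorem rwD_ker (hf : PH p (m + 1) p' q' f) {i0 : Fin m} {w : (Fin m → ℂ) × (Fin p → ℂ)} (hw : w ∈ Ow p i0)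
    (t : ℂ) (c : Fin q' → ℂ) : (∀ x, rwD f i0 x (w, t) ⬝ᵥ c = 0) ↔
      ∀ Z ∈ typeIDomain p (m + 1), Z *ᵥ s1 (t • w.1) = t • w.2 → f Z *ᵥ c = f (Zw i0 w) *ᵥ c := by
  have key : ∀ k Y i, rwD f i0 (k, Y, i) (w, t) ⬝ᵥ c = rdL i c ((Dir (Xd Y w t))^[k + 1] f (Zw i0 w)) := by
    intro k Y i
    rw [← iteratedFDeriv_eq_Dir isOpen_D hf.diff _ _ _ (Zw_mem hw)]
    rfl
  constructor
  · intro h Z hZ hZt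
    have hX : (Z - Zw i0 w) *ᵥ s1 (t • w.1) = 0 := by rw [sub_mulVec, hZt, Zw_s1 hw, sub_self]
    ext i
    refine const_line isOpen_D convex_D hf.diff (rdL i c) (Zw_mem hw) hZ fun k => ?_
    rw [eq_Xd hX]
    exact (key _ _ _).symm.trans (h _)
  · rintro h ⟨k, Y, i⟩
    refine (key _ _ _).trans ?_
    refine dir_const isOpen_D hf.diff _ (Zw_mem hw) (κ := (f (Zw i0 w) *ᵥ c) i) ?_ k
    have hU' : ∀ᶠ s in 𝓝 (0 : ℂ), Zw i0 w + s • Xd Y w t ∈ typeIDomain p (m + 1) :=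
      (by fun_prop : Continuous fun s : ℂ => Zw i0 w + s • Xd Y w t).continuousAt.eventually
        (isOpen_D.mem_nhds (by simpa using Zw_mem hw))
    filter_upwards [hU'] with s hs
    refine (rdL_apply _ _ _).trans (congrFun (h _ hs ?_) i)
    rw [add_mulVec, smul_mulVec, Xd_s1, Zw_s1 hw, smul_zero, add_zero]

end PartJ6

section PartJ7
open Set Topology Filter

variable {p m p' q' : ℕ} {f : Matrix (Fin p) (Fin (m + 1)) ℂ → Matrix (Fin p') (Fin q') ℂ}

theorem rat_lines (hf : PH p (m + 1) p' q' f) (i0 : Fin m) {j0 : Fin q'} {ε : ℝ}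
    {c : (Fin m → ℂ) × (Fin p → ℂ) → Fin q' → ℂ} (hε : 0 < ε)
    (hc : ∀ w ∈ Metric.ball (0 : (Fin m → ℂ) × (Fin p → ℂ)) ε,
        c w j0 = 1 ∧ sn 0 w.2 ∈ typeIDomain p (m + 1) ∧
        (∀ Z ∈ typeIDomain p (m + 1), Z *ᵥ s1 w.1 = w.2 → f Z *ᵥ c w = f (sn 0 w.2) *ᵥ c w) ∧
        ∀ c', (∀ Z ∈ typeIDomain p (m + 1), Z *ᵥ s1 w.1 = w.2 → f Z *ᵥ c' = f (sn 0 w.2) *ᵥ c') →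
          c' = c' j0 • c w) :
    ∃ (D : ℕ) (O : Set ((Fin m → ℂ) × (Fin p → ℂ))), IsOpen O ∧ O.Nonempty ∧ ∀ w ∈ O,
      ∃ Q : Polynomial ℂ, Q ≠ 0 ∧ Q.natDegree ≤ D ∧
        (∀ i, ∃ P : Polynomial ℂ, P.natDegree ≤ D ∧ ∀ᶠ t in 𝓝[≠] (0 : ℂ), Q.eval t * c (t • w) i = P.eval t) ∧
        (∀ i, ∃ P : Polynomial ℂ, P.natDegree ≤ D ∧ ∀ᶠ t in 𝓝[≠] (0 : ℂ),
          Q.eval t * (f (sn 0 (t • w).2) *ᵥ c (t • w)) i = P.eval t) := by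
  have hOw : (Ow p i0).Nonempty := ⟨(Pi.single i0 1, 0), by
    change nsq (0 : Fin p → ℂ) < _
    rw [nsq_zero]; simp⟩
  obtain ⟨ρ, r, s, ⟨⟨w0, t0⟩, ⟨hw0, -⟩, hdet0⟩, hker⟩ := ker_lemma (rwD f i0) (Ow p i0 ×ˢ (univ : Set ℂ))
    (hOw.prod univ_nonempty)
  have hball : ∀ w : (Fin m → ℂ) × (Fin p → ℂ), ∀ᶠ t in 𝓝[≠] (0 : ℂ), t • w ∈ Metric.ball (0 : (Fin m → ℂ) × (Fin p → ℂ)) ε := by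
    intro w
    refine mem_nhdsWithin_of_mem_nhds ?_
    exact (by fun_prop : Continuous fun t : ℂ => t • w).continuousAt (Metric.isOpen_ball.mem_nhds (by simpa using hε))
  obtain ⟨hdc, nd, hdp⟩ := kB_mem (polySub (Ow p i0)) (rwD f i0) (fun i j => rwD_mem hf i0 i j) r s
  have hqm := kq_mem (polySub (Ow p i0)) (rwD f i0) (fun i j => rwD_mem hf i0 i j) r s
  have hdet : ∀ w ∈ Ow p i0, (kB (rwD f i0) r s (w, t0)).det ≠ 0 →
      ∀ᶠ t in 𝓝[≠] (0 : ℂ), (kB (rwD f i0) r s (w, t)).det ≠ 0 := by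
    intro w hw h
    obtain ⟨P, -, hP⟩ := hdp w hw
    have hP0 : P ≠ 0 := by
      rintro rfl
      have := hP t0
      simp only [Polynomial.eval_zero] at this
      exact h this
    filter_upwards [poly_ev_ne hP0] with t ht
    rw [← hP t] at ht
    exact ht
  have hsame : ∀ w ∈ Ow p i0, ∀ t : ℂ, t • w ∈ Metric.ball (0 : (Fin m → ℂ) × (Fin p → ℂ)) ε →
      f (sn 0 (t • w).2) *ᵥ c (t • w) = f (Zw i0 w) *ᵥ c (t • w) := by
    intro w hw t htw
    exact ((hc _ htw).2.2.1 _ (Zw_mem hw) (Zw_s1 hw t)).symm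
  have hprop : ∀ w ∈ Ow p i0, ∀ t : ℂ, t • w ∈ Metric.ball (0 : (Fin m → ℂ) × (Fin p → ℂ)) ε →
      (kB (rwD f i0) r s (w, t)).det ≠ 0 → ∀ j,
      kq (rwD f i0) r s j (w, t) = kq (rwD f i0) r s j (w, t) j0 • c (t • w) := by
    intro w hw t htw hd j
    have h1 := (rwD_ker hf hw t _).1 fun x => hker (w, t) ⟨hw, mem_univ _⟩ hd x j
    refine (hc _ htw).2.2.2 _ fun Z hZ hZt => ?_
    have h2 := h1 Z hZ hZt
    have h3 := h1 _ (hc _ htw).2.1 (by rw [sn_s1]; simp)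
    rw [h2, h3]
  obtain ⟨t1, ht1, hd1⟩ := ((hball w0).and (hdet w0 hw0 hdet0)).exists
  obtain ⟨jj, hjj⟩ : ∃ jj, kq (rwD f i0) r s jj (w0, t1) j0 ≠ 0 := by
    by_contra hcon
    push Not at hcon
    have h1 := kq_span (rwD f i0) r s (w0, t1) (c (t1 • w0)) ((rwD_ker hf hw0 t1 _).2 fun Z hZ hZt => by
      rw [← hsame w0 hw0 t1 ht1]
      exact (hc _ ht1).2.2.1 Z hZ hZt)
    have h2 := congrFun h1 j0
    rw [Pi.smul_apply, (hc _ ht1).1, Finset.sum_apply] at h2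
    simp only [Pi.smul_apply, hcon, smul_eq_mul, mul_one, mul_zero, Finset.sum_const_zero] at h2
    exact hd1 h2
  have hdeg := fun i => (hqm jj i).2
  choose nn hnn using hdeg
  refine ⟨∑ i, nn i, (Ow p i0 ∩ (fun w => (kB (rwD f i0) r s (w, t0)).det) ⁻¹' {0}ᶜ) ∩
    (Ow p i0 ∩ (fun w => kq (rwD f i0) r s jj (w, t1) j0) ⁻¹' {0}ᶜ),
    ((hdc t0).isOpen_inter_preimage (Ow_open i0) isOpen_compl_singleton).inter
      (((hqm jj j0).1 t1).isOpen_inter_preimage (Ow_open i0) isOpen_compl_singleton),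
    ⟨w0, ⟨hw0, hdet0⟩, ⟨hw0, hjj⟩⟩, ?_⟩
  rintro w ⟨⟨hw, hwd⟩, ⟨-, hwk⟩⟩
  have hPP := fun i => hnn i w hw
  choose P hPd hPe using hPP
  have hle : ∀ i, (P i).natDegree ≤ ∑ i, nn i := fun i =>
    (hPd i).trans (Finset.single_le_sum (f := nn) (fun _ _ => Nat.zero_le _) (Finset.mem_univ i))
  have hev := (hball w).and (hdet w hw hwd)
  refine ⟨P j0, ?_, hle j0, fun i => ⟨P i, hle i, ?_⟩, fun i => ⟨∑ j, Polynomial.C (f (Zw i0 w) i j) * P j, ?_, ?_⟩⟩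
  · intro h0
    have := hPe j0 t1
    rw [h0, Polynomial.eval_zero] at this
    exact hwk this
  · filter_upwards [hev] with t ht
    rw [← hPe j0 t, ← hPe i t]
    exact (congrFun (hprop w hw t ht.1 ht.2 jj) i).symm
  · exact Polynomial.natDegree_sum_le_of_forall_le _ _ fun j _ =>
      (Polynomial.natDegree_C_mul_le _ _).trans (hle j)
  · filter_upwards [hev] with t ht
    rw [hsame w hw t ht.1, Polynomial.eval_finsetSum, mulVec, dotProduct, Finset.mul_sum]
    refine Finset.sum_congr rfl fun j _ => ?_
    rw [Polynomial.eval_mul, Polynomial.eval_C, ← hPe j0 t, ← hPe j t]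
    have := congrFun (hprop w hw t ht.1 ht.2 jj) j
    simp only [Pi.smul_apply, smul_eq_mul] at this
    simp only
    rw [this]
    ring

theorem holo_ident_prod {E G F : Type} [NormedAddCommGroup E] [NormedSpace ℂ E] [NormedAddCommGroup G]
    [NormedSpace ℂ G] [NormedAddCommGroup F] [NormedSpace ℂ F] [CompleteSpace F] {U : Set E} (hU : IsOpen U)
    (hc : Convex ℝ U) {f : E × G → F} (hf : DifferentiableOn ℂ f (U ×ˢ univ)) {z₀ : E} (hz₀ : z₀ ∈ U)
    (y₀ : G) (h0 : f =ᶠ[𝓝 (z₀, y₀)] 0) : ∀ z ∈ U, ∀ y, f (z, y) = 0 := fun z hz y =>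
  holo_ident (hU.prod isOpen_univ) (hc.prod convex_univ) hf (z₀ := (z₀, y₀)) ⟨hz₀, mem_univ _⟩ h0 (z, y) ⟨hz, mem_univ _⟩

theorem s1_diff : Differentiable ℂ (s1 (m := m)) := by
  refine differentiable_pi.2 fun i => ?_
  induction i using Fin.lastCases with
  | last => simp [s1]
  | cast i => simpa [s1] using differentiable_apply i

theorem r4 (hf : PH p (m + 1) p' q' f) (hqp : q' < p) (hm : 0 < m) {c0 : Fin q' → ℂ} (hc0 : c0 ≠ 0)
    (hone : ∀ c, (∀ Z ∈ typeIDomain p m, ∀ Z' ∈ typeIDomain p m,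
      f (sn Z 0) *ᵥ c = f (sn Z' 0) *ᵥ c) → ∃ k : ℂ, c = k • c0) : p ≤ p' := by
  obtain ⟨j0, ε, c, hε, hcd, hc⟩ := loc_sec hf hqp hc0 hone
  obtain ⟨D, O, hO, hOn, hQ⟩ := rat_lines hf ⟨0, hm⟩ hε hc
  let φ : Fin q' ⊕ Fin p' → (Fin m → ℂ) × (Fin p → ℂ) → ℂ :=
    Sum.elim (fun i w => c w i) (fun i w => (f (sn 0 w.2) *ᵥ c w) i)
  have hci : ∀ i, DifferentiableOn ℂ (fun w => c w i) (Metric.ball 0 ε) := fun i => differentiableOn_pi.1 hcd i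
  have hmap : ∀ w ∈ Metric.ball (0 : (Fin m → ℂ) × (Fin p → ℂ)) ε, sn 0 w.2 ∈ typeIDomain p (m + 1) :=
    fun w hw => (hc w hw).2.1
  have hfs : DifferentiableOn ℂ (fun w : (Fin m → ℂ) × (Fin p → ℂ) => f (sn 0 w.2)) (Metric.ball 0 ε) := by
    exact hf.diff.comp (sn_diff (differentiableOn_const _) differentiable_snd.differentiableOn) hmap
  have hφ : ∀ i, DifferentiableOn ℂ (φ i) (Metric.ball 0 ε) := by
    rintro (i | i)
    · exact hci i
    · change DifferentiableOn ℂ (fun w => (f (sn 0 w.2) *ᵥ c w) i) (Metric.ball 0 ε)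
      exact differentiableOn_pi.1 (vec_diff hfs hcd) i
  obtain ⟨Φ, Qt, hΦ, hΦQ, w1, hw1, hQw1⟩ := pade hε hφ hO hOn (by
    intro w hw
    obtain ⟨Q, h1, h2, h3, h4⟩ := hQ w hw
    refine ⟨Q, h1, h2, ?_⟩
    rintro (i | i)
    · exact h3 i
    · exact h4 i)
  have hC : Differentiable ℂ (fun w => fun i : Fin q' => Φ (Sum.inl i) w) := differentiable_pi.2 fun i => hΦ _
  have hD : Differentiable ℂ (fun w => fun i : Fin p' => Φ (Sum.inr i) w) := differentiable_pi.2 fun i => hΦ _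
  refine r6 hf hqp hc0 hone hC hD ?_ ⟨w1, fun h => ?_⟩
  · have hg : ∀ w ∈ Metric.ball (0 : (Fin m → ℂ) × (Fin p → ℂ)) ε, ∀ Z ∈ typeIDomain p (m + 1), Z *ᵥ s1 w.1 = w.2 →
        f Z *ᵥ (fun i : Fin q' => Φ (Sum.inl i) w) = fun i : Fin p' => Φ (Sum.inr i) w := by
      intro w hw Z hZ hZw
      have h1 : (fun i : Fin q' => Φ (Sum.inl i) w) = Qt w • c w := funext fun i => hΦQ _ w hw
      have h2 : (fun i : Fin p' => Φ (Sum.inr i) w) = Qt w • (f (sn 0 w.2) *ᵥ c w) := funext fun i => hΦQ _ w hw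
      rw [h1, h2, mulVec_smul, (hc w hw).2.2.1 Z hZ hZw]
    have hw : Differentiable ℂ (fun x : Matrix (Fin p) (Fin (m + 1)) ℂ × (Fin m → ℂ) => (x.2, x.1 *ᵥ s1 x.2)) := by
      refine differentiable_snd.prodMk ?_
      rw [← differentiableOn_univ]
      exact vec_diff differentiable_fst.differentiableOn
        ((s1_diff (m := m)).comp differentiable_snd).differentiableOn
    have hd : DifferentiableOn ℂ (fun x : Matrix (Fin p) (Fin (m + 1)) ℂ × (Fin m → ℂ) =>
        f x.1 *ᵥ (fun i : Fin q' => Φ (Sum.inl i) (x.2, x.1 *ᵥ s1 x.2)) -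
          fun i : Fin p' => Φ (Sum.inr i) (x.2, x.1 *ᵥ s1 x.2)) (typeIDomain p (m + 1) ×ˢ univ) := by
      have hd1 : DifferentiableOn ℂ (fun x : Matrix (Fin p) (Fin (m + 1)) ℂ × (Fin m → ℂ) => f x.1)
          (typeIDomain p (m + 1) ×ˢ univ) :=
        hf.diff.comp (t := typeIDomain p (m + 1)) (f := Prod.fst) differentiable_fst.differentiableOn
          (mapsTo_fst_prod)
      refine DifferentiableOn.sub (vec_diff hd1 ?_) ?_
      · exact (hC.comp hw).differentiableOn
      · exact (hD.comp hw).differentiableOn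
    have hid := holo_ident_prod isOpen_D convex_D hd zero_mem_D 0 (by
        have h1 : ∀ᶠ x in 𝓝 ((0, 0) : Matrix (Fin p) (Fin (m + 1)) ℂ × (Fin m → ℂ)),
            (x.2, x.1 *ᵥ s1 x.2) ∈ Metric.ball (0 : (Fin m → ℂ) × (Fin p → ℂ)) ε :=
          hw.continuous.continuousAt (Metric.isOpen_ball.mem_nhds (by simpa using hε))
        have h2 : ∀ᶠ x in 𝓝 ((0, 0) : Matrix (Fin p) (Fin (m + 1)) ℂ × (Fin m → ℂ)), x.1 ∈ typeIDomain p (m + 1) :=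
          continuous_fst.continuousAt (isOpen_D.mem_nhds zero_mem_D)
        filter_upwards [h1, h2] with x hx1 hx2
        exact sub_eq_zero.2 (hg _ hx1 _ hx2 rfl))
    intro Z hZ α
    exact sub_eq_zero.1 (hid Z hZ α)
  · have := congrFun h j0
    simp only [Pi.zero_apply] at this
    rw [hΦQ _ w1 hw1] at this
    change Qt w1 * c w1 j0 = 0 at this
    rw [(hc w1 hw1).1, mul_one] at this
    exact hQw1 this

theorem part_iii : ∀ (q q' : ℕ) (f : Matrix (Fin p) (Fin (q + 1)) ℂ → Matrix (Fin p') (Fin q') ℂ),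
    PH p (q + 1) p' q' f → q' < p → q' ≤ 2 * q + 1 → p ≤ p' := by
  intro q
  induction q with
  | zero =>
    intro q' f hf hqp hq
    have h1 := PH.target_pos (by omega) (by omega) hf
    obtain rfl : q' = 1 := by omega
    exact ball_case hf
  | succ m ih =>
    intro q' f hf hqp hq
    obtain ⟨c0, hc0, hcc⟩ := part_i0 hf hqp
    by_cases hone : ∀ c, (∀ Z ∈ typeIDomain p (m + 1), ∀ Z' ∈ typeIDomain p (m + 1),
      f (sn Z 0) *ᵥ c = f (sn Z' 0) *ᵥ c) → ∃ k : ℂ, c = k • c0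
    · exact r4 hf hqp (by omega) hc0 hone
    · push Not at hone
      obtain ⟨c2, hc2, hk⟩ := hone
      have hr := hf.restrict
      obtain ⟨n, rfl⟩ : ∃ n, q' = n + 1 := by
        have h1 := PH.target_pos (by omega) (by omega) hf
        exact ⟨q' - 1, by omega⟩
      obtain ⟨g, hg, hg2⟩ := hr.drop c0 _ hc0 hcc
      obtain ⟨c3, d3, hc3, hcd3⟩ := hg2 c2 _ (fun Z hZ => hc2 Z hZ 0 zero_mem_D) hk
      obtain ⟨n, rfl⟩ : ∃ k, n = k + 1 := by
        have h1 := PH.target_pos (by omega) (by omega) hg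
        exact ⟨n - 1, by omega⟩
      obtain ⟨g2, hgg, -⟩ := hg.drop c3 d3 hc3 hcd3
      exact ih n g2 hgg (by omega) (by omega)

end PartJ7

/-- For a proper holomorphic map `f : D^I_{p,q} → D^I_{p',q'}` with `p ≥ q ≥ 2` and `q' < p`:
(i) `f` maps every `(p,q-1)`-subspace of `D^I_{p,q}` into a `(p',q'-1)`-subspace of
`D^I_{p',q'}`; (ii) `q ≤ q'`; (iii) if moreover `q' ≤ 2q - 1`, then `p ≤ p'`. -/
theorem stmt_6 (p q p' q' : ℕ) (h0p : 0 < p) (h0q : 0 < q) (h0p' : 0 < p') (h0q' : 0 < q')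
    (hqp : q ≤ p) (h2q : 2 ≤ q) (hq'p : q' < p)
    (f : Matrix (Fin p) (Fin q) ℂ → Matrix (Fin p') (Fin q') ℂ)
    (hf : DifferentiableOn ℂ f (typeIDomain p q))
    (hfp : ProperOn f (typeIDomain p q) (typeIDomain p' q')) :
    (∀ (a : Fin q → ℂ) (b : Fin p → ℂ), ∑ j, ‖b j‖ ^ 2 < ∑ i, ‖a i‖ ^ 2 →
      ∃ (c : Fin q' → ℂ) (d : Fin p' → ℂ), ∑ j, ‖d j‖ ^ 2 < ∑ i, ‖c i‖ ^ 2 ∧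
        ∀ Z ∈ typeIDomain p q, Z *ᵥ a = b → (f Z) *ᵥ c = d) ∧
    q ≤ q' ∧
    (q' ≤ 2 * q - 1 → p ≤ p') := by
  have hPH : PH p q p' q' f := ⟨hf, hfp.1, fun K h1 h2 => hfp.2 K h1 h2⟩
  obtain ⟨m, rfl⟩ : ∃ m, q = m + 1 := ⟨q - 1, by omega⟩
  exact ⟨fun a b h => part_i hPH hq'p a b h, part_ii _ _ f hPH hq'p,
    fun h => part_iii m q' f hPH hq'p (by omega)⟩
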